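/- Let d be an integer with 1 ≤ d ≤ 50 and let x, z be integers satisfying ∑_{i=1}^{2d+1} (−1)^{i−1} (x+i)³ = z². Then either (x, z) = (−d−1, 0), or (d, x, ±z) is one of: d=2: (0, ±9), (3, ±18), (69, ±612); d=4: (1, ±24), (5, ±40), (235, ±3720); d=5: (34, ±260); d=6: (0, ±35), (11, ±90); d=7: (−7, ±13), (160, ±2184); d=8: (16, ±145); d=11: (36, ±360); d=12: (−9, ±44), (0, ±91), (23, ±252), (104, ±1287), (195, ±3016); d=16: (83, ±1040); d=19: (−16, ±68), (−14, ±84), (34, ±468), (170, ±2660), (265, ±4845), (5746, ±437844); d=20: (0, ±189), (39, ±540); d=27: (−10, ±216), (84, ±1288), (98, ±1512), (39734, ±7928712); d=28: (13, ±420), (29, ±580); d=29: (−24, ±126), (405, ±9135); d=30: (−21, ±170), (0, ±341), (59, ±990), (248, ±4743), (1179, ±42130), (5208, ±379223); d=32: (−24, ±171), (319, ±6688); d=34: (16, ±561), (35, ±770), (14245, ±1706460); d=38: (2811, ±152190); d=39: (−31, ±207), (81, ±1529), (480, ±11960); d=42: (0, ±559), (83, ±1638); d=45: (8, ±702), (69,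 ±1495), (440, ±10854); d=47: (−36, ±288), (516, ±13536); d=49: (230, ±4900). Conversely, each listed (d, x, z) is a solution. -/

import Mathlib

/-- The alternating sum `(x+1)³ − (x+2)³ + ⋯ + (x+2d+1)³` of `2d+1` consecutive cubes. -/
def altCubeSum (d : ℕ) (x : ℤ) : ℤ :=
  ∑ i ∈ Finset.range (2 * d + 1), (-1 : ℤ) ^ i * (x + (i : ℤ) + 1) ^ 3

/-- The nontrivial solutions `(d, x, z)` (up to the sign of `z`) of
`altCubeSum d x = z²` for `1 ≤ d ≤ 50`. -/
def squareSolList : List (ℕ × ℤ × ℤ) :=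
  [(2, 0, 9), (2, 3, 18), (2, 69, 612),
   (4, 1, 24), (4, 5, 40), (4, 235, 3720),
   (5, 34, 260),
   (6, 0, 35), (6, 11, 90),
   (7, -7, 13), (7, 160, 2184),
   (8, 16, 145),
   (11, 36, 360),
   (12, -9, 44), (12, 0, 91), (12, 23, 252), (12, 104, 1287), (12, 195, 3016),
   (16, 83, 1040),
   (19, -16, 68), (19, -14, 84), (19, 34, 468), (19, 170, 2660), (19, 265, 4845),
   (19, 5746, 437844),
   (20, 0, 189), (20, 39, 540),
   (27, -10, 216), (27, 84, 1288), (27, 98, 1512), (27, 39734, 7928712),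
   (28, 13, 420), (28, 29, 580),
   (29, -24, 126), (29, 405, 9135),
   (30, -21, 170), (30, 0, 341), (30, 59, 990), (30, 248, 4743), (30, 1179, 42130),
   (30, 5208, 379223),
   (32, -24, 171), (32, 319, 6688),
   (34, 16, 561), (34, 35, 770), (34, 14245, 1706460),
   (38, 2811, 152190),
   (39, -31, 207), (39, 81, 1529), (39, 480, 11960),
   (42, 0, 559), (42, 83, 1638),
   (45, 8, 702), (45, 69, 1495), (45, 440, 10854),
   (47, -36, 288), (47, 516, 13536),
   (49, 230, 4900)]

/-! ### Powers in a relative unit group, in coordinates -/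

/-- The pair `(T, U)` with `T + U √(A² - 1) = (A + √(A² - 1)) ^ k`. -/
def chebPair {R : Type*} [CommRing R] (A : R) : ℕ → R × R
  | 0 => (1, 0)
  | k + 1 => (A * (chebPair A k).1 + (A ^ 2 - 1) * (chebPair A k).2,
      A * (chebPair A k).2 + (chebPair A k).1)

section chebPair

variable {R : Type*} [CommRing R] (A : R)

theorem chebPair_succ (k : ℕ) : chebPair A (k + 1) =
    (A * (chebPair A k).1 + (A ^ 2 - 1) * (chebPair A k).2,
      A * (chebPair A k).2 + (chebPair A k).1) := rfl

theorem chebPair_add (k l : ℕ) : chebPair A (k + l) =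
    ((chebPair A k).1 * (chebPair A l).1 + (A ^ 2 - 1) * (chebPair A k).2 * (chebPair A l).2,
      (chebPair A k).1 * (chebPair A l).2 + (chebPair A k).2 * (chebPair A l).1) := by
  induction l with
  | zero => simp [chebPair]
  | succ l ih =>
    rw [← add_assoc, chebPair_succ, ih, chebPair_succ]
    ext <;> ring

theorem chebPair_norm (k : ℕ) :
    (chebPair A k).1 ^ 2 - (A ^ 2 - 1) * (chebPair A k).2 ^ 2 = 1 := by
  induction k with
  | zero => simp [chebPair]
  | succ k ih =>
    rw [chebPair_succ]
    linear_combination ih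

theorem chebPair_mul (k l : ℕ) : chebPair A (k * l) =
    ((chebPair (chebPair A l).1 k).1, (chebPair (chebPair A l).1 k).2 * (chebPair A l).2) := by
  induction k with
  | zero => simp [chebPair]
  | succ k ih =>
    have h := chebPair_norm A l
    rw [add_mul, one_mul, chebPair_add, ih, chebPair_succ]
    ext
    · linear_combination -(chebPair (chebPair A l).1 k).2 * h
    · ring

/-- If `A ≡ 1` modulo `m`, then `(T, U) ≡ (1, k)`. -/
theorem chebPair_modEq {m : R} (hA : m ∣ A - 1) (k : ℕ) :
    m ∣ (chebPair A k).1 - 1 ∧ m ∣ (chebPair A k).2 - k := by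
  obtain ⟨c, hc⟩ := hA
  have hA' : A = 1 + m * c := by linear_combination hc
  induction k with
  | zero => simp [chebPair]
  | succ k ih =>
    obtain ⟨⟨t, ht⟩, ⟨u, hu⟩⟩ := ih
    have ht' : (chebPair A k).1 = 1 + m * t := by linear_combination ht
    have hu' : (chebPair A k).2 = k + m * u := by linear_combination hu
    rw [chebPair_succ, ht', hu', hA']
    constructor
    · exact ⟨t + c * (1 + m * t) + c * (2 + m * c) * (k + m * u), by ring⟩
    · exact ⟨u + t + c * (k + m * u), by push_cast; ring⟩

/-- For an odd prime `p` and `A ≡ 1` modulo `p²`, the second coordinate of a proper power is a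
power of `p` times an integer prime to `p`, up to higher order terms. -/
theorem chebPair_snd_eq_pow_mul {p : ℕ} (hp : p.Prime) :
    ∀ (k : ℕ) (_ : 0 < k) (A : R) (_ : (p : R) ^ 2 ∣ A - 1),
      ∃ (e : ℕ) (m : ℤ) (c : R), ¬ (p : ℤ) ∣ m ∧
        (chebPair A k).2 = (p : R) ^ e * (m + p * c) := by
  intro k
  induction k using Nat.strong_induction_on with
  | _ k ih =>
    intro hk A hA
    by_cases hpk : p ∣ k
    · obtain ⟨l, rfl⟩ := hpk
      have hl : 0 < l := Nat.pos_of_mul_pos_left hk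
      obtain ⟨h1, u, hu⟩ := chebPair_modEq A hA p
      obtain ⟨e, m, c, hm, hc⟩ := ih l (by nlinarith [hp.two_le]) hl _ h1
      refine ⟨e + 1, m, c + u * (m + p * c), hm, ?_⟩
      have hu' : (chebPair A p).2 = p + p ^ 2 * u := by linear_combination hu
      rw [mul_comm p l, chebPair_mul, hc, hu']
      ring
    · obtain ⟨-, u, hu⟩ := chebPair_modEq A hA k
      refine ⟨0, k, p * u, by exact_mod_cast hpk, ?_⟩
      push_cast
      linear_combination hu

theorem map_chebPair {S : Type*} [CommRing S] (f : R →+* S) (k : ℕ) :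
    chebPair (f A) k = (f (chebPair A k).1, f (chebPair A k).2) := by
  induction k with
  | zero => simp [chebPair]
  | succ k ih => rw [chebPair_succ, ih, chebPair_succ]; simp

end chebPair

theorem chebPair_cosh (θ : ℝ) (k : ℕ) : (chebPair (Real.cosh θ) k).1 = Real.cosh (k * θ) ∧
    (chebPair (Real.cosh θ) k).2 * Real.sinh θ = Real.sinh (k * θ) := by
  induction k with
  | zero => simp [chebPair]
  | succ k ih =>
    obtain ⟨h1, h2⟩ := ih
    have h3 := Real.cosh_sq θ
    push_cast
    rw [chebPair_succ, add_mul, one_mul, Real.cosh_add, Real.sinh_add, ← h1, ← h2]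
    constructor
    · linear_combination (chebPair (Real.cosh θ) k).2 * h3
    · ring

set_option maxHeartbeats 600000 in
/-- Two relative units of `ℤ√n` over which `√(2σ/a)` generates a field with relative unit rank one
are commensurable. -/
theorem exists_chebPair_eq {n : ℤ} (hn : 0 ≤ n) (hsq : ∀ m : ℤ, n ≠ m * m) {a r : ℤ} (ha : 0 < a)
    (hr : 0 ≤ r) (hneg : a ^ 2 < n * r ^ 2) {A B A' B' : ℤ√n}
    (h : (a : ℤ√n) * (A ^ 2 - 1) = 2 * (⟨a, r⟩ : ℤ√n) * B ^ 2)
    (h' : (a : ℤ√n) * (A' ^ 2 - 1) = 2 * (⟨a, r⟩ : ℤ√n) * B' ^ 2)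
    (hA : 0 < Zsqrtd.toReal hn A) (hA' : 0 < Zsqrtd.toReal hn A') (hB' : B' ≠ 0) :
    ∃ k : ℕ, 0 < k ∧ ∃ (j : ℕ) (s : ℤ), s ^ 2 = 1 ∧
      B * (chebPair A k).2 = s * B' * (chebPair A' j).2 := by
  have hnR : (0 : ℝ) ≤ n := by exact_mod_cast hn
  have hw : Real.sqrt n * Real.sqrt n = n := Real.mul_self_sqrt hnR
  set φ : ℤ√n →+* ℝ := Zsqrtd.toReal hn with hφ
  let ψ : ℤ√n →+* ℝ := Zsqrtd.lift ⟨-Real.sqrt n, by linear_combination hw⟩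
  have φ_apply : ∀ z : ℤ√n, φ z = z.re + z.im * Real.sqrt n := fun z => rfl
  have ψ_apply : ∀ z : ℤ√n, ψ z = z.re + z.im * -Real.sqrt n := fun z => rfl
  have φinj : Function.Injective φ := Zsqrtd.toReal_injective hn hsq
  have haR : (0 : ℝ) < a := by exact_mod_cast ha
  have hrR : (0 : ℝ) ≤ r := by exact_mod_cast hr
  have hnegR : (a : ℝ) ^ 2 < n * r ^ 2 := by exact_mod_cast hneg
  set σ : ℤ√n := ⟨a, r⟩ with hσ
  have hσ1 : 0 < φ σ := by
    rw [φ_apply]; have := Real.sqrt_nonneg (n : ℝ); simp only [hσ]; positivity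
  have hσ2 : ψ σ < 0 := by
    rw [ψ_apply]
    simp only [hσ]
    have : (a : ℝ) < r * Real.sqrt n := by
      apply lt_of_pow_lt_pow_left₀ 2 (by positivity)
      rw [mul_pow, Real.sq_sqrt hnR]; linarith
    linarith
  set β := Real.sqrt (2 * φ σ / a) with hβ
  have hβ0 : 0 < β := Real.sqrt_pos.2 (by positivity)
  have hβ2 : β ^ 2 * a = 2 * φ σ := by
    rw [Real.sq_sqrt (by positivity)]; field_simp
  have angle : ∀ {C D : ℤ√n}, (a : ℤ√n) * (C ^ 2 - 1) = 2 * σ * D ^ 2 → 0 < φ C →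
      ∃ θ : ℝ, φ C = Real.cosh θ ∧ φ D * β = Real.sinh θ := by
    intro C D hCD hC
    refine ⟨Real.arsinh (φ D * β), ?_, (Real.sinh_arsinh _).symm⟩
    have e := congrArg φ hCD
    simp only [map_mul, map_sub, map_pow, map_one, map_intCast, map_ofNat] at e
    rw [Real.cosh_arsinh, eq_comm, Real.sqrt_eq_iff_mul_self_eq_of_pos hC]
    apply mul_left_cancel₀ haR.ne'
    linear_combination e - (φ D) ^ 2 * hβ2
  obtain ⟨θ, hθ1, hθ2⟩ := angle h hA
  obtain ⟨θ', hθ1', hθ2'⟩ := angle h' hA'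
  have hθ' : θ' ≠ 0 := by
    rintro rfl
    rw [Real.sinh_zero] at hθ2'
    rcases mul_eq_zero.1 hθ2' with h0 | h0
    · exact hB' (φinj (by rw [h0, map_zero]))
    · exact hβ0.ne' h0
  obtain ⟨δ, hδ, hδc⟩ : ∃ δ > 0, ∀ x : ℝ, |x| < δ → 2 * (a : ℝ) ^ 2 * (Real.cosh x - 1) < 1 := by
    have hc : Filter.Tendsto (fun x : ℝ => 2 * (a : ℝ) ^ 2 * (Real.cosh x - 1)) (nhds 0)
        (nhds (2 * (a : ℝ) ^ 2 * (Real.cosh 0 - 1))) :=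
      (Continuous.tendsto (by fun_prop) 0)
    rw [Real.cosh_zero, sub_self, mul_zero] at hc
    obtain ⟨δ, hδ, hb⟩ := Metric.eventually_nhds_iff.1 (hc.eventually_lt_const one_pos)
    exact ⟨δ, hδ, fun x hx => hb (by simpa [Real.dist_eq] using hx)⟩
  obtain ⟨N, hN⟩ := exists_nat_gt (|θ'| / δ)
  have hθ'0 : 0 < |θ'| := abs_pos.2 hθ'
  have hN0 : 0 < N := by
    have : (0 : ℝ) < N := lt_of_le_of_lt (by positivity) hN
    exact_mod_cast this
  obtain ⟨j, k, hk0, -, hjk⟩ := Real.exists_int_int_abs_mul_sub_le (θ / θ') hN0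
  have hclose : |k * θ - j * θ'| < δ := by
    have e : k * θ - j * θ' = (k * (θ / θ') - j) * θ' := by field_simp
    rw [e, abs_mul]
    have : |θ'| < δ * N := by rw [div_lt_iff₀ hδ] at hN; linarith
    calc _ ≤ 1 / ((N : ℝ) + 1) * |θ'| := by gcongr
      _ < δ := by rw [div_mul_eq_mul_div, one_mul, div_lt_iff₀ (by positivity)]; linarith
  lift k to ℕ using hk0.le
  rw [Int.cast_natCast] at hclose
  have hk : 0 < k := by exact_mod_cast hk0
  obtain ⟨i, s, hs, hjs⟩ : ∃ (i : ℕ) (s : ℤ), s ^ 2 = 1 ∧ j = s * i := by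
    rcases Int.eq_nat_or_neg j with ⟨i, rfl | rfl⟩
    · exact ⟨i, 1, by norm_num, by simp⟩
    · exact ⟨i, -1, by norm_num, by simp⟩
  have hsR : (s : ℝ) = 1 ∨ (s : ℝ) = -1 := by
    rcases (Int.isUnit_iff.1 (IsUnit.of_pow_eq_one hs two_ne_zero)) with h1 | h1 <;> simp [h1]
  refine ⟨k, hk, i, s, hs, ?_⟩
  have hT := chebPair_cosh θ k
  have hT' := chebPair_cosh θ' i
  rw [← hθ1, map_chebPair _ φ] at hT
  rw [← hθ1', map_chebPair _ φ] at hT'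
  obtain ⟨hT1, hU1⟩ := hT
  obtain ⟨hT2, hU2⟩ := hT'
  simp only at hT1 hU1 hT2 hU2
  have hcs : Real.cosh (i * θ') = Real.cosh (j * θ') ∧
      s * Real.sinh (i * θ') = Real.sinh (j * θ') := by
    rw [hjs]; push_cast
    rcases hsR with h1 | h1 <;> simp [h1]
  set T := (chebPair A k).1
  set U := (chebPair A k).2
  set T' := (chebPair A' i).1
  set U' := (chebPair A' i).2
  set H : ℤ√n := a * (T * T') - s * (2 * σ * (B * B' * U * U')) with hH
  have hφH : φ H = a * Real.cosh (k * θ - j * θ') := by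
    rw [Real.cosh_sub, ← hcs.1, ← hcs.2, ← hT1, ← hT2, ← hU1, ← hU2, ← hθ2, ← hθ2', hH]
    simp only [map_mul, map_sub, map_intCast, map_ofNat]
    linear_combination (s : ℝ) * φ B * φ B' * φ U * φ U' * hβ2
  have hψ : ∀ {C D : ℤ√n}, (a : ℤ√n) * (C ^ 2 - 1) = 2 * σ * D ^ 2 → ∀ k : ℕ,
      (a : ℝ) * ψ (chebPair C k).1 ^ 2 - 2 * ψ σ * (ψ D * ψ (chebPair C k).2) ^ 2 = a := by
    intro C D hCD k
    have e := congrArg ψ hCD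
    have e2 := congrArg ψ (chebPair_norm C k)
    simp only [map_mul, map_sub, map_pow, map_one, map_intCast, map_ofNat] at e e2
    linear_combination a * e2 + ψ (chebPair C k).2 ^ 2 * e
  have hψH : |ψ H| ≤ a := by
    have e1 := hψ h k
    have e2 := hψ h' i
    have e3 : ψ H = a * (ψ T * ψ T') - s * (2 * ψ σ * (ψ B * ψ B' * ψ U * ψ U')) := by
      rw [hH]; simp only [map_mul, map_sub, map_intCast, map_ofNat]
    rw [e3, abs_le]
    change (a : ℝ) * ψ T ^ 2 - 2 * ψ σ * (ψ B * ψ U) ^ 2 = a at e1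
    change (a : ℝ) * ψ T' ^ 2 - 2 * ψ σ * (ψ B' * ψ U') ^ 2 = a at e2
    have g1 := mul_nonneg haR.le (sq_nonneg (ψ T - ψ T'))
    have g2 := mul_nonneg haR.le (sq_nonneg (ψ T + ψ T'))
    have g3 := mul_nonneg (neg_nonneg.2 hσ2.le) (sq_nonneg (ψ B * ψ U - ψ B' * ψ U'))
    have g4 := mul_nonneg (neg_nonneg.2 hσ2.le) (sq_nonneg (ψ B * ψ U + ψ B' * ψ U'))
    rcases hsR with h1 | h1 <;> rw [h1] <;> constructor <;> linarith
  have hnorm : (H - a).norm = 0 := by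
    have e : (((H - a).norm : ℤ) : ℝ) = φ (H - a) * ψ (H - a) := by
      rw [φ_apply, ψ_apply, Zsqrtd.norm_def]; push_cast
      linear_combination ((H - a).im : ℝ) ^ 2 * hw
    rw [← Int.abs_lt_one_iff]
    have : |(((H - a).norm : ℤ) : ℝ)| < 1 := by
      rw [e, abs_mul, map_sub φ H, map_sub ψ H, map_intCast, map_intCast, hφH]
      have hc1 := Real.one_le_cosh (k * θ - j * θ')
      have f1 : |a * Real.cosh (k * θ - j * θ') - a| = a * (Real.cosh (k * θ - j * θ') - 1) := by
        rw [← mul_sub_one, abs_of_nonneg (mul_nonneg haR.le (by linarith))]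
      have f2 : |ψ H - a| ≤ 2 * a := by
        rw [abs_le] at hψH ⊢; constructor <;> linarith
      rw [f1]
      calc _ ≤ a * (Real.cosh (k * θ - j * θ') - 1) * (2 * a) := by
            apply mul_le_mul_of_nonneg_left f2
            exact mul_nonneg haR.le (by linarith)
        _ < 1 := by have := hδc _ hclose; linarith
    exact_mod_cast this
  have hHa : H = a := by
    have := (Zsqrtd.norm_eq_zero hsq _).1 hnorm
    linear_combination this
  have hzero : k * θ = j * θ' := by
    have e : (a : ℝ) * Real.cosh (k * θ - j * θ') = a * 1 := by
      rw [← hφH, hHa, map_intCast, mul_one]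
    have := mul_left_cancel₀ haR.ne' e
    by_contra hne
    exact (Real.one_lt_cosh.2 (sub_ne_zero.2 hne)).ne' this
  apply φinj
  apply mul_right_cancel₀ hβ0.ne'
  simp only [map_mul, map_intCast]
  have : Real.sinh (k * θ) = s * Real.sinh (i * θ') := by rw [hcs.2, hzero]
  rw [← hU1, ← hU2, ← hθ2, ← hθ2'] at this
  linear_combination this

theorem Zsqrtd.re_pow_mul {n : ℤ} (p e : ℕ) (z : ℤ√n) :
    ((p : ℤ√n) ^ e * z).re = (p : ℤ) ^ e * z.re := by
  rw [show (p : ℤ√n) ^ e = (((p : ℤ) ^ e : ℤ) : ℤ√n) by push_cast; rfl, Zsqrtd.re_mul,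
    Zsqrtd.re_intCast, Zsqrtd.im_intCast]
  ring

theorem Zsqrtd.im_pow_mul {n : ℤ} (p e : ℕ) (z : ℤ√n) :
    ((p : ℤ√n) ^ e * z).im = (p : ℤ) ^ e * z.im := by
  rw [show (p : ℤ√n) ^ e = (((p : ℤ) ^ e : ℤ) : ℤ√n) by push_cast; rfl, Zsqrtd.im_mul,
    Zsqrtd.re_intCast, Zsqrtd.im_intCast]
  ring

/-- Relative units whose second coordinates have independent directions modulo `p` have no common
power. -/
theorem chebPair_mul_ne {n : ℤ} {p : ℕ} (hp : p.Prime) {A A' β β' : ℤ√n} {v v' : ℕ} {s : ℤ}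
    (hs : s ^ 2 = 1) (hA : (p : ℤ√n) ^ 2 ∣ A - 1) (hA' : (p : ℤ√n) ^ 2 ∣ A' - 1)
    (hre : (p : ℤ) ∣ β.re) (him : ¬ (p : ℤ) ∣ β.im) (hre' : ¬ (p : ℤ) ∣ β'.re)
    {k j : ℕ} (hk : 0 < k) :
    (p : ℤ√n) ^ v * β * (chebPair A k).2 ≠ s * ((p : ℤ√n) ^ v' * β') * (chebPair A' j).2 := by
  intro h
  have hpZ : Prime (p : ℤ) := Nat.prime_iff_prime_int.1 hp
  have hs' : ¬ (p : ℤ) ∣ s := fun hd => hpZ.not_dvd_one (hs ▸ dvd_pow hd two_ne_zero)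
  obtain ⟨e, m, c, hm, hc⟩ := chebPair_snd_eq_pow_mul hp k hk A hA
  have hL : (p : ℤ√n) ^ v * β * (chebPair A k).2 =
      (p : ℤ√n) ^ (v + e) * ((m : ℤ) * β + ((p : ℤ) : ℤ√n) * (c * β)) := by
    rw [hc]; push_cast; ring
  obtain ⟨f, z, hz, hz0⟩ : ∃ (f : ℕ) (z : ℤ√n), (z ≠ 0 → ¬ (p : ℤ) ∣ z.re) ∧
      s * ((p : ℤ√n) ^ v' * β') * (chebPair A' j).2 = (p : ℤ√n) ^ f * z := by
    rcases Nat.eq_zero_or_pos j with rfl | hj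
    · exact ⟨0, 0, by simp, by simp [chebPair]⟩
    · obtain ⟨e', m', c', hm', hc'⟩ := chebPair_snd_eq_pow_mul hp j hj A' hA'
      refine ⟨v' + e', ((s * m' : ℤ) : ℤ√n) * β' + ((p : ℤ) : ℤ√n) * (s * c' * β'),
        fun _ hd => ?_, ?_⟩
      · rw [Zsqrtd.re_add, Zsqrtd.re_mul, Zsqrtd.re_mul (p : ℤ)] at hd
        simp only [Zsqrtd.re_intCast, Zsqrtd.im_intCast, mul_zero, zero_mul, add_zero] at hd
        rw [Int.dvd_add_left (Dvd.intro _ rfl), hpZ.dvd_mul, hpZ.dvd_mul] at hd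
        tauto
      · rw [hc']; push_cast; ring
  rw [hL, hz0] at h
  have h1 := congrArg Zsqrtd.re h
  have h2 := congrArg Zsqrtd.im h
  rw [Zsqrtd.re_pow_mul, Zsqrtd.re_pow_mul] at h1
  rw [Zsqrtd.im_pow_mul, Zsqrtd.im_pow_mul] at h2
  simp only [Zsqrtd.re_add, Zsqrtd.im_add, Zsqrtd.re_mul, Zsqrtd.im_mul (m : ℤ√n),
    Zsqrtd.im_mul ((p : ℤ) : ℤ√n), Zsqrtd.re_intCast, Zsqrtd.im_intCast, mul_zero, zero_mul,
    add_zero] at h1 h2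
  obtain ⟨b, hb⟩ := hre
  set w := m * β.im + p * (c * β).im with hw
  have hwp : ¬ (p : ℤ) ∣ w := by
    rw [hw, Int.dvd_add_left (Dvd.intro _ rfl), hpZ.dvd_mul]; tauto
  have hpow : ∀ i : ℕ, (p : ℤ) ^ i ≠ 0 := fun i => pow_ne_zero _ hpZ.ne_zero
  have hz1 : z ≠ 0 := by
    rintro rfl
    simp only [Zsqrtd.im_zero, mul_zero, mul_eq_zero, hpow, false_or] at h2
    exact hwp (h2 ▸ dvd_zero _)
  have hzp := hz hz1
  have d1 : (p : ℤ) ^ (v + e + 1) ∣ (p : ℤ) ^ f := by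
    refine (hpZ.coprime_iff_not_dvd.2 hzp).pow_left.dvd_of_dvd_mul_right ?_
    rw [← h1, hb, pow_succ]
    exact ⟨m * b + (c * β).re + n * 0, by rw [Zsqrtd.re_mul, hb]; ring⟩
  have d2 : (p : ℤ) ^ f ∣ (p : ℤ) ^ (v + e) :=
    (hpZ.coprime_iff_not_dvd.2 hwp).pow_left.dvd_of_dvd_mul_right (Dvd.intro _ h2.symm)
  have hu : ¬ IsUnit (p : ℤ) := hpZ.not_isUnit
  have l1 := (pow_dvd_pow_iff hpZ.ne_zero hu).1 d1
  have l2 := (pow_dvd_pow_iff hpZ.ne_zero hu).1 d2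
  omega

theorem chebPair_toReal_pos {n : ℤ} (hn : 0 ≤ n) {A : ℤ√n} (hA : 0 < Zsqrtd.toReal hn A)
    (hA1 : 0 ≤ Zsqrtd.toReal hn (A ^ 2 - 1)) (k : ℕ) :
    0 < Zsqrtd.toReal hn (chebPair A k).1 ∧ 0 ≤ Zsqrtd.toReal hn (chebPair A k).2 := by
  induction k with
  | zero => simp [chebPair]
  | succ k ih =>
    obtain ⟨h1, h2⟩ := ih
    rw [chebPair_succ]
    constructor
    · simp only [map_add, map_mul]
      positivity
    · simp only [map_add, map_mul]
      positivity

/-- If `A + 2 p ^ v B` has norm one and `A` is congruent to one modulo `p ^ (2 v)`, then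
`p ∣ B.re`. -/
theorem dvd_re_of_norm_eq_one {n : ℤ} {p : ℕ} (hp : p.Prime) (hp2 : p ≠ 2) {A B : ℤ√n} {v : ℕ}
    (hv : 0 < v) (hA : (p : ℤ√n) ^ (2 * v) ∣ A - 1)
    (hN : (A + 2 * ((p : ℤ√n) ^ v * B)).norm = 1) : (p : ℤ) ∣ B.re := by
  obtain ⟨w, rfl⟩ : ∃ w, v = w + 1 := ⟨v - 1, by omega⟩
  obtain ⟨C, hC⟩ := hA
  have hpZ : Prime (p : ℤ) := Nat.prime_iff_prime_int.1 hp
  have e : A + 2 * ((p : ℤ√n) ^ (w + 1) * B) =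
      ⟨1 + p ^ (w + 1) * (2 * B.re + p ^ (w + 1) * C.re),
        p ^ (w + 1) * (2 * B.im + p ^ (w + 1) * C.im)⟩ := by
    have : A = 1 + (p : ℤ√n) ^ (w + 1) * ((p : ℤ√n) ^ (w + 1) * C) := by
      linear_combination hC
    have h2 : A + 2 * ((p : ℤ√n) ^ (w + 1) * B) =
        1 + (p : ℤ√n) ^ (w + 1) * (B + B + (p : ℤ√n) ^ (w + 1) * C) := by
      linear_combination this
    rw [h2]
    ext
    · rw [Zsqrtd.re_add, Zsqrtd.re_pow_mul, Zsqrtd.re_add, Zsqrtd.re_pow_mul, Zsqrtd.re_add,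
        Zsqrtd.re_one]
      ring
    · rw [Zsqrtd.im_add, Zsqrtd.im_pow_mul, Zsqrtd.im_add, Zsqrtd.im_pow_mul, Zsqrtd.im_add,
        Zsqrtd.im_one]
      ring
  rw [e, Zsqrtd.norm_def] at hN
  have hq : (p : ℤ) ^ (w + 1) ≠ 0 := pow_ne_zero _ hpZ.ne_zero
  have h4 : (p : ℤ) ∣ 4 * B.re := by
    set q : ℤ := (p : ℤ) ^ (w + 1) with hqd
    have h0 : 4 * B.re = q * (n * (2 * B.im + q * C.im) ^ 2 - (2 * B.re + q * C.re) ^ 2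
        - 2 * C.re) := by
      apply mul_left_cancel₀ hq
      simp only at hN
      linear_combination hN
    rw [h0, hqd, pow_succ]
    exact ⟨_, by rw [mul_comm _ (p : ℤ), mul_assoc]⟩
  refine (hpZ.dvd_mul.1 h4).resolve_left fun h => ?_
  have h2 : (p : ℤ) ∣ ((2 : ℕ) : ℤ) := hpZ.dvd_of_dvd_pow (n := 2) (by simpa using h)
  exact hp2 ((Nat.prime_dvd_prime_iff_eq hp Nat.prime_two).1 (by exact_mod_cast h2))

theorem exists_eq_pow_mul {n : ℤ} {p : ℕ} (hp : p.Prime) {z : ℤ√n} (hz : z ≠ 0) :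
    ∃ (v : ℕ) (y : ℤ√n), z = (p : ℤ√n) ^ v * y ∧ ¬ (p : ℤ√n) ∣ y := by
  have hfin : FiniteMultiplicity (p : ℤ√n) z := by
    have h0 : z.re ≠ 0 ∨ z.im ≠ 0 := by
      by_contra! h
      exact hz (Zsqrtd.ext h.1 h.2)
    have hu : ¬ IsUnit (p : ℤ) := (Nat.prime_iff_prime_int.1 hp).not_isUnit
    rcases h0 with h0 | h0
    · obtain ⟨k, hk⟩ := Int.finiteMultiplicity_iff.2
        ⟨fun h => hu (Int.isUnit_iff_natAbs_eq.2 h), h0⟩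
      exact ⟨k, fun ⟨y, hy⟩ => hk ⟨y.re, by rw [hy, Zsqrtd.re_pow_mul]⟩⟩
    · obtain ⟨k, hk⟩ := Int.finiteMultiplicity_iff.2
        ⟨fun h => hu (Int.isUnit_iff_natAbs_eq.2 h), h0⟩
      exact ⟨k, fun ⟨y, hy⟩ => hk ⟨y.im, by rw [hy, Zsqrtd.im_pow_mul]⟩⟩
  obtain ⟨y, h1, h2⟩ := hfin.exists_eq_pow_mul_and_not_dvd
  exact ⟨_, y, h1, h2⟩

section relativeUnit

variable {R : Type*} [CommRing R] {a c e r n P Q ω s : R}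

theorem pow_four_sub_one_of_norm (hω : ω ^ 2 = n) (hN : P ^ 2 - n * Q ^ 2 = 1) :
    ((P + Q * ω) ^ 2) ^ 2 - 1 = 2 * (2 * P * Q) * ω * (P + Q * ω) ^ 2 := by
  have h : P ^ 2 - Q ^ 2 * ω ^ 2 = 1 := by linear_combination hN - Q ^ 2 * hω
  linear_combination (P ^ 2 - Q ^ 2 * ω ^ 2 + 1) * h

theorem mul_pow_four_sub_one (hω : ω ^ 2 = n) (hN : P ^ 2 - n * Q ^ 2 = 1)
    (hnac : n = c * a) (hcr : c * r ^ 2 = a + e)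
    (hs : s ^ 2 = P ^ 2 + n * Q ^ 2 + 2 * (c * r) * P * Q) :
    e * (((P + Q * ω) ^ 2) ^ 2 - 1) =
      2 * (a + r * ω) * ((s * (P + Q * ω)) ^ 2 - ((P + Q * ω) ^ 2) ^ 2) := by
  have h1 := pow_four_sub_one_of_norm hω hN
  have h2 : s ^ 2 - (P + Q * ω) ^ 2 = 2 * P * Q * (c * r - ω) := by
    linear_combination hs - Q ^ 2 * hω
  have h3 : (a + r * ω) * (c * r - ω) = e * ω := by
    linear_combination (-r) * hω + ω * hcr - r * hnac
  linear_combination e * h1 - 2 * (a + r * ω) * (P + Q * ω) ^ 2 * h2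
    - 2 * (P + Q * ω) ^ 2 * (2 * P * Q) * h3

theorem sq_add_mul_eq (hω : ω ^ 2 = n) (hnac : n = c * a) (hcr : c * r ^ 2 = a + e) :
    (a + r * ω) ^ 2 = a * (2 * (a + r * ω) + e) := by
  linear_combination r ^ 2 * hω + a * hcr + r ^ 2 * hnac

theorem relative_unit_of_sq_sub_one {σ T q : R} (hσ : σ ^ 2 = a * (2 * σ + e))
    (hT : T ^ 2 - 1 = 2 * (q * σ) * (e * q + 2 * T)) :
    a * ((T - 2 * (q * σ)) ^ 2 - 1) = 2 * σ * (q * σ) ^ 2 := by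
  linear_combination a * hT - 2 * (q * σ) * q * hσ

end relativeUnit

set_option maxHeartbeats 1600000 in
/-- A norm-one unit `P + Q√n` close to `1` at `p` and making `P² + nQ² + 2crPQ` a square is
trivial, provided some relative unit has a power whose second coordinate points in another
direction modulo `p`. -/
theorem eq_zero_of_relative_unit {n a c e r : ℤ} {p : ℕ} (hp : p.Prime) (hp2 : p ≠ 2)
    (hnac : n = c * a) (hc : 0 < c) (ha : 0 < a) (he : 0 < e) (hr : 0 < r)
    (hcr : c * r ^ 2 = a + e) (hsq : ∀ m : ℤ, n ≠ m * m) (hpa : ¬ (p : ℤ) ∣ a)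
    (hroot : ∀ s : ℤ, e * p ∣ s ^ 2 - 1 → e * p ∣ s - 1 ∨ e * p ∣ s + 1)
    {A' B' β' : ℤ√n} {v' : ℕ}
    (h' : (a : ℤ√n) * (A' ^ 2 - 1) = 2 * (⟨a, r⟩ : ℤ√n) * B' ^ 2)
    (hre' : 0 < A'.re) (him' : 0 ≤ A'.im) {L : ℕ}
    (hA' : (p : ℤ√n) ^ 2 ∣ (chebPair A' L).1 - 1)
    (hB' : B' * (chebPair A' L).2 = (p : ℤ√n) ^ v' * β') (hβ' : ¬ (p : ℤ) ∣ β'.re)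
    {P Q s : ℤ} (hN : P ^ 2 - n * Q ^ 2 = 1) (hP : e * p ∣ P - 1) (hQ : e * p ∣ Q)
    (hs : s ^ 2 = P ^ 2 + n * Q ^ 2 + 2 * (c * r) * P * Q) : P * Q = 0 := by
  by_contra hPQ
  have hn : 0 ≤ n := by rw [hnac]; positivity
  have hpZ : Prime (p : ℤ) := Nat.prime_iff_prime_int.1 hp
  have hp0 : (p : ℤ√n) ≠ 0 := by
    intro h; have := congrArg Zsqrtd.re h; simp at this; exact hp.ne_zero this
  set φ : ℤ√n →+* ℝ := Zsqrtd.toReal hn with hφ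
  have φ_apply : ∀ z : ℤ√n, φ z = z.re + z.im * Real.sqrt n := fun z => rfl
  have φinj : Function.Injective φ := Zsqrtd.toReal_injective hn hsq
  have haR : (0 : ℝ) < a := by exact_mod_cast ha
  set σ : ℤ√n := ⟨a, r⟩ with hσ
  have hσ1 : 0 < φ σ := by
    rw [φ_apply]; have := Real.sqrt_nonneg (n : ℝ)
    have : (0 : ℝ) < r := by exact_mod_cast hr
    simp only [hσ]; positivity
  have one_le : ∀ {C D : ℤ√n}, (a : ℤ√n) * (C ^ 2 - 1) = 2 * σ * D ^ 2 →
      0 ≤ φ (C ^ 2 - 1) := by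
    intro C D h
    have h1 := congrArg φ h
    simp only [map_mul, map_pow, map_intCast, map_ofNat] at h1
    have : 0 ≤ (a : ℝ) * φ (C ^ 2 - 1) := by rw [h1]; positivity
    exact nonneg_of_mul_nonneg_right this haR
  -- the sign of `s`
  obtain ⟨P₁, hP₁⟩ := hP
  obtain ⟨Q₁, hQ₁⟩ := hQ
  obtain ⟨s', hs's, s₁, hs₁⟩ : ∃ s' : ℤ, s' ^ 2 = s ^ 2 ∧ e * p ∣ s' - 1 := by
    have : e * p ∣ s ^ 2 - 1 := by
      rw [hs]
      exact ⟨2 * n * Q * Q₁ + 2 * (c * r) * P * Q₁, by linear_combination hN +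
        (2 * n * Q + 2 * (c * r) * P) * hQ₁⟩
    rcases hroot s this with h | h
    · exact ⟨s, rfl, h⟩
    · exact ⟨-s, by ring, by
        rw [show -s - 1 = -(s + 1) by ring]; exact dvd_neg.2 h⟩
  rw [← hs's] at hs
  -- the relative unit attached to the solution
  have hω : (⟨0, 1⟩ : ℤ√n) ^ 2 = n := by
    rw [pow_two]; ext <;> simp
  set ω : ℤ√n := ⟨0, 1⟩ with hωd
  have hσω : σ = a + r * ω := by ext <;> simp [hσ, hωd]
  set D : ℤ√n := P + Q * ω with hD
  set T : ℤ√n := D ^ 2 with hT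
  set z : ℤ√n := ((s₁ - P₁ : ℤ) - Q₁ * ω) * D with hz
  have hs1' : (s' : ℤ√n) = 1 + e * p * s₁ := by
    have : s' = 1 + e * p * s₁ := by linear_combination hs₁
    rw [this]; push_cast; ring
  have hP1' : (P : ℤ√n) = 1 + e * p * P₁ := by
    have : P = 1 + e * p * P₁ := by linear_combination hP₁
    rw [this]; push_cast; ring
  have hQ1' : (Q : ℤ√n) = e * p * Q₁ := by rw [hQ₁]; push_cast; ring
  have hΔ : s' * D - T = e * p * z := by
    rw [hz, hT]
    push_cast
    linear_combination D * hs1' - D * hP1' - D * ω * hQ1' - D * hD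
  have hN' : (P : ℤ√n) ^ 2 - n * (Q : ℤ√n) ^ 2 = 1 := by exact_mod_cast congrArg (Int.cast) hN
  have hs' : (s' : ℤ√n) ^ 2 = P ^ 2 + n * Q ^ 2 + 2 * (c * r) * P * Q := by
    exact_mod_cast congrArg (Int.cast) hs
  have hcr' : (c : ℤ√n) * r ^ 2 = a + e := by exact_mod_cast congrArg (Int.cast) hcr
  have hnac' : (n : ℤ√n) = c * a := by exact_mod_cast congrArg (Int.cast) hnac
  have he0 : (e : ℤ√n) ≠ 0 := by exact_mod_cast he.ne'
  have ha0 : (a : ℤ√n) ≠ 0 := by exact_mod_cast ha.ne'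
  obtain ⟨B, hB⟩ : ∃ B : ℤ√n, B = p * z * σ := ⟨_, rfl⟩
  obtain ⟨A, hA⟩ : ∃ A : ℤ√n, A = T - 2 * B := ⟨_, rfl⟩
  have hpT : (p : ℤ√n) ∣ T - 1 := by
    refine ⟨e * (P₁ + Q₁ * ω) * (D + 1), ?_⟩
    rw [hT, hD]
    linear_combination (D + 1) * hP1' + ω * (D + 1) * hQ1'
  have hTN : T.norm = 1 := by
    have hDn : D = ⟨P, Q⟩ := by ext <;> simp [hD, hωd]
    rw [hT, pow_two, Zsqrtd.norm_mul, hDn, Zsqrtd.norm_def]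
    linear_combination (P * P - n * Q * Q + 1) * hN
  have cancel : ∀ {x y w : ℤ√n}, x ≠ 0 → x * y = x * w → y = w := by
    intro x y w hx h
    apply φinj
    have h1 := congrArg φ h
    rw [map_mul, map_mul] at h1
    exact mul_left_cancel₀ (fun h0 => hx (φinj (by rw [h0, map_zero]))) h1
  have hPQω : (2 * (2 * P * Q) * ω : ℤ√n) ≠ 0 := by
    intro h
    have := congrArg Zsqrtd.im h
    rw [show (2 * (2 * P * Q) * ω : ℤ√n) = ((4 * (P * Q) : ℤ) : ℤ√n) * ω by push_cast; ring,
      Zsqrtd.im_mul] at this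
    simp [hωd] at this
    exact hPQ (mul_eq_zero.2 this)
  clear_value ω σ
  have hT1 : T ^ 2 - 1 = 2 * (2 * P * Q) * ω * T := pow_four_sub_one_of_norm hω hN'
  have hkey : (e : ℤ√n) * (T ^ 2 - 1) = 2 * σ * ((s' * D) ^ 2 - T ^ 2) := by
    rw [hσω]; exact mul_pow_four_sub_one hω hN' hnac' hcr' hs'
  have hσ2 : σ ^ 2 = a * (2 * σ + e) := by rw [hσω]; exact sq_add_mul_eq hω hnac' hcr'
  clear_value z T D
  have hTB : T ^ 2 - 1 = 2 * (p * z * σ) * (e * (p * z) + 2 * T) := by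
    apply cancel he0
    rw [hkey, show (s' : ℤ√n) * D = T + e * p * z by rw [← hΔ]; ring]
    ring
  have hrel : (a : ℤ√n) * (A ^ 2 - 1) = 2 * σ * B ^ 2 := by
    rw [hA, hB]; exact relative_unit_of_sq_sub_one hσ2 hTB
  have hB0 : B ≠ 0 := by
    intro hB00
    have hT0 : T ≠ 0 := by rintro rfl; simp at hTN
    refine hT0 (cancel hPQω ?_)
    rw [← hT1, hTB, ← hB, hB00]; ring
  obtain ⟨v, y, hy, hyp⟩ := exists_eq_pow_mul hp hB0
  have hv : 0 < v := by
    rcases Nat.eq_zero_or_pos v with rfl | hv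
    · exact absurd ⟨z * σ, by rw [← mul_assoc, ← hB, hy]; ring⟩ hyp
    · exact hv
  have hpA : (p : ℤ√n) ∣ A - 1 := by
    rw [hA, hB, show T - 2 * (p * z * σ) - 1 = (T - 1) - p * (2 * z * σ) by ring]
    exact dvd_sub hpT (Dvd.intro _ rfl)
  have hcop : ∀ {m : ℤ}, ¬ (p : ℤ) ∣ m → IsCoprime (p : ℤ√n) m := by
    intro m hm
    have := (hpZ.coprime_iff_not_dvd.2 hm).map (Int.castRingHom (ℤ√n))
    simpa using this
  have h2p : ¬ (p : ℤ) ∣ 2 := by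
    intro h
    exact hp2 ((Nat.prime_dvd_prime_iff_eq hp Nat.prime_two).1 (by exact_mod_cast h))
  have hA1 : (p : ℤ√n) ^ (2 * v) ∣ A - 1 := by
    have h1 : IsCoprime ((p : ℤ√n) ^ (2 * v)) (a * (A + 1)) := by
      refine (IsCoprime.mul_right (hcop hpa) ?_).pow_left
      obtain ⟨w, hw⟩ := hpA
      rw [show A + 1 = (2 : ℤ) + p * w by rw [← hw]; push_cast; ring]
      exact (hcop h2p).add_mul_left_right w
    refine h1.dvd_of_dvd_mul_right ⟨2 * σ * y ^ 2, ?_⟩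
    linear_combination hrel + 2 * σ * (B + p ^ v * y) * hy
  have hyre : (p : ℤ) ∣ y.re := by
    refine dvd_re_of_norm_eq_one hp hp2 hv hA1 ?_
    rw [← hy, hA]; convert hTN using 2; ring
  have hyim : ¬ (p : ℤ) ∣ y.im := by
    intro him
    obtain ⟨u, hu⟩ := hyre
    obtain ⟨w, hw⟩ := him
    exact hyp ⟨⟨u, w⟩, by ext <;> simp [hu, hw]⟩
  obtain ⟨w, hw⟩ := hpA
  have hw' : A = 1 + p * w := by linear_combination hw
  have hArel : (a : ℤ√n) * ((2 * A ^ 2 - 1) ^ 2 - 1) = 2 * σ * (2 * A * B) ^ 2 := by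
    linear_combination 4 * A ^ 2 * hrel
  have hArel' : (a : ℤ√n) * ((chebPair A' L).1 ^ 2 - 1) =
      2 * σ * (B' * (chebPair A' L).2) ^ 2 := by
    linear_combination a * chebPair_norm A' L + (chebPair A' L).2 ^ 2 * h'
  have hA'pos : 0 < φ A' := by
    rw [φ_apply]; have := Real.sqrt_nonneg (n : ℝ)
    have h1 : (0 : ℝ) < A'.re := by exact_mod_cast hre'
    have h2 : (0 : ℝ) ≤ A'.im := by exact_mod_cast him'
    positivity
  have hpos' := (chebPair_toReal_pos hn hA'pos (one_le h') L).1
  have hpos : 0 < φ (2 * A ^ 2 - 1) := by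
    have := one_le hrel
    have e1 : φ (2 * A ^ 2 - 1) = 2 * φ (A ^ 2 - 1) + 1 := by
      simp only [map_sub, map_mul, map_pow, map_one, map_ofNat]; ring
    rw [e1]; linarith
  have hB'0 : B' * (chebPair A' L).2 ≠ 0 := by
    rw [hB']
    intro h0
    have := congrArg Zsqrtd.re h0
    rw [Zsqrtd.re_pow_mul, Zsqrtd.re_zero] at this
    rcases mul_eq_zero.1 this with h1 | h1
    · exact pow_ne_zero _ hpZ.ne_zero h1
    · exact hβ' (h1 ▸ dvd_zero _)
  rw [hσ] at hArel hArel'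
  obtain ⟨k, hk, j, s₂, hs₂, hkj⟩ := exists_chebPair_eq hn hsq ha hr.le
    (by rw [hnac]; nlinarith [mul_pos ha he]) hArel hArel' hpos hpos' hB'0
  rw [hB', hy, show 2 * A * ((p : ℤ√n) ^ v * y) = (p : ℤ√n) ^ v * (2 * A * y) by ring] at hkj
  have h2A : 2 * A * y = y + y + (p : ℤ√n) ^ 1 * (2 * w * y) := by rw [hw']; ring
  refine chebPair_mul_ne hp hs₂ ?_ hA' ?_ ?_ hβ' hk hkj
  · obtain ⟨u, hu⟩ := (pow_dvd_pow (p : ℤ√n) (show 2 ≤ 2 * v by omega)).trans hA1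
    exact ⟨2 * (A + 1) * u, by linear_combination 2 * (A + 1) * hu⟩
  · rw [h2A, Zsqrtd.re_add, Zsqrtd.re_add, Zsqrtd.re_pow_mul, pow_one]
    exact dvd_add (dvd_add hyre hyre) (Dvd.intro _ rfl)
  · rw [h2A, Zsqrtd.im_add, Zsqrtd.im_add, Zsqrtd.im_pow_mul, pow_one,
      Int.dvd_add_left (Dvd.intro _ rfl), ← two_mul, hpZ.dvd_mul]
    exact not_or.2 ⟨h2p, hyim⟩

namespace Pell.Solution₁

variable {a : ℤ}

theorem zpow_y_ne_zero {E : Solution₁ a} (hx : 0 < E.x) (hy : 0 < E.y) {k : ℤ} (hk : k ≠ 0) :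
    (E ^ k).y ≠ 0 := by
  intro h
  have := sign_y_zpow_eq_sign_of_x_pos_of_y_pos hx hy k
  rw [h, Int.sign_zero, eq_comm, Int.sign_eq_zero_iff_zero] at this
  exact hk this

theorem x_sq (E : Solution₁ a) : (E ^ 2).x = 2 * E.x ^ 2 - 1 := by
  rw [pow_two, x_mul]; linear_combination -E.prop

theorem y_sq (E : Solution₁ a) : (E ^ 2).y = 2 * E.x * E.y := by
  rw [pow_two, y_mul]; ring

theorem pow_sub_dvd {Q s : ℤ} {E : Solution₁ a} (hx : Q ∣ E.x - s) (hy : Q ∣ E.y) (k : ℕ) :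
    Q ∣ (E ^ k).x - s ^ k ∧ Q ∣ (E ^ k).y := by
  induction k with
  | zero => simp
  | succ k ih =>
    obtain ⟨⟨c, hc⟩, ⟨d, hd⟩⟩ := ih
    obtain ⟨x, hx⟩ := hx
    obtain ⟨y, hy⟩ := hy
    rw [_root_.pow_succ, x_mul, y_mul, hy, hd, eq_add_of_sub_eq hc, eq_add_of_sub_eq hx]
    exact ⟨⟨c * (Q * x + s) + s ^ k * x + a * (d * (Q * y)), by ring⟩,
      ⟨(Q * c + s ^ k) * y + d * (Q * x + s), by ring⟩⟩

/-- Powers of a solution congruent to `s` modulo `Q` are congruent to powers of `s`. -/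
theorem zpow_sub_dvd {Q s : ℤ} {E : Solution₁ a} (hx : Q ∣ E.x - s) (hy : Q ∣ E.y) (k : ℤ) :
    Q ∣ (E ^ k).x - s ^ k.natAbs ∧ Q ∣ (E ^ k).y := by
  have h := pow_sub_dvd hx hy k.natAbs
  rcases Int.natAbs_eq k with hk | hk
  · rwa [hk, zpow_natCast, Int.natAbs_natCast]
  · rw [hk, zpow_neg, zpow_natCast, Int.natAbs_neg, Int.natAbs_natCast, x_inv, y_inv]
    exact ⟨h.1, h.2.neg_right⟩

theorem zpow_add_one_dvd {Q : ℤ} {E : Solution₁ a} (hx : Q ∣ E.x + 1) (hy : Q ∣ E.y) (k : ℤ) :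
    ∃ s : ℤ, (s = 1 ∨ s = -1) ∧ Q ∣ (E ^ k).x - s ∧ Q ∣ (E ^ k).y := by
  obtain ⟨h1, h2⟩ := zpow_sub_dvd (s := -1) (by simpa using hx) hy k
  exact ⟨_, neg_one_pow_eq_or ℤ _, h1, h2⟩

end Pell.Solution₁

theorem jacobiSym_sq_ne {u : ℤ} {Q : ℕ} : jacobiSym (u ^ 2) Q ≠ -1 := by
  rw [jacobiSym.pow_left]
  intro h
  nlinarith [sq_nonneg (jacobiSym u Q)]

theorem jacobiSym_two_of_one {Q : ℕ} (hQ : Q % 8 = 1) : jacobiSym 2 Q = 1 := by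
  rw [jacobiSym.at_two (by rw [Nat.odd_iff]; omega), ZMod.χ₈_nat_eq_if_mod_eight]
  simp [hQ]; omega

theorem jacobiSym_sign_of_one {Q : ℕ} (hQ : Q % 4 = 1) {s : ℤ} (hs : s = 1 ∨ s = -1) :
    jacobiSym s Q = 1 := by
  rcases hs with rfl | rfl
  · exact jacobiSym.one_left Q
  · rw [jacobiSym.at_neg_one (by rw [Nat.odd_iff]; omega), ZMod.χ₄_nat_one_mod_four hQ]

/-- Reciprocity for a modulus `1` modulo `8`: signs and powers of two in the numerator are
irrelevant. -/
theorem jacobiSym_of_one_mod_eight {Q W e : ℕ} (hQ : Q % 8 = 1) (hW : Odd W) {s : ℤ}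
    (hs : s = 1 ∨ s = -1) : jacobiSym (s * 2 ^ e * W) Q = jacobiSym Q W := by
  rw [jacobiSym.mul_left, jacobiSym.mul_left, jacobiSym.pow_left, jacobiSym_two_of_one hQ,
    jacobiSym_sign_of_one (by omega) hs, one_pow, one_mul, one_mul,
    jacobiSym.quadratic_reciprocity_one_mod_four' hW (by omega)]

theorem exists_odd_part {z : ℤ} (hz : z ≠ 0) :
    ∃ (s : ℤ) (e W : ℕ), (s = 1 ∨ s = -1) ∧ Odd W ∧ z = s * 2 ^ e * W := by
  obtain ⟨e, W, hW, h⟩ := Nat.exists_eq_two_pow_mul_odd (Int.natAbs_ne_zero.2 hz)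
  rcases Int.natAbs_eq z with hk | hk
  · exact ⟨1, e, W, .inl rfl, hW, by rw [hk, h]; push_cast; ring⟩
  · exact ⟨-1, e, W, .inr rfl, hW, by rw [hk, h]; push_cast; ring⟩

theorem jacobiSym_congr {u v : ℤ} {Q : ℕ} (h : (Q : ℤ) ∣ u - v) :
    jacobiSym u Q = jacobiSym v Q :=
  jacobiSym.mod_left' (Int.emod_eq_emod_iff_emod_sub_eq_zero.2 (Int.emod_eq_zero_of_dvd h))

open Pell.Solution₁ in
/-- A point whose coordinate `V` has odd part `W` is not followed by squares at odd multiples of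
`2h` when the unit there is a non-residue modulo `W`. -/
theorem Pell.Solution₁.ne_sq_of_jacobiSym {a : ℤ} {H : Pell.Solution₁ a} (hx : H.x % 8 = 1)
    (hx0 : 0 < H.x) (hy : H.y ≠ 0) {V s : ℤ} {W e : ℕ} (hW : Odd W) (hs : s = 1 ∨ s = -1)
    (hV : V = s * 2 ^ e * W) (hJ : jacobiSym (H ^ 2).x W = -1) {j : ℤ} (hj : Odd j) (U u : ℤ) :
    U * ((H ^ 2) ^ j).x + V * ((H ^ 2) ^ j).y ≠ u ^ 2 := by
  intro hu
  set G := H ^ 2 with hG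
  have hGx : G.x = 2 * H.x ^ 2 - 1 := x_sq H
  have hGy : G.y = 2 * H.x * H.y := y_sq H
  obtain ⟨Q, hQ⟩ : ∃ Q : ℕ, G.x = Q := Int.eq_ofNat_of_zero_le (by rw [hGx]; nlinarith)
  have hQ8 : Q % 8 = 1 := by
    have : G.x % 8 = 1 := by
      rw [hGx, Int.sub_emod, Int.mul_emod, pow_two, Int.mul_emod H.x, hx]; norm_num
    omega
  obtain ⟨q, rfl⟩ := hj
  obtain ⟨t, ht, ⟨m, hm⟩, ⟨n, hn⟩⟩ := zpow_add_one_dvd (Q := (Q : ℤ)) (E := G ^ 2)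
    ⟨2 * G.x, by rw [x_sq, ← hQ]; ring⟩ ⟨2 * G.y, by rw [y_sq, ← hQ]; ring⟩ q
  have hGj : G ^ (2 * q + 1) = G * (G ^ 2) ^ q := by
    rw [zpow_add, zpow_one, zpow_mul, mul_comm]; rfl
  have hcong : (Q : ℤ) ∣ u ^ 2 - t * V * (2 * H.x * H.y) := by
    rw [← hu, hGj, x_mul, y_mul, hn, eq_add_of_sub_eq hm, ← hGy, hQ]
    exact ⟨U * (m * Q + t) + U * a * (G.y * n) + V * (Q * n) + V * G.y * m, by ring⟩
  obtain ⟨X, hX⟩ : ∃ X : ℕ, H.x = X := Int.eq_ofNat_of_zero_le hx0.le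
  have hX8 : X % 8 = 1 := by omega
  have hJx : jacobiSym H.x Q = 1 := by
    have := jacobiSym_of_one_mod_eight (e := 0) hQ8 (W := X) (by rw [Nat.odd_iff]; omega)
      (Or.inl rfl)
    rw [hX, show (X : ℤ) = 1 * 2 ^ 0 * X by ring, this,
      jacobiSym_congr (v := -1) ⟨2 * X, by rw [← hQ, hGx, hX]; ring⟩,
      jacobiSym_sign_of_one (by omega) (.inr rfl)]
  have hJy : jacobiSym H.y Q = 1 := by
    obtain ⟨s', e', W', hs', hW', hyW⟩ := exists_odd_part hy
    rw [hyW, jacobiSym_of_one_mod_eight hQ8 hW' hs']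
    rw [jacobiSym_congr (v := 1) ⟨2 * a * (s' * 2 ^ e') * H.y, ?_⟩, jacobiSym.one_left]
    rw [← hQ, hGx]
    have := H.prop
    linear_combination 2 * this + 2 * a * H.y * hyW
  refine jacobiSym_sq_ne (u := u) (Q := Q) ?_
  rw [jacobiSym_congr hcong, jacobiSym.mul_left, jacobiSym.mul_left, jacobiSym.mul_left,
    jacobiSym.mul_left, hJx, hJy, jacobiSym_two_of_one hQ8, jacobiSym_sign_of_one (by omega) ht,
    hV, jacobiSym_of_one_mod_eight hQ8 hW hs, ← hQ, hJ]
  norm_num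

/-- Reciprocity when the numerator is `1` modulo `8`, of either sign, and the modulus is
represented as `c` times a square modulo the numerator. -/
theorem jacobiSym_eq_of_one_mod_eight {Q : ℕ} (hQ : Q % 4 = 1) {Z y c : ℤ} (hZ : Z % 8 = 1)
    (hc : Z ∣ Q - c * y ^ 2) (hy : IsCoprime y Z) {i c' : ℕ} (hc' : Odd c')
    (hci : c = 2 ^ i * c') : jacobiSym Z Q = jacobiSym Z c' := by
  obtain ⟨s, hs, hsZ⟩ : ∃ s : ℤ, (s = 1 ∨ s = -1) ∧ Z = s * Z.natAbs := by
    rcases Int.natAbs_eq Z with h | h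
    · exact ⟨1, .inl rfl, by omega⟩
    · exact ⟨-1, .inr rfl, by omega⟩
  set z := Z.natAbs with hz
  have hz8 : z % 8 = 1 ∨ z % 8 = 7 := by omega
  have hzo : Odd z := by rw [Nat.odd_iff]; omega
  have h2 : jacobiSym 2 z = 1 := by
    rw [jacobiSym.at_two hzo, ZMod.χ₈_nat_eq_if_mod_eight]
    rcases hz8 with h | h <;> simp [h] <;> omega
  have hy2 : jacobiSym (y ^ 2) z = 1 := by
    apply jacobiSym.sq_one'
    rw [← Int.isCoprime_iff_gcd_eq_one]
    rw [hsZ] at hy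
    exact hy.of_mul_right_right
  have h1 : jacobiSym Z Q = jacobiSym c' z := by
    rw [hsZ, jacobiSym.mul_left, jacobiSym_sign_of_one hQ hs, one_mul,
      jacobiSym.quadratic_reciprocity_one_mod_four' hzo hQ,
      jacobiSym_congr (v := c * y ^ 2) (dvd_trans ⟨s, ?_⟩ hc), jacobiSym.mul_left, hy2, hci,
      jacobiSym.mul_left, jacobiSym.pow_left, h2, one_pow, one_mul, mul_one]
    rw [hsZ, mul_comm]
  rw [h1]
  rcases hs with rfl | rfl
  · rw [hsZ, one_mul, jacobiSym.quadratic_reciprocity_one_mod_four' hc' (by omega)]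
  · rw [hsZ, jacobiSym.mul_left, jacobiSym.at_neg_one hc']
    rcases Nat.odd_mod_four_iff.1 (Nat.odd_iff.1 hc') with h | h
    · rw [jacobiSym.quadratic_reciprocity_one_mod_four h hzo, ZMod.χ₄_nat_one_mod_four h, one_mul]
    · rw [jacobiSym.quadratic_reciprocity_three_mod_four h (by omega),
        ZMod.χ₄_nat_three_mod_four h, neg_one_mul]

namespace Pell.Solution₁

variable {a : ℤ}

/-- If `E ^ r` is `-1` modulo `Q` then `E ^ j` is `± E` or `± E⁻¹` for `j` congruent to `±1`
modulo `r`. -/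
theorem zpow_sub_mul_dvd {Q : ℤ} {E : Solution₁ a} {r : ℤ} (hx : Q ∣ (E ^ r).x + 1)
    (hy : Q ∣ (E ^ r).y) {j : ℤ} (hj : r ∣ j - 1 ∨ r ∣ j + 1) :
    ∃ s t : ℤ, (s = 1 ∨ s = -1) ∧ (t = 1 ∨ t = -1) ∧ Q ∣ (E ^ j).x - s * E.x ∧
      Q ∣ (E ^ j).y - s * (t * E.y) := by
  rcases hj with ⟨q, hq⟩ | ⟨q, hq⟩
  · obtain ⟨s, hs, ⟨m, hm⟩, ⟨n, hn⟩⟩ := zpow_add_one_dvd hx hy q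
    have h : E ^ j = (E ^ r) ^ q * E := by
      rw [eq_add_of_sub_eq hq, zpow_add, zpow_one, zpow_mul]
    refine ⟨s, 1, hs, .inl rfl, ?_, ?_⟩
    · rw [h, x_mul, eq_add_of_sub_eq hm, hn]
      exact ⟨m * E.x + a * (n * E.y), by ring⟩
    · rw [h, y_mul, eq_add_of_sub_eq hm, hn]
      exact ⟨m * E.y + n * E.x, by ring⟩
  · obtain ⟨s, hs, ⟨m, hm⟩, ⟨n, hn⟩⟩ := zpow_add_one_dvd hx hy q
    have h : E ^ j = (E ^ r) ^ q * E⁻¹ := by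
      rw [eq_sub_of_add_eq hq, zpow_sub, zpow_one, zpow_mul]
    refine ⟨s, -1, hs, .inr rfl, ?_, ?_⟩
    · rw [h, x_mul, eq_add_of_sub_eq hm, hn, x_inv, y_inv]
      exact ⟨m * E.x - a * (n * E.y), by ring⟩
    · rw [h, y_mul, eq_add_of_sub_eq hm, hn, x_inv, y_inv]
      exact ⟨-m * E.y + n * E.x, by ring⟩

theorem isCoprime_add_mul (E : Solution₁ a) (V : ℤ) : IsCoprime E.y (E.x + V * E.y) := by
  refine IsCoprime.add_mul_right_right ?_ V
  exact ⟨-a * E.y, E.x, by linear_combination E.prop⟩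

/-- The point `1 + V y` is not followed by squares at exponents prime to `2` (`f = 1`) or `6`
(`f = 3`). -/
theorem ne_sq_of_jacobiSym_add {E : Solution₁ a} (ha : 0 < a) (hx : E.x % 8 = 1) (hx0 : 0 < E.x)
    (hy : 8 ∣ E.y) {V f j : ℤ} (hf : f = 1 ∧ Odd j ∨ f = 3 ∧ Odd j ∧ ¬ 3 ∣ j)
    {i c : ℕ} (hc : Odd c) (hci : V ^ 2 + f * a = 2 ^ i * c)
    (hJ : jacobiSym (E.x + V * E.y) c = -1) (hJ' : jacobiSym (E.x - V * E.y) c = -1) (u : ℤ) :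
    (E ^ j).x + V * (E ^ j).y ≠ u ^ 2 := by
  intro hu
  obtain ⟨y, hy⟩ := hy
  have hf0 : 0 < f := by rcases hf with ⟨h, -⟩ | ⟨h, -⟩ <;> omega
  obtain ⟨Q, hQ⟩ : ∃ Q : ℕ, E.x ^ 2 + f * a * E.y ^ 2 = Q :=
    Int.eq_ofNat_of_zero_le (by positivity)
  have hQ8 : Q % 8 = 1 := by
    have : (E.x ^ 2 + f * a * E.y ^ 2) % 8 = 1 := by
      rw [hy, show E.x ^ 2 + f * a * (8 * y) ^ 2 = E.x * E.x + 8 * (8 * f * a * y ^ 2) by ring,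
        Int.add_mul_emod_self_left, Int.mul_emod, hx]; norm_num
    omega
  have key : ∀ t : ℤ, t = 1 ∨ t = -1 → jacobiSym (E.x + V * (t * E.y)) Q = -1 := by
    intro t ht
    have ht2 : t ^ 2 = 1 := by rcases ht with rfl | rfl <;> norm_num
    rw [jacobiSym_eq_of_one_mod_eight (y := E.y) (c := V ^ 2 + f * a) (by omega) ?_ ?_ ?_ hc hci]
    · rcases ht with rfl | rfl
      · rw [one_mul, hJ]
      · rw [neg_one_mul, mul_neg, ← sub_eq_add_neg, hJ']
    · rw [hy, show V * (t * (8 * y)) = 8 * (V * t * y) by ring, Int.add_mul_emod_self_left, hx]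
    · rw [← hQ]
      exact ⟨E.x - V * (t * E.y), by linear_combination V ^ 2 * E.y ^ 2 * ht2⟩
    · rw [← mul_assoc]; exact E.isCoprime_add_mul _
  obtain ⟨s, t, hs, ht, ⟨m, hm⟩, ⟨n, hn⟩⟩ : ∃ s t : ℤ, (s = 1 ∨ s = -1) ∧ (t = 1 ∨ t = -1) ∧
      (Q : ℤ) ∣ (E ^ j).x - s * E.x ∧ (Q : ℤ) ∣ (E ^ j).y - s * (t * E.y) := by
    rcases hf with ⟨rfl, hj⟩ | ⟨rfl, hj⟩
    · have hF : (E ^ (4 : ℤ)) = (E ^ 2) ^ 2 := by rw [← pow_mul]; rfl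
      have h2 : (E ^ 2).x = Q := by rw [x_sq, ← hQ]; linear_combination E.prop
      refine zpow_sub_mul_dvd (r := 4) ?_ ?_ ?_
      · rw [hF, x_sq, h2]; exact ⟨2 * Q, by ring⟩
      · rw [hF, y_sq, h2]; exact ⟨2 * (E ^ 2).y, by ring⟩
      · obtain ⟨q, rfl⟩ := hj; omega
    · have hF : (E ^ (6 : ℤ)) = (E ^ 3) ^ 2 := by rw [← pow_mul]; rfl
      have h2 : (E ^ 3).x = E.x * Q := by
        rw [_root_.pow_succ, x_mul, x_sq, y_sq, ← hQ]; linear_combination E.x * E.prop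
      refine zpow_sub_mul_dvd (r := 6) ?_ ?_ ?_
      · rw [hF, x_sq, h2]; exact ⟨2 * E.x ^ 2 * Q, by ring⟩
      · rw [hF, y_sq, h2]; exact ⟨2 * E.x * (E ^ 3).y, by ring⟩
      · have := Int.odd_iff.1 hj.1
        have : j % 6 = 1 ∨ j % 6 = 5 := by have := hj.2; omega
        omega
  refine jacobiSym_sq_ne (u := u) (Q := Q) ?_
  rw [← hu, jacobiSym_congr (v := s * (E.x + V * (t * E.y))) ⟨m + V * n, ?_⟩, jacobiSym.mul_left,
    jacobiSym_sign_of_one (by omega) hs, key t ht, one_mul]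
  linear_combination hm + V * hn

end Pell.Solution₁

/-! ### The four kinds of exponents excluded by residue symbols and descent -/

/-- The sequence `V ↦ V² - 2`. -/
def lucasSeq (P : ℤ) : ℕ → ℤ
  | 0 => P
  | s + 1 => lucasSeq P s ^ 2 - 2

namespace Pell.Solution₁

variable {a : ℤ}

theorem two_mul_x_pow_two_pow {E : Solution₁ a} {P : ℤ} (hE : 2 * E.x = P ^ 3 - 3 * P) (s : ℕ) :
    2 * (E ^ 2 ^ s).x = lucasSeq P s ^ 3 - 3 * lucasSeq P s := by
  induction s with
  | zero => simpa [lucasSeq] using hE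
  | succ s ih =>
    rw [_root_.pow_succ, pow_mul, x_sq, lucasSeq]
    linear_combination (2 * (E ^ 2 ^ s).x + (lucasSeq P s ^ 3 - 3 * lucasSeq P s)) * ih

theorem lucasSeq_pos_of_odd {P : ℤ} (hP : Odd P) (hP3 : 3 ≤ P) (s : ℕ) :
    3 ≤ lucasSeq P s ∧ Odd (lucasSeq P s) := by
  induction s with
  | zero => exact ⟨hP3, hP⟩
  | succ s ih =>
    refine ⟨?_, ?_⟩
    · rw [lucasSeq]; nlinarith
    · rw [lucasSeq]; exact ih.2.pow.sub_even even_two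

theorem lucasSeq_succ_emod_eight {P : ℤ} (hP : Odd P) (hP3 : 3 ≤ P) (s : ℕ) :
    lucasSeq P (s + 1) % 8 = 7 := by
  obtain ⟨m, hm⟩ := Int.eight_dvd_sq_sub_one_of_odd (lucasSeq_pos_of_odd hP hP3 s).2
  rw [lucasSeq]; omega

theorem lucasSeq_succ_add_one_dvd {P u : ℤ} (h : u ∣ P ^ 2 - 1) (s : ℕ) :
    u ∣ lucasSeq P (s + 1) + 1 := by
  induction s with
  | zero => exact h.trans ⟨1, by rw [lucasSeq, lucasSeq]; ring⟩
  | succ s ih => exact ih.trans ⟨lucasSeq P (s + 1) - 1, by rw [lucasSeq]; ring⟩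

/-- A square followed by a square in the Pell sequence of a cube of a half-integral unit. -/
theorem ne_sq_of_half_unit {E : Solution₁ a} {P : ℤ} (hE : 2 * E.x = P ^ 3 - 3 * P)
    (hP : Odd P) (hP3 : 3 ≤ P) {u₀ : ℤ} (hu₀ : u₀ ∣ P ^ 2 - 1) (s : ℕ) {j : ℤ} (hj : Odd j)
    (V u : ℤ) : u₀ ^ 2 * ((E ^ 2 ^ (s + 2)) ^ j).x + V * ((E ^ 2 ^ (s + 2)) ^ j).y ≠ u ^ 2 := by
  intro hu
  obtain ⟨h3, hodd⟩ := lucasSeq_pos_of_odd hP hP3 (s + 1)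
  obtain ⟨Q, hQ⟩ : ∃ Q : ℕ, lucasSeq P (s + 1) = Q := Int.eq_ofNat_of_zero_le (by omega)
  have hQ8 : Q % 8 = 7 := by have := lucasSeq_succ_emod_eight hP hP3 s; omega
  have hQo : Odd Q := by rw [Nat.odd_iff]; omega
  obtain ⟨m, hm⟩ : (Q : ℤ) ∣ (E ^ 2 ^ (s + 1)).x := by
    have h2 : IsCoprime (Q : ℤ) 2 := by
      rw [Int.isCoprime_iff_gcd_eq_one, Int.gcd_comm]
      exact Int.isCoprime_iff_gcd_eq_one.1 ((Nat.isCoprime_iff_coprime).2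
        (Nat.coprime_two_left.2 hQo))
    refine h2.dvd_of_dvd_mul_left ?_
    rw [two_mul_x_pow_two_pow hE, hQ]
    exact ⟨Q ^ 2 - 3, by ring⟩
  have hF : E ^ 2 ^ (s + 2) = (E ^ 2 ^ (s + 1)) ^ 2 := by rw [← pow_mul, ← _root_.pow_succ]
  obtain ⟨⟨n, hn⟩, ⟨k, hk⟩⟩ := zpow_sub_dvd (Q := (Q : ℤ)) (s := -1) (E := E ^ 2 ^ (s + 2))
    ⟨2 * (E ^ 2 ^ (s + 1)).x * m, by rw [hF, x_sq, hm]; ring⟩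
    ⟨2 * m * (E ^ 2 ^ (s + 1)).y, by rw [hF, y_sq, hm]; ring⟩ j
  rw [(Int.natAbs_odd.2 hj).neg_one_pow] at hn
  have hJ : jacobiSym (u ^ 2) Q = jacobiSym (-1 * u₀ ^ 2) Q := by
    refine jacobiSym_congr ⟨u₀ ^ 2 * n + V * k, ?_⟩
    rw [← hu, hk]; linear_combination u₀ ^ 2 * hn
  refine jacobiSym_sq_ne (u := u) (Q := Q) ?_
  rw [hJ, jacobiSym.mul_left, jacobiSym.at_neg_one hQo, ZMod.χ₄_nat_three_mod_four (by omega),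
    jacobiSym.sq_one', mul_one]
  rw [← Int.isCoprime_iff_gcd_eq_one]
  obtain ⟨b, hb⟩ := lucasSeq_succ_add_one_dvd hu₀ s
  exact ⟨b, -1, by rw [← hQ]; linear_combination -hb⟩

end Pell.Solution₁

/-! ### The equation `8 x⁴ - 8 x² + 1 = q²` -/

theorem Int.sq_eq_one_of_pow_four_sub_one {β f : ℤ} (h : β ^ 4 - 1 = 2 * f ^ 2) : β ^ 2 = 1 := by
  have hodd : Odd β := by
    have : Odd (β ^ 4) := ⟨f ^ 2, by linarith⟩
    exact (Int.odd_pow' (by norm_num)).1 this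
  obtain ⟨t, ht⟩ := Int.eight_dvd_sq_sub_one_of_odd hodd
  have hcop : IsCoprime (β ^ 2 - 1) (4 * t + 1) := ⟨2 * t, 1 - 4 * t, by rw [ht]; ring⟩
  have hprod : (β ^ 2 - 1) * (4 * t + 1) = f ^ 2 := by
    have h2 : β ^ 2 = 8 * t + 1 := by linarith
    have : (β ^ 2) ^ 2 - 1 = 2 * f ^ 2 := by rw [← h]; ring
    rw [h2] at this ⊢; linarith
  obtain ⟨g, hg⟩ := Int.sq_of_isCoprime hcop hprod
  have hβ : β ≠ 0 := by rintro rfl; simp at hodd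
  have hβ2 : 0 < β ^ 2 := by positivity
  have hg' : β ^ 2 - 1 = g ^ 2 := by
    rcases hg with hg | hg
    · exact hg
    · have := sq_nonneg g; omega
  have hfac : (|β| - |g|) * (|β| + |g|) = 1 := by
    have h1 := sq_abs β
    have h2 := sq_abs g
    linear_combination h1 - h2 + hg'
  have h1 : |β| + |g| = 1 := by
    rcases Int.mul_eq_one_iff_eq_one_or_neg_one.1 hfac with h | h
    · exact h.2
    · have := abs_nonneg β; have := abs_nonneg g; omega
  have : |β| = 1 := by have := abs_pos.2 hβ; have := abs_nonneg g; omega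
  rw [← sq_abs, this, one_pow]

theorem Int.sq_eq_one_of_mul_eq_sq {s t x : ℤ} (hst : IsCoprime s t) (hx : s * t = x ^ 2)
    (h : s ^ 2 - 1 = 2 * (t - s) ^ 2) : x ^ 2 = 1 := by
  obtain ⟨β, hβ⟩ := Int.sq_of_isCoprime hst hx
  have h4 : β ^ 4 = s ^ 2 := by rcases hβ with rfl | rfl <;> ring
  have h1 := Int.sq_eq_one_of_pow_four_sub_one (h4 ▸ h)
  have hs : s ^ 2 = 1 := by rw [← h4, show β ^ 4 = (β ^ 2) ^ 2 by ring, h1, one_pow]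
  have : t - s = 0 := by
    rw [← sq_eq_zero_iff]; omega
  rw [← hx, sub_eq_zero.1 this, ← hs, sq]

/-- The only positive integer for which `cosh 4θ` is a square, where `x = cosh θ`, is `x = 1`. -/
theorem Int.eq_one_of_quartic_eq_sq {x q : ℤ} (hx : 1 ≤ x) (h : 8 * x ^ 4 - 8 * x ^ 2 + 1 = q ^ 2) :
    x = 1 := by
  have hodd : Odd q := by
    have : Odd (q ^ 2) := ⟨4 * x ^ 4 - 4 * x ^ 2, by linarith⟩
    exact (Int.odd_pow' (by norm_num)).1 this
  obtain ⟨m, rfl⟩ := hodd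
  have hr0 : 0 < 2 * x ^ 2 - 1 := by nlinarith
  have hsq : m * m + (m + 1) * (m + 1) = (2 * x ^ 2 - 1) * (2 * x ^ 2 - 1) := by linarith
  suffices x ^ 2 = 1 by nlinarith
  obtain ⟨A, B, hA, hAB, hP, hAB1⟩ : ∃ A B : ℤ, A % 2 = 1 ∧ IsCoprime A B ∧
      PythagoreanTriple A B (2 * x ^ 2 - 1) ∧ (A - B = 1 ∨ A - B = -1) := by
    rcases Int.emod_two_eq_zero_or_one m with h0 | h1
    · exact ⟨m + 1, m, by omega, ⟨1, -1, by ring⟩, by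
        unfold PythagoreanTriple; linarith, .inl (by ring)⟩
    · exact ⟨m, m + 1, by omega, ⟨-1, 1, by ring⟩, hsq, .inr (by ring)⟩
  obtain ⟨a, b, h1, h2, h3, hab, -, -⟩ :=
    hP.coprime_classification' (Int.isCoprime_iff_gcd_eq_one.1 hAB) hA hr0
  replace hab : IsCoprime a b := Int.isCoprime_iff_gcd_eq_one.2 hab
  rcases hAB1 with h | h
  · refine Int.sq_eq_one_of_mul_eq_sq (s := a - b) (t := a) ?_ ?_ ?_
    · obtain ⟨u, v, huv⟩ := hab
      exact ⟨-v, u + v, by linear_combination huv⟩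
    · linarith
    · linarith
  · refine Int.sq_eq_one_of_mul_eq_sq (s := a + b) (t := b) ?_ ?_ ?_
    · obtain ⟨u, v, huv⟩ := hab
      exact ⟨u, v - u, by linear_combination huv⟩
    · linarith
    · linarith

namespace Pell.Solution₁

variable {a : ℤ}

theorem isCoprime_x_sq_sq (E : Solution₁ a) : IsCoprime ((E ^ 2) ^ 2).x (210 : ℤ) := by
  have key : ((E ^ 2) ^ 2).x = 8 * E.x ^ 4 - 8 * E.x ^ 2 + 1 := by rw [x_sq, x_sq]; ring
  rw [key, show (210 : ℤ) = 2 * (3 * (5 * 7)) by norm_num]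
  have h : ∀ p : ℕ, p.Prime → (∀ x : ZMod p, 8 * x ^ 4 - 8 * x ^ 2 + 1 ≠ 0) →
      IsCoprime (8 * E.x ^ 4 - 8 * E.x ^ 2 + 1) (p : ℤ) := by
    intro p hp hne
    refine ((Prime.coprime_iff_not_dvd (Nat.prime_iff_prime_int.1 hp)).2 fun hd => ?_).symm
    refine hne (E.x : ZMod p) ?_
    have := (ZMod.intCast_zmod_eq_zero_iff_dvd _ p).2 hd
    push_cast at this; exact this
  refine IsCoprime.mul_right (h 2 Nat.prime_two (by decide)) (IsCoprime.mul_right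
    (h 3 Nat.prime_three (by decide)) (IsCoprime.mul_right (h 5 Nat.prime_five (by decide))
    (h 7 (by norm_num) (by decide))))

/-- A multiple of the trivial solution is not followed by squares. -/
theorem ne_sq_of_dvd_pow {E : Solution₁ a} (ha : 0 < a) (hx : 0 < E.x) (hy : 0 < E.y) {c : ℤ}
    {n : ℕ} (hc : c ∣ 210 ^ n) {m : ℤ} (hm : m ≠ 0) (u : ℤ) : c * (E ^ (8 * m)).y ≠ u ^ 2 := by
  intro h
  obtain ⟨F, hF⟩ : ∃ F : Solution₁ a, F = ((E ^ m) ^ 2) ^ 2 := ⟨_, rfl⟩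
  have hE : E ^ (8 * m) = F ^ 2 := by
    rw [hF, ← zpow_natCast, ← zpow_natCast, ← zpow_natCast, ← zpow_mul, ← zpow_mul, ← zpow_mul]
    congr 1; push_cast; ring
  have hcop : IsCoprime F.x (2 * c * F.y) := by
    have h210 : IsCoprime F.x (210 : ℤ) := hF ▸ isCoprime_x_sq_sq _
    refine IsCoprime.mul_right (IsCoprime.mul_right (h210.of_isCoprime_of_dvd_right (by norm_num))
      (h210.pow_right.of_isCoprime_of_dvd_right hc)) ?_
    exact ⟨F.x, -a * F.y, by linear_combination F.prop⟩
  obtain ⟨q, hq⟩ := Int.sq_of_isCoprime hcop (c := u) (by rw [← h, hE, y_sq]; ring)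
  have hF0 : F.x = 8 * (E ^ m).x ^ 4 - 8 * (E ^ m).x ^ 2 + 1 := by rw [hF, x_sq, x_sq]; ring
  have hpos : 0 < (E ^ m).x := x_zpow_pos hx m
  have hpos' : 0 < F.x := hF ▸ x_pow_pos (x_pow_pos hpos 2) 2
  have h1 : (E ^ m).x = 1 := Int.eq_one_of_quartic_eq_sq (q := q) hpos (by
    rcases hq with hq | hq
    · rw [← hF0, hq]
    · have := sq_nonneg q; omega)
  have h2 := (E ^ m).prop
  rw [h1, one_pow, sub_eq_self, mul_eq_zero, sq_eq_zero_iff] at h2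
  exact h2.elim ha.ne' (zpow_y_ne_zero hx hy hm)

end Pell.Solution₁

namespace Pell.Solution₁

/-- No square follows the point `U + V y` at nonzero exponents divisible by `M`. -/
def IsIsolated {a : ℤ} (E : Solution₁ a) (M : ℕ) (U V : ℤ) : Prop :=
  ∀ k : ℤ, (M : ℤ) ∣ k → ∀ u : ℤ, U * (E ^ k).x + V * (E ^ k).y = u ^ 2 → k = 0

variable {a : ℤ} {E : Solution₁ a}

theorem isIsolated_trivial (ha : 0 < a) (hx : 0 < E.x) (hy : 0 < E.y) {c : ℤ} {n : ℕ}
    (hc : c ∣ 210 ^ n) : E.IsIsolated 8 0 c := by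
  rintro k ⟨m, rfl⟩ u hu
  by_contra hk
  refine ne_sq_of_dvd_pow ha hx hy hc (m := m) (by rintro rfl; simp at hk) u ?_
  rw [← hu]; push_cast; ring

end Pell.Solution₁

theorem Int.exists_eq_two_pow_mul_odd' {k : ℤ} (hk : k ≠ 0) :
    ∃ (s : ℕ) (j : ℤ), Odd j ∧ k = 2 ^ s * j := by
  obtain ⟨s, m, hm, h⟩ := Nat.exists_eq_two_pow_mul_odd (Int.natAbs_ne_zero.2 hk)
  rcases Int.natAbs_eq k with h' | h'
  · exact ⟨s, m, by exact_mod_cast hm, by rw [h', h]; push_cast; ring⟩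
  · exact ⟨s, -m, by rw [odd_neg]; exact_mod_cast hm, by rw [h', h]; push_cast; ring⟩

theorem Int.exists_eq_two_pow_mul_three_pow_mul {k : ℤ} (hk : k ≠ 0) :
    ∃ (s t : ℕ) (j : ℤ), Odd j ∧ ¬ 3 ∣ j ∧ k = 2 ^ s * 3 ^ t * j := by
  obtain ⟨s, j, hj, rfl⟩ := Int.exists_eq_two_pow_mul_odd' hk
  have hj0 : j ≠ 0 := by rintro rfl; simp at hj
  have hfin : FiniteMultiplicity (3 : ℤ) j := Int.finiteMultiplicity_iff.2 ⟨by decide, hj0⟩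
  obtain ⟨i, hi, h3⟩ := hfin.exists_eq_pow_mul_and_not_dvd
  refine ⟨s, multiplicity 3 j, i, ?_, h3, by rw [mul_assoc, ← hi]⟩
  rw [hi] at hj
  exact (Int.odd_mul.1 hj).2

namespace Pell.Solution₁

variable {a : ℤ} {E : Solution₁ a}

theorem isIsolated_half_unit {P : ℤ} (hE : 2 * E.x = P ^ 3 - 3 * P) (hP : Odd P) (hP3 : 3 ≤ P)
    {u₀ : ℤ} (hu₀ : u₀ ∣ P ^ 2 - 1) (V : ℤ) : E.IsIsolated 4 (u₀ ^ 2) V := by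
  rintro k ⟨m, rfl⟩ u hu
  by_contra hk
  obtain ⟨s, j, hj, hm⟩ := Int.exists_eq_two_pow_mul_odd' (k := m) (by rintro rfl; simp at hk)
  refine ne_sq_of_half_unit hE hP hP3 hu₀ s hj V u ?_
  have : E ^ (((4 : ℕ) : ℤ) * m) = (E ^ 2 ^ (s + 2)) ^ j := by
    rw [← zpow_natCast, ← zpow_mul, hm]; congr 1; push_cast; ring
  rw [← this]; exact hu

theorem pow_four_x_emod_eight (E : Solution₁ a) : (E ^ 4).x % 8 = 1 := by
  have h : E ^ 4 = (E ^ 2) ^ 2 := by rw [← pow_mul]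
  obtain ⟨m, hm⟩ := Int.eight_dvd_sq_sub_one_of_odd (k := (E ^ 2).x) ⟨E.x ^ 2 - 1, by
    rw [x_sq]; ring⟩
  rw [h, x_sq]; omega

theorem eight_dvd_pow_eight_y (E : Solution₁ a) : 8 ∣ (E ^ 8).y := by
  have h : E ^ 8 = ((E ^ 2) ^ 2) ^ 2 := by rw [← pow_mul, ← pow_mul]
  rw [h, y_sq, y_sq, y_sq]
  exact ⟨((E ^ 2) ^ 2).x * (E ^ 2).x * E.x * E.y, by ring⟩

/-- Isolation from residue symbols: it suffices to produce, for each nonzero exponent `k`, a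
divisor `8 m` of `k` with the required symbol. -/
theorem isIsolated_of_jacobiSym (hx : 0 < E.x) (hy : 0 < E.y) {M : ℕ} {V s : ℤ} {W e : ℕ}
    (hW : Odd W) (hs : s = 1 ∨ s = -1) (hV : V = s * 2 ^ e * W)
    (h : ∀ k : ℤ, k ≠ 0 → (M : ℤ) ∣ k → ∃ (m : ℕ) (j : ℤ), k = (8 * m : ℕ) * j ∧ Odd j ∧
      jacobiSym (E ^ (8 * m)).x W = -1) (U : ℤ) : E.IsIsolated M U V := by
  intro k hMk u hu
  by_contra hk
  obtain ⟨m, j, rfl, hj, hJ⟩ := h k hk hMk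
  have hm : m ≠ 0 := by rintro rfl; simp at hk
  have hH : (E ^ (4 * m)) ^ 2 = E ^ (8 * m) := by rw [← pow_mul]; congr 1; ring
  refine ne_sq_of_jacobiSym (H := E ^ (4 * m)) ?_ (x_pow_pos hx _) ?_ hW hs hV
    (by rw [hH]; exact hJ) hj U u ?_
  · rw [mul_comm, pow_mul]; exact pow_four_x_emod_eight _
  · rw [← zpow_natCast]; exact zpow_y_ne_zero hx hy (by positivity)
  · rw [hH, ← hu, zpow_mul, zpow_natCast]

theorem isIsolated_of_jacobiSym_add (ha : 0 < a) (hx : 0 < E.x) {M : ℕ} {V f : ℤ} {i c : ℕ}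
    (hc : Odd c) (hci : V ^ 2 + f * a = 2 ^ i * c)
    (h : ∀ k : ℤ, k ≠ 0 → (M : ℤ) ∣ k → ∃ (m : ℕ) (j : ℤ), k = (8 * m : ℕ) * j ∧
      (f = 1 ∧ Odd j ∨ f = 3 ∧ Odd j ∧ ¬ 3 ∣ j) ∧
      jacobiSym ((E ^ (8 * m)).x + V * (E ^ (8 * m)).y) c = -1 ∧
      jacobiSym ((E ^ (8 * m)).x - V * (E ^ (8 * m)).y) c = -1) : E.IsIsolated M 1 V := by
  intro k hMk u hu
  by_contra hk
  obtain ⟨m, j, rfl, hj, hJ, hJ'⟩ := h k hk hMk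
  refine ne_sq_of_jacobiSym_add (E := E ^ (8 * m)) ha ?_ (x_pow_pos hx _) ?_ hj hc hci hJ hJ' u ?_
  · rw [show 8 * m = 2 * m * 4 by ring, pow_mul]; exact pow_four_x_emod_eight _
  · rw [show 8 * m = m * 8 by ring, pow_mul]; exact eight_dvd_pow_eight_y _
  · rw [← hu, one_mul, zpow_mul, zpow_natCast]

/-- The Pell sequence of a power of `E` in another quadratic order. -/
theorem zpow_of_scale {n : ℤ} {E' : Solution₁ n} {h : ℕ} {f U : ℤ} (hf : f ≠ 0)
    (hX : (E ^ h).x = E'.x) (hY : f * (E ^ h).y = U * E'.y) (hn : f ^ 2 * n = a * U ^ 2) (j : ℤ) :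
    ((E ^ h) ^ j).x = (E' ^ j).x ∧ f * ((E ^ h) ^ j).y = U * (E' ^ j).y := by
  have hf2 : f ^ 2 ≠ 0 := pow_ne_zero 2 hf
  induction j using Int.induction_on with
  | zero => simp
  | succ i ih =>
    obtain ⟨h1, h2⟩ := ih
    rw [zpow_add_one, zpow_add_one, x_mul, x_mul, y_mul, y_mul, hX, h1]
    refine ⟨?_, by linear_combination (E' ^ (i : ℤ)).x * hY + E'.x * h2⟩
    refine mul_left_cancel₀ hf2 ?_
    linear_combination a * f * (E ^ h).y * h2 + a * U * (E' ^ (i : ℤ)).y * hY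
      - (E' ^ (i : ℤ)).y * E'.y * hn
  | pred i ih =>
    obtain ⟨h1, h2⟩ := ih
    rw [zpow_sub_one, zpow_sub_one, x_mul, x_mul, y_mul, y_mul, x_inv, x_inv, y_inv, y_inv, hX, h1]
    refine ⟨?_, by linear_combination -(E' ^ (-i : ℤ)).x * hY + E'.x * h2⟩
    refine mul_left_cancel₀ hf2 ?_
    linear_combination -a * f * (E ^ h).y * h2 - a * U * (E' ^ (-i : ℤ)).y * hY
      + (E' ^ (-i : ℤ)).y * E'.y * hn

theorem IsIsolated.of_scale {n : ℤ} {E' : Solution₁ n} {M' h : ℕ} {f u₀ V' : ℤ} (hf : f ≠ 0)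
    (hu₀ : u₀ ≠ 0) (hX : (E ^ h).x = E'.x) (hY : f * (E ^ h).y = u₀ ^ 2 * E'.y)
    (hn : f ^ 2 * n = a * (u₀ ^ 2) ^ 2) (hiso : E'.IsIsolated M' 1 V') :
    E.IsIsolated (h * M') (u₀ ^ 2) (f * V') := by
  rintro k ⟨j, rfl⟩ u hu
  obtain ⟨h1, h2⟩ := zpow_of_scale hf hX hY hn (M' * j)
  have hE : E ^ (((h * M' : ℕ) : ℤ) * j) = (E ^ h) ^ ((M' : ℤ) * j) := by
    rw [← zpow_natCast, ← zpow_mul]; congr 1; push_cast; ring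
  rw [hE, h1, mul_right_comm, h2] at hu
  obtain ⟨w, rfl⟩ : u₀ ∣ u := by
    rw [← Int.pow_dvd_pow_iff two_ne_zero, ← hu]
    exact ⟨(E' ^ ((M' : ℤ) * j)).x + V' * (E' ^ ((M' : ℤ) * j)).y, by ring⟩
  have := hiso (M' * j) ⟨j, rfl⟩ w (mul_left_cancel₀ (pow_ne_zero 2 hu₀) (by linear_combination hu))
  rw [Nat.cast_mul, mul_assoc, this, mul_zero]

end Pell.Solution₁

namespace Pell.Solution₁

theorem isIsolated_of_relative_unit {n a c e r : ℤ} {p : ℕ} (hp : p.Prime) (hp2 : p ≠ 2)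
    (hnac : n = c * a) (hc : 0 < c) (ha : 0 < a) (he : 0 < e) (hr : 0 < r) (hcr : c * r ^ 2 = a + e)
    (hpa : ¬ (p : ℤ) ∣ a) (hroot : ∀ s : ℤ, e * p ∣ s ^ 2 - 1 → e * p ∣ s - 1 ∨ e * p ∣ s + 1)
    {A B β : ℤ√n} {v : ℕ}
    (h : (a : ℤ√n) * (A ^ 2 - 1) = 2 * (⟨a, r⟩ : ℤ√n) * B ^ 2) (hre : 0 < A.re) (him : 0 ≤ A.im)
    {L : ℕ} (hA : (p : ℤ√n) ^ 2 ∣ (chebPair A L).1 - 1)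
    (hB : B * (chebPair A L).2 = (p : ℤ√n) ^ v * β) (hβ : ¬ (p : ℤ) ∣ β.re)
    {E : Solution₁ n} (hx : 0 < E.x) (hy : 0 < E.y) {g : ℕ} (hgx : e * p ∣ (E ^ g).x - 1)
    (hgy : e * p ∣ (E ^ g).y) : E.IsIsolated (2 * g) 1 (c * r) := by
  rintro k ⟨j, rfl⟩ u hu
  obtain ⟨h1, h2⟩ := zpow_sub_dvd hgx hgy j
  rw [one_pow] at h1
  have hE : E ^ (((2 * g : ℕ) : ℤ) * j) = ((E ^ g) ^ j) ^ 2 := by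
    rw [← zpow_natCast, ← zpow_natCast, ← zpow_mul, ← zpow_mul]; congr 1; push_cast; ring
  rw [hE, x_sq, y_sq] at hu
  have hsq : ∀ m : ℤ, n ≠ m * m := by
    rintro m hm
    have hprop := E.prop
    have hm0 : 0 < |m| := by
      rw [abs_pos]; rintro rfl
      have : 0 < n := hnac ▸ mul_pos hc ha
      omega
    have hfac : (E.x - |m| * E.y) * (E.x + |m| * E.y) = 1 := by
      have := abs_mul_abs_self m
      linear_combination hprop + E.y ^ 2 * hm - E.y ^ 2 * this
    have := mul_pos hm0 hy
    rcases Int.mul_eq_one_iff_eq_one_or_neg_one.1 hfac with h | h <;> omega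
  have h0 := eq_zero_of_relative_unit hp hp2 hnac hc ha he hr hcr hsq hpa hroot h hre him hA hB hβ
    ((E ^ g) ^ j).prop h1 h2 (s := u) (by linear_combination -hu + ((E ^ g) ^ j).prop)
  have hpos : 0 < ((E ^ g) ^ j).x := x_zpow_pos (x_pow_pos hx g) j
  have hy0 := (mul_eq_zero.1 h0).resolve_left hpos.ne'
  by_contra hk
  refine zpow_y_ne_zero hx hy (k := g * j) ?_ (by rw [zpow_mul, zpow_natCast]; exact hy0)
  rintro h; apply hk; push_cast; rw [mul_assoc, h, mul_zero]

end Pell.Solution₁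

/-! ### Evaluation of powers modulo an integer -/

/-- `f x`, with `x` evaluated first. -/
def force {α : Sort*} (x : ℕ) (f : ℕ → α) : α :=
  match x with
  | 0 => f 0
  | n + 1 => f (Nat.succ n)

@[simp] theorem force_eq {α : Sort*} (x : ℕ) (f : ℕ → α) : force x f = f x := by
  cases x <;> rfl

/-- The pair of integers `(x, y)` reduces to `s` modulo `q`. -/
def Reduces (q : ℕ) (x y : ℤ) (s : ℕ × ℕ) : Prop :=
  (x : ZMod q) = s.1 ∧ (y : ZMod q) = s.2

/-- Multiplication in `ℤ[√a]` modulo `q`. -/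
def mulMod (q a : ℕ) (s t : ℕ × ℕ) : ℕ × ℕ :=
  force ((s.1 * t.1 + a * (s.2 * t.2)) % q) fun x =>
    force ((s.1 * t.2 + s.2 * t.1) % q) fun y => (x, y)

/-- `r * s ^ n` in `ℤ[√a]` modulo `q`. -/
def mulPowMod (q a : ℕ) (s : ℕ × ℕ) : ℕ → ℕ × ℕ → ℕ × ℕ
  | 0, r => r
  | n + 1, r =>
    match mulMod q a r s with
    | (x, y) => mulPowMod q a s n (x, y)

theorem Reduces.mulMod {q a : ℕ} {x y x' y' : ℤ} {s t : ℕ × ℕ} (h : Reduces q x y s)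
    (h' : Reduces q x' y' t) :
    Reduces q (x * x' + a * (y * y')) (x * y' + y * x') (mulMod q a s t) := by
  obtain ⟨h1, h2⟩ := h
  obtain ⟨h3, h4⟩ := h'
  simp only [_root_.mulMod, force_eq, Reduces, ZMod.natCast_mod]
  push_cast
  rw [h1, h2, h3, h4]
  exact ⟨rfl, rfl⟩

section

variable {q a : ℕ}

theorem Reduces.sol_mul {E F : Pell.Solution₁ (a : ℤ)} {s t : ℕ × ℕ} (h : Reduces q E.x E.y s)
    (hF : Reduces q F.x F.y t) : Reduces q (E * F).x (E * F).y (_root_.mulMod q a s t) := by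
  rw [Pell.Solution₁.x_mul, Pell.Solution₁.y_mul]
  exact h.mulMod hF

theorem Reduces.sol_mulPow {E F : Pell.Solution₁ (a : ℤ)} {s r : ℕ × ℕ} (h : Reduces q E.x E.y s)
    (h' : Reduces q F.x F.y r) (n : ℕ) :
    Reduces q (F * E ^ n).x (F * E ^ n).y (mulPowMod q a s n r) := by
  induction n generalizing F r with
  | zero => simpa [mulPowMod] using h'
  | succ n ih =>
    rw [pow_succ', ← mul_assoc]
    exact ih (h'.sol_mul h)

theorem Reduces.sol_pow {E : Pell.Solution₁ (a : ℤ)} {s : ℕ × ℕ} (h : Reduces q E.x E.y s) (n : ℕ) :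
    Reduces q (E ^ n).x (E ^ n).y (mulPowMod q a s n (1, 0)) := by
  simpa using h.sol_mulPow (F := 1) (r := (1, 0)) (by simp [Reduces]) n

/-- Membership in a list of pairs. -/
def memPair (s : ℕ × ℕ) (L : List (ℕ × ℕ)) : Bool :=
  L.any fun t => Nat.beq t.1 s.1 && Nat.beq t.2 s.2

theorem mem_of_memPair {s : ℕ × ℕ} {L : List (ℕ × ℕ)} (h : memPair s L = true) : s ∈ L := by
  simp only [memPair, List.any_eq_true, Bool.and_eq_true, Nat.beq_eq] at h
  obtain ⟨t, ht, h1, h2⟩ := h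
  rwa [← Prod.ext h1 h2]

/-- `L` contains `s` and is closed under squares (and cubes, if `three`), and all its elements
satisfy `crit`. -/
def isClosedList (q a : ℕ) (three : Bool) (crit : ℕ × ℕ → Bool) (s : ℕ × ℕ) (L : List (ℕ × ℕ)) :
    Bool :=
  memPair s L && L.all fun t => memPair (mulMod q a t t) L &&
    (!three || memPair (mulMod q a (mulMod q a t t) t) L) && crit t

/-- Builds a list closed under squares (and cubes, if `three`) and checks it. -/
def closureCheck (q a : ℕ) (three : Bool) (crit : ℕ × ℕ → Bool) (s : ℕ × ℕ) :
    ℕ → List (ℕ × ℕ) → List (ℕ × ℕ) → Bool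
  | 0, _, L => isClosedList q a three crit s L
  | _ + 1, [], L => isClosedList q a three crit s L
  | k + 1, t :: T, L =>
    match t with
    | (x, y) =>
      bif memPair (x, y) L then closureCheck q a three crit s k T L
      else closureCheck q a three crit s k
        (mulMod q a (x, y) (x, y) ::
          (bif three then mulMod q a (mulMod q a (x, y) (x, y)) (x, y) :: T else T)) ((x, y) :: L)

theorem exists_isClosedList {three : Bool} {crit : ℕ × ℕ → Bool} {s : ℕ × ℕ} {k : ℕ}
    {T L : List (ℕ × ℕ)} (h : closureCheck q a three crit s k T L = true) :
    ∃ L', isClosedList q a three crit s L' = true := by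
  induction k generalizing T L with
  | zero => exact ⟨L, h⟩
  | succ k ih =>
    cases T with
    | nil => exact ⟨L, h⟩
    | cons t T =>
      rw [closureCheck] at h
      cases hm : memPair t L <;> simp only [hm, cond_true, cond_false] at h <;> exact ih h

theorem exists_reduces_of_isClosedList {three : Bool} {crit : ℕ × ℕ → Bool} {s : ℕ × ℕ}
    {L : List (ℕ × ℕ)} (h : isClosedList q a three crit s L = true) {E : Pell.Solution₁ (a : ℤ)}
    (hE : Reduces q E.x E.y s) (i j : ℕ) (hj : three = true ∨ j = 0) :
    ∃ t, crit t = true ∧ Reduces q (E ^ (2 ^ i * 3 ^ j)).x (E ^ (2 ^ i * 3 ^ j)).y t := by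
  simp only [isClosedList, Bool.and_eq_true, List.all_eq_true, Bool.or_eq_true,
    Bool.not_eq_true'] at h
  obtain ⟨hs, h⟩ := h
  suffices ∃ t ∈ L, Reduces q (E ^ (2 ^ i * 3 ^ j)).x (E ^ (2 ^ i * 3 ^ j)).y t by
    obtain ⟨t, ht, hr⟩ := this
    exact ⟨t, (h t ht).2, hr⟩
  induction i with
  | succ i ih =>
    obtain ⟨t, ht, hr⟩ := ih
    refine ⟨_, mem_of_memPair (h t ht).1.1, ?_⟩
    rw [show 2 ^ (i + 1) * 3 ^ j = 2 ^ i * 3 ^ j + 2 ^ i * 3 ^ j by ring, pow_add]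
    exact hr.sol_mul hr
  | zero =>
    induction j with
    | zero => exact ⟨s, mem_of_memPair hs, by simpa using hE⟩
    | succ j ih =>
      have h3 : three = true := hj.resolve_right (by omega)
      obtain ⟨t, ht, hr⟩ := ih (.inl h3)
      refine ⟨_, mem_of_memPair ((h t ht).1.2.resolve_left (by simp [h3])), ?_⟩
      rw [show 2 ^ 0 * 3 ^ (j + 1) = 2 ^ 0 * 3 ^ j + 2 ^ 0 * 3 ^ j + 2 ^ 0 * 3 ^ j by ring, pow_add,
        pow_add]
      exact (hr.sol_mul hr).sol_mul hr

/-- One of the powers of `s` with exponent in `gs` passes the test; the exponents are required to be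
odd (prime to `6`, if `three`) divisors of `G`. -/
def critOf (q a : ℕ) (three : Bool) (G : ℕ) (gs : List ℕ) (test : ℕ × ℕ → Bool) (s : ℕ × ℕ) :
    Bool :=
  gs.any fun g => Nat.beq (G % g) 0 && Nat.beq (g % 2) 1 && (!three || !Nat.beq (g % 3) 0) &&
    test (mulPowMod q a s g (1, 0))

/-- Every nonzero multiple of `8 G` (`24 G`, if `three`) is `8 m j` with `j` odd (and prime to `3`)
and `E ^ (8 * m)` passing the test. -/
theorem exists_reduces_of_closureCheck {three : Bool} {G : ℕ} {gs : List ℕ} {test : ℕ × ℕ → Bool}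
    {s₀ s : ℕ × ℕ} {k : ℕ} {E : Pell.Solution₁ (a : ℤ)} (hE : Reduces q E.x E.y s₀)
    (hs : s = mulPowMod q a s₀ (bif three then 24 else 8) (1, 0))
    (h : closureCheck q a three (critOf q a three G gs test) s k [s] [] = true) {κ : ℤ} (hκ : κ ≠ 0)
    (hG : (((bif three then 24 else 8) * G : ℕ) : ℤ) ∣ κ) :
    ∃ (m : ℕ) (j : ℤ), κ = (8 * m : ℕ) * j ∧
      (three = false ∧ Odd j ∨ three = true ∧ Odd j ∧ ¬ 3 ∣ j) ∧
      ∃ t, test t = true ∧ Reduces q (E ^ (8 * m)).x (E ^ (8 * m)).y t := by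
  obtain ⟨L, hL⟩ := exists_isClosedList h
  obtain ⟨κ, rfl⟩ := (Dvd.intro _ (by push_cast; rfl) :
    (((bif three then 24 else 8 : ℕ)) : ℤ) ∣ _).trans hG
  have hκ0 : κ ≠ 0 := by rintro rfl; simp at hκ
  have hc0 : ((bif three then 24 else 8 : ℕ) : ℤ) ≠ 0 := by cases three <;> simp
  have hGκ : (G : ℤ) ∣ κ := by
    rw [Nat.cast_mul] at hG
    exact Int.dvd_of_mul_dvd_mul_left hc0 hG
  obtain ⟨x, y, j, hodd, h3, hxy, hκj⟩ : ∃ (x y : ℕ) (j : ℤ), Odd j ∧ (three = true → ¬ 3 ∣ j) ∧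
      (three = true ∨ y = 0) ∧ κ = 2 ^ x * 3 ^ y * j := by
    cases three with
    | true =>
      obtain ⟨x, y, j, h1, h2, h3⟩ := Int.exists_eq_two_pow_mul_three_pow_mul hκ0
      exact ⟨x, y, j, h1, fun _ => h2, .inl rfl, h3⟩
    | false =>
      obtain ⟨x, j, h1, h2⟩ := Int.exists_eq_two_pow_mul_odd' hκ0
      exact ⟨x, 0, j, h1, by simp, .inr rfl, by rw [h2]; ring⟩
  have hr := hE.sol_pow (bif three then 24 else 8)
  rw [← hs] at hr
  obtain ⟨t, ht, hrt⟩ := exists_reduces_of_isClosedList hL hr x y hxy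
  simp only [critOf, List.any_eq_true, Bool.and_eq_true, Nat.beq_eq, Bool.or_eq_true,
    Bool.not_eq_true', ← Bool.not_eq_true, Nat.beq_eq] at ht
  obtain ⟨g, -, ⟨⟨hgG, hg2⟩, hg3⟩, htest⟩ := ht
  have hgj : (g : ℤ) ∣ j := by
    have h1 : (g : ℤ) ∣ 2 ^ x * 3 ^ y * j := by
      rw [← hκj]; exact (Int.natCast_dvd_natCast.2 (Nat.dvd_of_mod_eq_zero hgG)).trans hGκ
    refine IsCoprime.dvd_of_dvd_mul_left (IsCoprime.mul_right (IsCoprime.pow_right ?_) ?_) h1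
    · exact Nat.isCoprime_iff_coprime.2 (Nat.coprime_two_right.2 (Nat.odd_iff.2 hg2))
    · rcases hxy with h3' | rfl
      · refine IsCoprime.pow_right (Nat.isCoprime_iff_coprime.2 ?_)
        exact ((Nat.Prime.coprime_iff_not_dvd Nat.prime_three).2 fun h =>
          hg3.resolve_left (by simp [h3']) (Nat.mod_eq_zero_of_dvd h)).symm
      · rw [pow_zero]; exact isCoprime_one_right
  obtain ⟨j, rfl⟩ := hgj
  have hfin := hrt.sol_pow g
  rw [← pow_mul, ← pow_mul] at hfin
  refine ⟨(bif three then 3 else 1) * (2 ^ x * 3 ^ y * g), j, ?_, ?_, _, htest, ?_⟩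
  · rw [hκj]; cases three <;> (push_cast; simp only [cond_true, cond_false]; ring)
  · have ho := (Int.odd_mul.1 hodd).2
    cases three with
    | true => exact .inr ⟨rfl, ho, fun hd => h3 rfl (hd.mul_left _)⟩
    | false => exact .inl ⟨rfl, ho⟩
  · convert hfin using 3 <;> cases three <;> simp only [cond_true, cond_false] <;> ring

end

/-! ### Residue symbols -/

/-- The Jacobi symbol of `a` modulo the odd number `b` is `-1` (if `s` is true) or `1` (if `s` is
false); this is decided within `k` steps. -/
def hasJacobi : ℕ → Bool → ℕ → ℕ → Bool
  | 0, _, _, _ => false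
  | k + 1, s, a, b =>
    bif Nat.beq a 1 then !s
    else bif Nat.beq (a % 2) 0 then
      force (a / 2) fun a' =>
        bif Nat.beq (b % 8) 3 || Nat.beq (b % 8) 5 then hasJacobi k (!s) a' b
        else hasJacobi k s a' b
    else force (b % a) fun c =>
      bif Nat.beq (a % 4) 3 && Nat.beq (b % 4) 3 then hasJacobi k (!s) c a
      else hasJacobi k s c a

theorem jacobiSym_eq_of_hasJacobi {k : ℕ} {s : Bool} {a b : ℕ} (hb : b % 2 = 1)
    (h : hasJacobi k s a b = true) : jacobiSym a b = if s then -1 else 1 := by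
  induction k generalizing s a b with
  | zero => simp [hasJacobi] at h
  | succ k ih =>
    simp only [hasJacobi, force_eq, Bool.cond_eq_ite, Nat.beq_eq, Bool.or_eq_true,
      Bool.and_eq_true] at h
    split_ifs at h with h1 h2 h3 h3
    · subst h1
      cases s <;> simp_all
    · rw [← jacobiSym.even_odd (by exact_mod_cast h2) hb, if_pos h3]
      have := ih hb h
      rw [Int.natCast_ediv, Nat.cast_ofNat] at this
      rw [this]; cases s <;> rfl
    · rw [← jacobiSym.even_odd (by exact_mod_cast h2) hb, if_neg h3]
      have := ih hb h
      rwa [Int.natCast_ediv, Nat.cast_ofNat] at this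
    · have ha := Nat.mod_two_ne_zero.1 h2
      have := ih ha h
      rw [Int.natCast_mod, ← jacobiSym.mod_left] at this
      rw [← jacobiSym.quadratic_reciprocity_if ha hb, if_pos h3, this]; cases s <;> rfl
    · have ha := Nat.mod_two_ne_zero.1 h2
      have := ih ha h
      rw [Int.natCast_mod, ← jacobiSym.mod_left] at this
      rw [← jacobiSym.quadratic_reciprocity_if ha hb, if_neg h3, this]

theorem dvd_sub_of_reduces {q : ℕ} {x y : ℤ} {s : ℕ × ℕ} (h : Reduces q x y s) :
    (q : ℤ) ∣ x - s.1 ∧ (q : ℤ) ∣ y - s.2 := by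
  refine ⟨(ZMod.intCast_eq_intCast_iff_dvd_sub _ _ q).1 ?_,
    (ZMod.intCast_eq_intCast_iff_dvd_sub _ _ q).1 ?_⟩ <;> simp [h.1, h.2]

/-- The test for the first coordinate being a non-residue modulo `W`. -/
def symbolTest (W : ℕ) (t : ℕ × ℕ) : Bool :=
  hasJacobi 64 true (t.1 % W) W

/-- The test for `x + V y` and `x - V y` both being non-residues modulo `c`. -/
def symbolAddTest (V c : ℕ) (t : ℕ × ℕ) : Bool :=
  hasJacobi 64 true ((t.1 + V * t.2) % c) c &&
    hasJacobi 64 true ((t.1 + (c - V % c) * t.2) % c) c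

theorem jacobiSym_of_symbolTest {W : ℕ} (hW : W % 2 = 1) {t : ℕ × ℕ} (h : symbolTest W t = true)
    {x y : ℤ} (ht : Reduces W x y t) : jacobiSym x W = -1 := by
  rw [jacobiSym_congr (dvd_sub_of_reduces ht).1]
  have := jacobiSym_eq_of_hasJacobi hW h
  rwa [Int.natCast_mod, ← jacobiSym.mod_left, if_pos rfl] at this

theorem jacobiSym_of_symbolAddTest {V c : ℕ} (hc : c % 2 = 1) {t : ℕ × ℕ}
    (h : symbolAddTest V c t = true) {x y : ℤ} (ht : Reduces c x y t) :
    jacobiSym (x + V * y) c = -1 ∧ jacobiSym (x - V * y) c = -1 := by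
  obtain ⟨⟨u, h1⟩, v, h2⟩ := dvd_sub_of_reduces ht
  simp only [symbolAddTest, Bool.and_eq_true] at h
  constructor
  · rw [jacobiSym_congr (v := (t.1 + V * t.2 : ℕ))]
    · have := jacobiSym_eq_of_hasJacobi hc h.1
      rwa [Int.natCast_mod, ← jacobiSym.mod_left, if_pos rfl] at this
    · push_cast
      exact ⟨u + V * v, by linear_combination h1 + V * h2⟩
  · rw [jacobiSym_congr (v := (t.1 + (c - V % c) * t.2 : ℕ))]
    · have := jacobiSym_eq_of_hasJacobi hc h.2
      rwa [Int.natCast_mod, ← jacobiSym.mod_left, if_pos rfl] at this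
    · push_cast [(Nat.mod_lt V (show 0 < c by omega)).le]
      exact ⟨u - V * v - t.2 * (1 + V / c), by
        linear_combination h1 - V * h2 + t.2 * Int.emod_add_mul_ediv (V : ℤ) c⟩

namespace Pell.Solution₁

variable {a : ℕ} {E : Solution₁ (a : ℤ)}

theorem isIsolated_of_symbolTest (hx : 0 < E.x) (hy : 0 < E.y) {e W G k : ℕ} {gs : List ℕ}
    {s₀ s : ℕ × ℕ} (hW : W % 2 = 1) (hE : Reduces W E.x E.y s₀)
    (hs : s = mulPowMod W a s₀ 8 (1, 0))
    (h : closureCheck W a false (critOf W a false G gs (symbolTest W)) s k [s] [] = true) (U : ℤ) :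
    E.IsIsolated (8 * G) U (2 ^ e * W : ℕ) := by
  refine isIsolated_of_jacobiSym hx hy (s := 1) (Nat.odd_iff.2 hW) (.inl rfl) (by push_cast; ring)
    (fun κ hκ hd => ?_) U
  obtain ⟨m, j, h1, h2, t, h3, h4⟩ := exists_reduces_of_closureCheck hE (three := false) hs h hκ hd
  exact ⟨m, j, h1, h2.elim (·.2) (by simp), jacobiSym_of_symbolTest hW h3 h4⟩

theorem isIsolated_of_symbolAddTest (ha : 0 < a) (hx : 0 < E.x) {three : Bool} {V i c G k : ℕ}
    {gs : List ℕ} {s₀ s : ℕ × ℕ} (hc : c % 2 = 1)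
    (hci : V ^ 2 + (bif three then 3 else 1) * a = 2 ^ i * c) (hE : Reduces c E.x E.y s₀)
    (hs : s = mulPowMod c a s₀ (bif three then 24 else 8) (1, 0))
    (h : closureCheck c a three (critOf c a three G gs (symbolAddTest V c)) s k [s] [] = true) :
    E.IsIsolated ((bif three then 24 else 8) * G) 1 V := by
  refine isIsolated_of_jacobiSym_add (by exact_mod_cast ha) hx
    (f := (bif three then 3 else 1 : ℕ)) (Nat.odd_iff.2 hc) (by exact_mod_cast hci)
    (fun κ hκ hd => ?_)
  obtain ⟨m, j, h1, h2, t, h3, h4⟩ := exists_reduces_of_closureCheck hE hs h hκ hd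
  refine ⟨m, j, h1, ?_, jacobiSym_of_symbolAddTest hc h3 h4⟩
  cases three <;> simpa using h2

end Pell.Solution₁

/-! ### Relative units -/

/-- Addition of pairs modulo `q`. -/
def addMod (q : ℕ) (s t : ℕ × ℕ) : ℕ × ℕ :=
  force ((s.1 + t.1) % q) fun x => force ((s.2 + t.2) % q) fun y => (x, y)

theorem Reduces.zsqrtd_add {q : ℕ} {n : ℤ} {z w : ℤ√n} {s t : ℕ × ℕ} (h : Reduces q z.re z.im s)
    (h' : Reduces q w.re w.im t) : Reduces q (z + w).re (z + w).im (addMod q s t) := by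
  obtain ⟨h1, h2⟩ := h
  obtain ⟨h3, h4⟩ := h'
  simp only [addMod, force_eq, Reduces, ZMod.natCast_mod, Zsqrtd.re_add, Zsqrtd.im_add]
  push_cast
  rw [h1, h2, h3, h4]
  exact ⟨rfl, rfl⟩

theorem Reduces.zsqrtd_mul {q n : ℕ} {z w : ℤ√(n : ℤ)} {s t : ℕ × ℕ} (h : Reduces q z.re z.im s)
    (hw : Reduces q w.re w.im t) : Reduces q (z * w).re (z * w).im (_root_.mulMod q n s t) := by
  rw [Zsqrtd.re_mul, Zsqrtd.im_mul, mul_assoc]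
  exact h.mulMod hw

/-- `k` steps of the recursion defining `chebPair`, modulo `q`. -/
def chebLoop (q n : ℕ) (A D : ℕ × ℕ) : ℕ → ℕ × ℕ → ℕ × ℕ → (ℕ × ℕ) × (ℕ × ℕ)
  | 0, t, u => (t, u)
  | k + 1, t, u =>
    match addMod q (mulMod q n A t) (mulMod q n D u), addMod q (mulMod q n A u) t with
    | (x, y), (x', y') => chebLoop q n A D k (x, y) (x', y')

theorem reduces_chebLoop {q n : ℕ} {A : ℤ√(n : ℤ)} {s D : ℕ × ℕ} (hA : Reduces q A.re A.im s)
    (hD : Reduces q (A ^ 2 - 1).re (A ^ 2 - 1).im D) (k l : ℕ) {t u : ℕ × ℕ}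
    (ht : Reduces q (chebPair A l).1.re (chebPair A l).1.im t)
    (hu : Reduces q (chebPair A l).2.re (chebPair A l).2.im u) :
    Reduces q (chebPair A (l + k)).1.re (chebPair A (l + k)).1.im (chebLoop q n s D k t u).1 ∧
    Reduces q (chebPair A (l + k)).2.re (chebPair A (l + k)).2.im (chebLoop q n s D k t u).2 := by
  induction k generalizing l t u with
  | zero => exact ⟨ht, hu⟩
  | succ k ih =>
    rw [show l + (k + 1) = l + 1 + k by ring]
    refine ih (l + 1) ?_ ?_
    · exact (hA.zsqrtd_mul ht).zsqrtd_add (hD.zsqrtd_mul hu)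
    · exact (hA.zsqrtd_mul hu).zsqrtd_add ht

/-- `f k` holds for all `k < n`. -/
def allBelow (f : ℕ → Bool) : ℕ → Bool
  | 0 => true
  | n + 1 => f n && allBelow f n

theorem of_allBelow {f : ℕ → Bool} {n : ℕ} (h : allBelow f n = true) {k : ℕ} (hk : k < n) :
    f k = true := by
  induction n with
  | zero => omega
  | succ n ih =>
    simp only [allBelow, Bool.and_eq_true] at h
    rcases Nat.lt_succ_iff_lt_or_eq.1 hk with hk | rfl
    exacts [ih h.2 hk, h.1]

/-- The only square roots of `1` modulo `q` are `1` and `-1`. -/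
def rootCheck (q : ℕ) : Bool :=
  allBelow (fun s => !Nat.beq (s * s % q) 1 || Nat.beq s 1 || Nat.beq (s + 1) q) q

theorem dvd_of_rootCheck {q : ℕ} (hq : 1 < q) (h : rootCheck q = true) (s : ℤ)
    (hs : (q : ℤ) ∣ s ^ 2 - 1) : (q : ℤ) ∣ s - 1 ∨ (q : ℤ) ∣ s + 1 := by
  have hq0 : (0 : ℤ) < q := by omega
  obtain ⟨t, ht⟩ := Int.eq_ofNat_of_zero_le (Int.emod_nonneg s hq0.ne')
  have htq : t < q := by have := Int.emod_lt_of_pos s hq0; omega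
  have hst : (q : ℤ) ∣ s - t := by rw [← ht]; exact Int.dvd_self_sub_emod
  have h2 : t * t % q = 1 := by
    have h3 : (q : ℤ) ∣ t * t - 1 := by
      obtain ⟨u, hu⟩ := hst
      obtain ⟨v, hv⟩ := hs
      exact ⟨v - u * (s + t), by linear_combination hv - (s + t) * hu⟩
    have h4 := (Int.emod_eq_emod_iff_emod_sub_eq_zero.2 (Int.emod_eq_zero_of_dvd h3))
    have h5 : t * t % q = 1 % q := by exact_mod_cast h4
    rwa [Nat.mod_eq_of_lt hq] at h5
  have h3 := of_allBelow h htq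
  simp only [Bool.or_eq_true, Bool.not_eq_true', ← Bool.not_eq_true, Nat.beq_eq] at h3
  rcases h3 with (h3 | rfl) | rfl
  · exact absurd h2 h3
  · exact .inl (by exact_mod_cast hst)
  · right; obtain ⟨u, hu⟩ := hst; exact ⟨u + 1, by push_cast at hu ⊢; linear_combination hu⟩

/-- The conditions of `isIsolated_of_relative_unit`, for the solution `(X, Y)` of the Pell equation
of `n`. -/
def unitCheck (n X Y c a e r p L g : ℕ) (A B : ℕ × ℕ) : Bool :=
  [3, 5, 7, 11, 13, 17, 47].any (Nat.beq p) && Nat.beq n (c * a) && Nat.ble 1 c && Nat.ble 1 a &&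
  Nat.ble 1 e && Nat.ble 1 r && Nat.ble 1 A.1 && Nat.beq (c * r ^ 2) (a + e) &&
  !Nat.beq (a % p) 0 &&
  Nat.beq (a * (A.1 ^ 2 + n * A.2 ^ 2))
    (2 * (a * (B.1 ^ 2 + n * B.2 ^ 2) + r * (n * (2 * (B.1 * B.2)))) + a) &&
  Nat.beq (a * (2 * (A.1 * A.2)))
    (2 * (a * (2 * (B.1 * B.2)) + r * (B.1 ^ 2 + n * B.2 ^ 2))) &&
  rootCheck (e * p) &&
  (match mulPowMod (e * p) n (X % (e * p), Y % (e * p)) g (1, 0) with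
    | (x, y) => Nat.beq x 1 && Nat.beq y 0) &&
  (match chebLoop (p * p) n A ((A.1 ^ 2 + n * A.2 ^ 2 + (p * p - 1)) % (p * p), 2 * (A.1 * A.2)) L
      (1, 0) (0, 0) with
    | (t, u) => Nat.beq t.1 1 && Nat.beq t.2 0 &&
      (match mulMod (p * p) n B u with
        | (x, y) => Nat.beq (x % p) 0 && Nat.beq (y % p) 0 && !Nat.beq (x / p % p) 0))

theorem Pell.Solution₁.isIsolated_of_unitCheck {n X Y c a e r p L g : ℕ} {A B : ℕ × ℕ}
    (h : unitCheck n X Y c a e r p L g A B = true) {E : Pell.Solution₁ (n : ℤ)} (hx : 0 < E.x)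
    (hy : 0 < E.y) (hX : E.x = X) (hY : E.y = Y) : E.IsIsolated (2 * g) 1 (c * r : ℕ) := by
  simp only [unitCheck, Bool.and_eq_true, Bool.not_eq_true', ← Bool.not_eq_true, Nat.beq_eq,
    Nat.ble_eq, List.any_eq_true] at h
  obtain ⟨⟨⟨⟨⟨⟨⟨⟨⟨⟨⟨⟨⟨⟨q, hq, rfl⟩, hn⟩, hc⟩, ha⟩, he⟩, hr⟩, hA0⟩, hcr⟩, hpa⟩, hre⟩, him⟩, hroot⟩,
    hg1, hg2⟩, ⟨hT1, hT2⟩, ⟨hB1, hB2⟩, hB3⟩ := h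
  have hp : p.Prime ∧ p ≠ 2 := by
    fin_cases hq <;> norm_num
  have hp1 := hp.1.one_lt
  have hep : 1 < e * p := hp1.trans_le (Nat.le_mul_of_pos_left p he)
  have hE := Reduces.sol_pow (q := e * p) (E := E) (s := (X % (e * p), Y % (e * p)))
    (by rw [hX, hY]; simp [Reduces]) g
  obtain ⟨hE1, hE2⟩ := dvd_sub_of_reduces hE
  rw [hg1] at hE1
  rw [hg2] at hE2
  set D := ((A.1 ^ 2 + n * A.2 ^ 2 + (p * p - 1)) % (p * p), 2 * (A.1 * A.2)) with hD
  have hpp : 1 ≤ p * p := Nat.mul_pos hp.1.pos hp.1.pos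
  obtain ⟨hT, hU⟩ := reduces_chebLoop (q := p * p) (A := (⟨A.1, A.2⟩ : ℤ√(n : ℤ))) (s := A)
    (D := D) (by simp [Reduces]) (by
      simp only [hD, Reduces, ZMod.natCast_mod, sq, Zsqrtd.re_sub, Zsqrtd.im_sub, Zsqrtd.re_mul,
        Zsqrtd.im_mul, Zsqrtd.re_one, Zsqrtd.im_one]
      push_cast [hpp]
      constructor
      · have : (p : ZMod (p * p)) * p = 0 := by exact_mod_cast ZMod.natCast_self (p * p)
        linear_combination -this
      · ring) L 0 (t := (1, 0)) (u := (0, 0)) (by simp [Reduces, chebPair])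
    (by simp [Reduces, chebPair])
  rw [zero_add] at hT hU
  obtain ⟨hT', hT''⟩ := dvd_sub_of_reduces hT
  have hBU := dvd_sub_of_reduces (Reduces.zsqrtd_mul (z := (⟨B.1, B.2⟩ : ℤ√(n : ℤ))) (s := B)
    (by simp [Reduces]) hU)
  rw [hT1] at hT'
  rw [hT2] at hT''
  generalize mulMod (p * p) n B (chebLoop (p * p) n A D L (1, 0) (0, 0)).2 = b at *
  obtain ⟨b0, hb0⟩ := Nat.dvd_of_mod_eq_zero hB1
  obtain ⟨b1, hb1⟩ := Nat.dvd_of_mod_eq_zero hB2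
  rw [hb0, Nat.mul_div_cancel_left _ hp.1.pos] at hB3
  obtain ⟨⟨w0, h0⟩, w1, h1⟩ := hBU
  rw [hb0] at h0
  rw [hb1] at h1
  push_cast at h0 h1
  have key := isIsolated_of_relative_unit (n := n) (a := a) (c := c) (e := e) (r := r) hp.1 hp.2
    (by exact_mod_cast hn) (by exact_mod_cast hc) (by exact_mod_cast ha) (by exact_mod_cast he)
    (by exact_mod_cast hr) (by exact_mod_cast hcr) ?_ ?_ (A := ⟨A.1, A.2⟩) (B := ⟨B.1, B.2⟩)
    (β := ⟨b0 + p * w0, b1 + p * w1⟩) (v := 1) ?_ (show (0 : ℤ) < A.1 by exact_mod_cast hA0)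
    (by positivity) (L := L) ?_ ?_ ?_ hx hy (g := g) (by exact_mod_cast hE1) (by simpa using hE2)
  · exact_mod_cast key
  · rw [Int.natCast_dvd_natCast, Nat.dvd_iff_mod_eq_zero]; exact hpa
  · have := dvd_of_rootCheck hep hroot
    exact_mod_cast this
  · rw [Zsqrtd.ext_iff]
    zify at hre him
    constructor <;> simp [sq]
    · linear_combination hre
    · linear_combination him
  · have : (p : ℤ√(n : ℤ)) ^ 2 = ((p * p : ℕ) : ℤ) := by push_cast; ring
    rw [this, Zsqrtd.intCast_dvd]
    exact ⟨by simpa using hT', by simpa using hT''⟩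
  · rw [Zsqrtd.ext_iff]
    simp only [pow_one, Zsqrtd.re_mul, Zsqrtd.im_mul, Zsqrtd.re_natCast, Zsqrtd.im_natCast]
      at h0 h1 ⊢
    constructor
    · linear_combination h0
    · linear_combination h1
  · intro hd
    have : (p : ℤ) ∣ b0 := by simpa using hd
    exact hB3 (Nat.mod_eq_zero_of_dvd (by exact_mod_cast this))

/-! ### Certificates of isolation -/

/-- Data proving that a point is isolated. -/
inductive IsoCert
  | trivial
  | half (P : ℕ)
  | symbol (e W G : ℕ) (gs : List ℕ)
  | symbolAdd (h f n X Y V : ℕ) (three : Bool) (i c G : ℕ) (gs : List ℕ)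
  | unit (h f n X Y c a e r p L g : ℕ) (A B : ℕ × ℕ)

namespace IsoCert

/-- The exponents covered by the certificate are the multiples of this number. -/
def modulus : IsoCert → ℕ
  | trivial => 8
  | half _ => 4
  | symbol _ _ G _ => 8 * G
  | symbolAdd h _ _ _ _ _ three _ _ G _ => h * ((bif three then 24 else 8) * G)
  | unit h _ _ _ _ _ _ _ _ _ _ g _ _ => h * (2 * g)

/-- The conditions of `Pell.Solution₁.IsIsolated.of_scale`. -/
def scaleCheck (a X Y u₀ h f n X₁ Y₁ : ℕ) : Bool :=
  Nat.ble 1 f && Nat.ble 1 u₀ && Nat.ble 1 X₁ && Nat.ble 1 Y₁ &&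
  Nat.beq (X₁ ^ 2) (1 + n * Y₁ ^ 2) && Nat.beq (f ^ 2 * n) (a * (u₀ ^ 2) ^ 2) &&
  match mulPowMod 0 a (X, Y) h (1, 0) with
  | (x, y) => Nat.beq x X₁ && Nat.beq (f * y) (u₀ ^ 2 * Y₁)

/-- Validity of a certificate for the solution `(X, Y)` of the Pell equation of `a` and the point
`(V, u₀ ^ 2)`. -/
def check (a X Y u₀ V : ℕ) : IsoCert → Bool
  | trivial => Nat.beq u₀ 0 && Nat.beq (210 ^ 5 % V) 0
  | half P => Nat.beq (2 * X + 3 * P) (P ^ 3) && Nat.beq (P % 2) 1 && Nat.ble 3 P &&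
    Nat.beq ((P ^ 2 - 1) % u₀) 0
  | symbol e W G gs => Nat.beq (W % 2) 1 && Nat.beq V (2 ^ e * W) &&
    match mulPowMod W a (X % W, Y % W) 8 (1, 0) with
    | (x, y) => closureCheck W a false (critOf W a false G gs (symbolTest W)) (x, y) 1000
      [(x, y)] []
  | symbolAdd h f n X' Y' V' three i c G gs =>
    scaleCheck a X Y u₀ h f n X' Y' && Nat.beq V (f * V') && Nat.beq (c % 2) 1 && Nat.ble 1 n &&
    Nat.beq (V' ^ 2 + (bif three then 3 else 1) * n) (2 ^ i * c) &&
    match mulPowMod c n (X' % c, Y' % c) (bif three then 24 else 8) (1, 0) with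
    | (x, y) => closureCheck c n three (critOf c n three G gs (symbolAddTest V' c)) (x, y) 1000
      [(x, y)] []
  | unit h f n X' Y' c a' e r p L g A B =>
    scaleCheck a X Y u₀ h f n X' Y' && Nat.beq V (f * (c * r)) &&
    unitCheck n X' Y' c a' e r p L g A B

variable {a X Y u₀ V : ℕ} {E : Pell.Solution₁ (a : ℤ)}

theorem isIsolated_of_scaleCheck {h f n X' Y' M' V' : ℕ}
    (hs : scaleCheck a X Y u₀ h f n X' Y' = true) (hX : E.x = X) (hY : E.y = Y)
    (H : ∀ E' : Pell.Solution₁ (n : ℤ), 0 < E'.x → 0 < E'.y → E'.x = X' → E'.y = Y' →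
      E'.IsIsolated M' 1 V') : E.IsIsolated (h * M') (u₀ ^ 2 : ℕ) (f * V' : ℕ) := by
  simp only [scaleCheck, Bool.and_eq_true, Nat.beq_eq, Nat.ble_eq] at hs
  obtain ⟨⟨⟨⟨⟨⟨hf, hu⟩, hX1⟩, hY1⟩, hprop⟩, hn⟩, h1, h2⟩ := hs
  have hE := Reduces.sol_pow (q := 0) (E := E) (s := (X, Y)) (by rw [hX, hY]; simp [Reduces]) h
  obtain ⟨hE1, hE2⟩ := dvd_sub_of_reduces hE
  rw [Nat.cast_zero, zero_dvd_iff, sub_eq_zero] at hE1 hE2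
  let E' : Pell.Solution₁ (n : ℤ) := .mk X' Y' (by zify at hprop; linear_combination hprop)
  have hE'x : E'.x = X' := Pell.Solution₁.x_mk _ _ _
  have hE'y : E'.y = Y' := Pell.Solution₁.y_mk _ _ _
  have key := Pell.Solution₁.IsIsolated.of_scale (E := E) (E' := E') (h := h) (f := f) (u₀ := u₀)
    (by positivity) (by positivity) (by rw [hE1, h1, hE'x])
    (by rw [hE2, hE'y]; exact_mod_cast h2) (by exact_mod_cast hn)
    (H E' (by rw [hE'x]; exact_mod_cast hX1) (by rw [hE'y]; exact_mod_cast hY1) hE'x hE'y)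
  exact_mod_cast key

theorem isIsolated {C : IsoCert} (h : C.check a X Y u₀ V = true) (ha : 0 < a) (hx : 0 < E.x)
    (hy : 0 < E.y) (hX : E.x = X) (hY : E.y = Y) :
    E.IsIsolated C.modulus (u₀ ^ 2 : ℕ) V := by
  have hred : ∀ q : ℕ, Reduces q E.x E.y (X % q, Y % q) := fun q => by rw [hX, hY]; simp [Reduces]
  cases C with
  | trivial =>
    simp only [check, Bool.and_eq_true, Nat.beq_eq] at h
    obtain ⟨rfl, h⟩ := h
    have := Pell.Solution₁.isIsolated_trivial (E := E) (by exact_mod_cast ha) hx hy (c := V)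
      (n := 5)
      (by exact_mod_cast Nat.dvd_of_mod_eq_zero h)
    simpa [modulus] using this
  | half P =>
    simp only [check, Bool.and_eq_true, Nat.beq_eq, Nat.ble_eq] at h
    obtain ⟨⟨⟨h1, h2⟩, h3⟩, h4⟩ := h
    have h5 : (u₀ : ℤ) ∣ (P : ℤ) ^ 2 - 1 := by
      have := Nat.dvd_of_mod_eq_zero h4
      have hP : 1 ≤ P ^ 2 := Nat.one_le_pow _ _ (by omega)
      exact_mod_cast (Int.natCast_dvd_natCast.2 this)
    have := Pell.Solution₁.isIsolated_half_unit (E := E) (P := P)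
      (by rw [hX]; zify at h1; linear_combination h1) (by exact_mod_cast Nat.odd_iff.2 h2)
      (by exact_mod_cast h3) h5 V
    exact_mod_cast this
  | symbol e W G gs =>
    simp only [check, Bool.and_eq_true, Nat.beq_eq] at h
    obtain ⟨⟨h1, rfl⟩, h3⟩ := h
    exact Pell.Solution₁.isIsolated_of_symbolTest hx hy h1 (hred W) rfl h3 _
  | symbolAdd h f n X' Y' V' three i c G gs =>
    simp only [check, Bool.and_eq_true, Nat.beq_eq, Nat.ble_eq] at h
    obtain ⟨⟨⟨⟨⟨h1, rfl⟩, h3⟩, h4⟩, h5⟩, h6⟩ := h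
    refine isIsolated_of_scaleCheck h1 hX hY fun E' hx' hy' hX' hY' => ?_
    exact Pell.Solution₁.isIsolated_of_symbolAddTest h4 hx' h3 h5
      (by rw [hX', hY']; simp [Reduces]) rfl h6
  | unit h f n X' Y' c a' e r p L g A B =>
    simp only [check, Bool.and_eq_true, Nat.beq_eq] at h
    obtain ⟨⟨h1, rfl⟩, h3⟩ := h
    exact isIsolated_of_scaleCheck h1 hX hY fun E' hx' hy' hX' hY' =>
      Pell.Solution₁.isIsolated_of_unitCheck h3 hx' hy' hX' hY'

end IsoCert

/-! ### Classes of solutions of `v ^ 2 - a w ^ 2 = b` -/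

namespace Pell.Solution₁

theorem exists_fundamental {a : ℤ} {E : Solution₁ a} (ha : 0 < a) (hx : 0 < E.x) (hy : 0 < E.y)
    {b : ℤ} (hb : 0 < b) {v w : ℤ} (hv : 0 < v) (h : v ^ 2 - a * w ^ 2 = b) :
    ∃ (k : ℤ) (v₁ w₁ : ℤ), 0 < v₁ ∧ v₁ ^ 2 - a * w₁ ^ 2 = b ∧ 2 * a * w₁ ^ 2 ≤ b * (E.x - 1) ∧
      v = v₁ * (E ^ k).x + a * (w₁ * (E ^ k).y) ∧ w = v₁ * (E ^ k).y + w₁ * (E ^ k).x := by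
  have hprop := E.prop
  have hx1 : 1 < E.x := by nlinarith [mul_pos ha (mul_pos hy hy)]
  induction hn : w.natAbs using Nat.strong_induction_on generalizing v w with
  | _ n ih =>
  subst hn
  rcases le_or_gt (2 * a * w ^ 2) (b * (E.x - 1)) with hle | hlt
  · exact ⟨0, v, w, hv, h, hle, by simp, by simp⟩
  have hw0 : w ≠ 0 := by rintro rfl; nlinarith
  obtain ⟨s, hs, hsw⟩ : ∃ s : ℤ, s ^ 2 = 1 ∧ 0 < s * w := by
    rcases lt_or_gt_of_ne hw0 with h | h
    · exact ⟨-1, by norm_num, by linarith⟩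
    · exact ⟨1, by norm_num, by linarith⟩
  have hw2 : 0 < w ^ 2 := by positivity
  have hv' : 0 < v * E.x - a * (w * (s * E.y)) := by
    have h1 : (a * (s * w * E.y)) ^ 2 < (v * E.x) ^ 2 := by
      have : (v * E.x) ^ 2 - (a * (s * w * E.y)) ^ 2 = b * E.x ^ 2 + a * w ^ 2 := by
        linear_combination E.x ^ 2 * h + a * w ^ 2 * hprop - a ^ 2 * w ^ 2 * E.y ^ 2 * hs
      nlinarith [mul_pos ha hw2, mul_pos hb (mul_pos hx hx)]
    have := (abs_lt_of_sq_lt_sq' h1 (by positivity)).2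
    linarith
  have h1 : s * w * (E.x - 1) < v * E.y := by
    refine (abs_lt_of_sq_lt_sq' (lt_of_mul_lt_mul_left ?_ ha.le) ?_).2
    swap; · positivity
    have : a * (v * E.y) ^ 2 - a * (s * w * (E.x - 1)) ^ 2 =
        b * (E.x - 1) * (E.x + 1) + 2 * a * w ^ 2 * (E.x - 1) := by
      linear_combination a * E.y ^ 2 * h - (a * w ^ 2 + b) * hprop - a * w ^ 2 * (E.x - 1) ^ 2 * hs
    have h2 : 0 < E.x - 1 := by linarith
    have h3 : 0 < b * (E.x - 1) * (E.x + 1) := by positivity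
    have h4 : 0 < 2 * a * w ^ 2 * (E.x - 1) := by positivity
    linarith
  have h2 : v * E.y < s * w * (E.x + 1) := by
    refine (abs_lt_of_sq_lt_sq' (lt_of_mul_lt_mul_left ?_ ha.le) ?_).2
    swap; · positivity
    have : a * (s * w * (E.x + 1)) ^ 2 - a * (v * E.y) ^ 2 =
        (E.x + 1) * (2 * a * w ^ 2 - b * (E.x - 1)) := by
      linear_combination -a * E.y ^ 2 * h + (a * w ^ 2 + b) * hprop + a * w ^ 2 * (E.x + 1) ^ 2 * hs
    have : 0 < (E.x + 1) * (2 * a * w ^ 2 - b * (E.x - 1)) := mul_pos (by linarith) (by linarith)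
    linarith
  have hlt' : (w * E.x - v * (s * E.y)).natAbs < w.natAbs := by
    rw [Int.natAbs_lt_iff_sq_lt]
    have h3 : (s * w * E.x - v * E.y) ^ 2 < (s * w) ^ 2 :=
      sq_lt_sq' (by linarith) (by linarith)
    have h4 : (w * E.x - v * (s * E.y)) ^ 2 = (s * w * E.x - v * E.y) ^ 2 := by
      linear_combination (v ^ 2 * E.y ^ 2 - w ^ 2 * E.x ^ 2) * hs
    have h5 : (s * w) ^ 2 = w ^ 2 := by linear_combination w ^ 2 * hs
    rwa [h4, ← h5]
  obtain ⟨k, v₁, w₁, h3, h4, h5, h6, h7⟩ := ih _ hlt' hv'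
    (by linear_combination h + (v ^ 2 - a * w ^ 2) * hprop +
      (a ^ 2 * w ^ 2 * E.y ^ 2 - a * v ^ 2 * E.y ^ 2) * hs) rfl
  have hprop' := (E ^ k).prop
  rcases sq_eq_one_iff.1 hs with rfl | rfl
  · refine ⟨k + 1, v₁, w₁, h3, h4, h5, ?_, ?_⟩ <;>
      rw [zpow_add_one, x_mul, y_mul]
    · linear_combination E.x * h6 + a * E.y * h7 - v * hprop
    · linear_combination E.y * h6 + E.x * h7 - w * hprop
  · refine ⟨k - 1, v₁, w₁, h3, h4, h5, ?_, ?_⟩ <;>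
      rw [zpow_sub_one, x_mul, y_mul, x_inv, y_inv]
    · linear_combination E.x * h6 - a * E.y * h7 - v * hprop
    · linear_combination -E.y * h6 + E.x * h7 - w * hprop

end Pell.Solution₁

/-- An approximation to the square root of `t` from above, improved `k` times. -/
def newton (t : ℕ) : ℕ → ℕ → ℕ
  | 0, s => s
  | k + 1, s => force ((s + t / s) / 2) fun r => bif Nat.ble s r then s else newton t k r

/-- If `a w ^ 2 + b` is a square `s ^ 2`, then `s` and `w`, `-w` pass `test`. -/
def squareCheck (a b : ℕ) (test : ℕ → ℤ → Bool) (w : ℕ) : Bool :=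
  force (a * w ^ 2 + b) fun t => force (newton t 64 (t + 1)) fun s =>
    Nat.ble (s * s) t && Nat.ble (t + 1) ((s + 1) * (s + 1)) &&
      (!Nat.beq (s * s) t || test s w && test s (-w))

/-- Multiplication by the solution `(X, Y)` or one of its neighbours sends a member of `L` to
`(v, w)`. -/
def inClass (a X Y : ℕ) (L : List (ℕ × ℤ)) (v : ℕ) (w : ℤ) : Bool :=
  L.any fun t => decide (t.1 = v ∧ t.2 = w) ||
    decide (t.1 * (X : ℤ) + a * (t.2 * Y) = v ∧ t.1 * (Y : ℤ) + t.2 * X = w) ||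
    decide (t.1 * (X : ℤ) - a * (t.2 * Y) = v ∧ t.2 * X - t.1 * (Y : ℤ) = w)

/-- All solutions of `v ^ 2 - a w ^ 2 = b` are equivalent to members of `L`; those with `|w| ≤ B`
are checked. -/
def classCheck (a b X Y B : ℕ) (L : List (ℕ × ℤ)) : Bool :=
  Nat.ble (b * (X - 1) + 1) (2 * a * (B + 1) ^ 2) &&
    allBelow (squareCheck a b (inClass a X Y L)) (B + 1)

theorem of_squareCheck {a b w s : ℕ} {test : ℕ → ℤ → Bool} (h : squareCheck a b test w = true)
    (hs : s ^ 2 = a * w ^ 2 + b) : test s w = true ∧ test s (-w) = true := by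
  simp only [squareCheck, force_eq, Bool.and_eq_true, Bool.or_eq_true, Bool.not_eq_true',
    ← Bool.not_eq_true, Nat.beq_eq, Nat.ble_eq, ← hs] at h
  obtain ⟨⟨h1, h2⟩, h3⟩ := h
  have : newton (s ^ 2) 64 (s ^ 2 + 1) = s := by
    rw [sq] at h1 h2 ⊢
    exact le_antisymm (Nat.mul_self_le_mul_self_iff.1 h1)
      (Nat.lt_succ_iff.1 (Nat.mul_self_lt_mul_self_iff.1 h2))
  rw [this] at h3
  exact h3.resolve_left fun h => h (sq s).symm

theorem exists_mem_of_inClass {a X Y : ℕ} {L : List (ℕ × ℤ)} {v : ℕ} {w : ℤ}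
    (h : inClass a X Y L v w = true) {E : Pell.Solution₁ (a : ℤ)} (hX : E.x = X) (hY : E.y = Y) :
    ∃ t ∈ L, ∃ k : ℤ, (v : ℤ) = t.1 * (E ^ k).x + a * (t.2 * (E ^ k).y) ∧
      w = t.1 * (E ^ k).y + t.2 * (E ^ k).x := by
  simp only [inClass, List.any_eq_true, Bool.or_eq_true, decide_eq_true_eq] at h
  obtain ⟨t, ht, (⟨h1, h2⟩ | ⟨h1, h2⟩) | ⟨h1, h2⟩⟩ := h
  · exact ⟨t, ht, 0, by simp [h1], by simp [h2]⟩
  · exact ⟨t, ht, 1, by simp [← h1, hX, hY], by simp [← h2, hX, hY]⟩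
  · refine ⟨t, ht, -1, ?_, ?_⟩ <;>
      simp only [zpow_neg_one, Pell.Solution₁.x_inv, Pell.Solution₁.y_inv, ← h1, ← h2, hX, hY] <;>
      ring

theorem exists_mem_of_classCheck {a b X Y B : ℕ} {L : List (ℕ × ℤ)}
    (h : classCheck a b X Y B L = true) (ha : 0 < a) (hb : 0 < b) {E : Pell.Solution₁ (a : ℤ)}
    (hx : 0 < E.x) (hy : 0 < E.y) (hX : E.x = X) (hY : E.y = Y) {v w : ℤ} (hv : 0 < v)
    (hvw : v ^ 2 - a * w ^ 2 = b) :
    ∃ t ∈ L, ∃ k : ℤ, w = t.1 * (E ^ k).y + t.2 * (E ^ k).x := by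
  simp only [classCheck, Bool.and_eq_true, Nat.ble_eq] at h
  obtain ⟨hB, h⟩ := h
  obtain ⟨k, v₁, w₁, h1, h2, h3, -, h5⟩ := Pell.Solution₁.exists_fundamental (by exact_mod_cast ha)
    hx hy (by exact_mod_cast hb) hv hvw
  lift v₁ to ℕ using h1.le
  have hwB : w₁.natAbs < B + 1 := by
    have hX1 : 1 ≤ X := by rw [hX] at hx; exact_mod_cast hx
    rw [hX] at h3
    zify [hX1] at hB
    have : |w₁| ^ 2 < ((B : ℤ) + 1) ^ 2 := by
      rw [sq_abs]
      refine lt_of_mul_lt_mul_left (a := 2 * (a : ℤ)) ?_ (by positivity)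
      linarith
    have := lt_of_pow_lt_pow_left₀ 2 (by positivity) this
    zify
    exact this
  have hsq : v₁ ^ 2 = a * w₁.natAbs ^ 2 + b := by
    zify
    rw [sq_abs]
    linarith
  have h6 := of_squareCheck (of_allBelow h hwB) hsq
  have h7 : inClass a X Y L v₁ w₁ = true := by
    rcases Int.natAbs_eq w₁ with h | h <;> rw [h]
    exacts [h6.1, h6.2]
  obtain ⟨t, ht, l, h8, h9⟩ := exists_mem_of_inClass h7 hX hY
  refine ⟨t, ht, l + k, ?_⟩
  rw [h5, h8, h9, zpow_add, Pell.Solution₁.y_mul, Pell.Solution₁.x_mul]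
  ring

/-! ### Sieving exponents -/

/-- The `i`-th bit of `m`. -/
def bitAt (m i : ℕ) : Bool :=
  Nat.beq ((m >>> i) % 2) 1

theorem bitAt_eq (m i : ℕ) : bitAt m i = m.testBit i := by
  rw [bitAt, Nat.testBit_eq_decide_div_mod_eq, Nat.shiftRight_eq_div_pow, Bool.eq_iff_iff,
    Nat.beq_eq, decide_eq_true_eq]

/-- Sets the bits of `m` at the squares modulo `p` of the numbers up to `n`. -/
def squareMask (p : ℕ) : ℕ → ℕ → ℕ
  | 0, m => m ||| 1
  | n + 1, m => force (m ||| 2 ^ ((n + 1) * (n + 1) % p)) (squareMask p n)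

theorem testBit_squareMask (p n m : ℕ) :
    (∀ j, m.testBit j = true → (squareMask p n m).testBit j = true) ∧
      ∀ i ≤ n, (squareMask p n m).testBit (i * i % p) = true := by
  induction n generalizing m with
  | zero =>
    simp only [squareMask, Nat.testBit_or]
    refine ⟨fun j hj => by simp [hj], fun i hi => ?_⟩
    obtain rfl : i = 0 := by omega
    simp
  | succ n ih =>
    simp only [squareMask, force_eq]
    refine ⟨fun j hj => (ih _).1 j (by simp [Nat.testBit_or, hj]), fun i hi => ?_⟩
    rcases Nat.le_succ_iff.1 hi with hi | rfl
    · exact (ih _).2 i hi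
    · exact (ih _).1 _ (by simp [Nat.testBit_or, Nat.testBit_two_pow_self])

theorem testBit_squareMask_of_sq {p : ℕ} (hp : 0 < p) {r : ℕ} {u : ℤ} (hr : r < p)
    (h : (u : ZMod p) ^ 2 = r) : (squareMask p (p / 2) 0).testBit r = true := by
  have : NeZero p := ⟨hp.ne'⟩
  have key : ∀ i : ℕ, (i : ZMod p) ^ 2 = r → i * i % p = r := fun i hi => by
    rw [← Nat.mod_eq_of_lt hr]
    exact (ZMod.natCast_eq_natCast_iff' _ _ _).1 (by push_cast; rw [← hi, sq])
  obtain ⟨i, hi, hip⟩ : ∃ i : ℕ, (i : ZMod p) ^ 2 = r ∧ i < p :=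
    ⟨(u : ZMod p).val, by rwa [ZMod.natCast_zmod_val], ZMod.val_lt _⟩
  rcases le_or_gt i (p / 2) with h2 | h2
  · rw [← key i hi]; exact (testBit_squareMask p _ 0).2 i h2
  · rw [← key (p - i) (by rw [Nat.cast_sub hip.le]; simpa using hi)]
    exact (testBit_squareMask p _ 0).2 _ (by omega)

/-- Computes the set of indices below `o` where the sequence with `w (i + 2) = c w (i + 1) - w i`
hits the set `sq`, checks that the sequence has period `o` and passes the result to `k`. -/
def seqMask (p c sq s₀ s₁ : ℕ) (k : ℕ → Bool) : ℕ → ℕ → ℕ → ℕ → ℕ → Bool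
  | 0, w, w', _, m => Nat.beq w s₀ && (Nat.beq w' s₁ && k m)
  | o + 1, w, w', b, m =>
    force ((c * w' + (p - w)) % p) fun w'' => force (2 * b) fun b' =>
      bif bitAt sq w then force (m ||| b) fun m' => seqMask p c sq s₀ s₁ k o w' w'' b' m'
      else seqMask p c sq s₀ s₁ k o w' w'' b' m

theorem exists_of_seqMask {p c sq s₀ s₁ : ℕ} {k : ℕ → Bool} {W : ℤ → ZMod p}
    (hW : ∀ i, W (i + 2) = c * W (i + 1) - W i) (h0 : W 0 = s₀) (h1 : W 1 = s₁) {o w w' m j : ℕ}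
    (h : seqMask p c sq s₀ s₁ k o w w' (2 ^ j) m = true) (hw : W j = w) (hw' : W (j + 1) = w')
    (hwp : w < p) (hwp' : w' < p)
    (hm : ∀ i < j, (∃ r < p, W i = r ∧ sq.testBit r = true) → m.testBit i = true) :
    ∃ m', k m' = true ∧ W (j + o) = W 0 ∧ W (j + o + 1) = W 1 ∧
      ∀ i < j + o, (∃ r < p, W i = r ∧ sq.testBit r = true) → m'.testBit i = true := by
  induction o generalizing w w' m j with
  | zero =>
    simp only [seqMask, Bool.and_eq_true, Nat.beq_eq] at h
    obtain ⟨rfl, rfl, h⟩ := h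
    exact ⟨m, h, by simp [hw, h0], by simp [hw', h1], hm⟩
  | succ o ih =>
    have hw'' : W ((j + 1 : ℕ) + 1) = ((c * w' + (p - w)) % p : ℕ) := by
      rw [ZMod.natCast_mod]
      push_cast [hwp.le]
      rw [add_assoc, show (1 : ℤ) + 1 = 2 by norm_num, hW, hw, hw']
      simp [sub_eq_add_neg]
    have hj : W (j + 1 : ℕ) = w' := by exact_mod_cast hw'
    have hlt := Nat.mod_lt (c * w' + (p - w)) (by omega : 0 < p)
    have hjo : ((j : ℤ) + (o + 1 : ℕ)) = (j + 1 : ℕ) + o := by push_cast; ring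
    have hjo' : j + (o + 1) = j + 1 + o := by ring
    simp only [seqMask, force_eq, ← pow_succ', bitAt_eq] at h
    rw [hjo, hjo']
    cases hb : sq.testBit w <;> simp only [hb, cond_true, cond_false] at h
    · refine ih h hj hw'' hwp' hlt fun i hi hr => ?_
      rcases Nat.lt_succ_iff_lt_or_eq.1 hi with hi | rfl
      · exact hm i hi hr
      · obtain ⟨r, hrp, hr, hr'⟩ := hr
        have : r = w := by
          rw [hw, ZMod.natCast_eq_natCast_iff', Nat.mod_eq_of_lt hwp, Nat.mod_eq_of_lt hrp] at hr
          exact hr.symm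
        simp [this, hb] at hr'
    · refine ih h hj hw'' hwp' hlt fun i hi hr => ?_
      rcases Nat.lt_succ_iff_lt_or_eq.1 hi with hi | rfl
      · simp [Nat.testBit_or, hm i hi hr]
      · simp [Nat.testBit_or, Nat.testBit_two_pow_self]

theorem periodic_of_recurrence {R : Type*} [CommRing R] {c : R} {W : ℤ → R}
    (hW : ∀ i, W (i + 2) = c * W (i + 1) - W i) {o : ℤ} (h0 : W o = W 0) (h1 : W (o + 1) = W 1) :
    Function.Periodic W o := by
  suffices ∀ k : ℤ, W (k + o) = W k ∧ W (k + 1 + o) = W (k + 1) from fun k => (this k).1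
  intro k
  induction k using Int.induction_on with
  | zero => simp [h0, add_comm 1 o, h1]
  | succ i ih =>
    refine ⟨ih.2, ?_⟩
    have h2 := hW (i + o)
    have h3 := hW i
    rw [show (i : ℤ) + o + 2 = i + 1 + 1 + o by ring, show (i : ℤ) + o + 1 = i + 1 + o by ring,
      ih.1, ih.2] at h2
    rw [h2, ← h3]; ring_nf
  | pred i ih =>
    rw [sub_add_cancel]
    refine ⟨?_, ih.1⟩
    have h2 := hW (-i - 1 + o)
    have h3 := hW (-i - 1)
    rw [show (-i - 1 + o + 2 : ℤ) = -i + 1 + o by ring, show (-i - 1 + o + 1 : ℤ) = -i + o by ring,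
      ih.1, ih.2] at h2
    rw [show (-i - 1 + 2 : ℤ) = -i + 1 by ring, show (-i - 1 + 1 : ℤ) = -i by ring] at h3
    linear_combination h2 - h3

/-- The numbers `s + M i` for `i < q`, followed by `L`. -/
def expandOne (M s : ℕ) : ℕ → List ℕ → List ℕ
  | 0, L => L
  | i + 1, L => force (s + M * i) fun t => expandOne M s i (t :: L)

/-- The numbers `s + M i` for `s` in a list and `i < q`, followed by `L`. -/
def expandAll (M q : ℕ) : List ℕ → List ℕ → List ℕ
  | [], L => L
  | s :: S, L => expandAll M q S (expandOne M s q L)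

/-- The members of a list with residue modulo `o` in the set `m`, followed by `L`. -/
def filterMask (o m : ℕ) : List ℕ → List ℕ → List ℕ
  | [], L => L
  | s :: S, L => bif bitAt m (s % o) then filterMask o m S (s :: L) else filterMask o m S L

/-- Sieves a list of residues modulo `M` by the primes and periods in the list `ps`; `mask` computes
the set of admissible residues. -/
def sieveBy (mask : ℕ → ℕ → (ℕ → Bool) → Bool) (M : ℕ) :
    List (ℕ × ℕ) → List ℕ → (List ℕ → Bool) → Bool
  | [], S, k => k S
  | (p, o) :: ps, S, k => Nat.beq (M % o) 0 &&
    mask p o fun m => sieveBy mask M ps (filterMask o m S []) k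

/-- Sieves residues modulo `M`, raising `M` in stages. -/
def sieve (mask : ℕ → ℕ → (ℕ → Bool) → Bool) (final : ℕ → List ℕ → Bool) :
    List (ℕ × List (ℕ × ℕ)) → ℕ → List ℕ → Bool
  | [], M, S => final M S
  | (q, ps) :: stages, M, S => Nat.ble 1 q && force (M * q) fun M' =>
    sieveBy mask M' ps (expandAll M q S []) fun S' => sieve mask final stages M' S'

theorem mem_expandOne {M s q t : ℕ} {L : List ℕ} :
    t ∈ expandOne M s q L ↔ t ∈ L ∨ ∃ i < q, t = s + M * i := by
  induction q generalizing L with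
  | zero => simp [expandOne]
  | succ q ih =>
    simp only [expandOne, force_eq, ih, List.mem_cons, Nat.lt_succ_iff_lt_or_eq]
    constructor
    · rintro ((rfl | h) | ⟨i, hi, rfl⟩)
      exacts [.inr ⟨q, .inr rfl, rfl⟩, .inl h, .inr ⟨i, .inl hi, rfl⟩]
    · rintro (h | ⟨i, hi | rfl, rfl⟩)
      exacts [.inl (.inr h), .inr ⟨i, hi, rfl⟩, .inl (.inl rfl)]

theorem mem_expandAll {M q t : ℕ} {S L : List ℕ} :
    t ∈ expandAll M q S L ↔ t ∈ L ∨ ∃ s ∈ S, ∃ i < q, t = s + M * i := by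
  induction S generalizing L with
  | nil => simp [expandAll]
  | cons s S ih => simp [expandAll, ih, mem_expandOne, or_assoc]

theorem mem_filterMask {o m t : ℕ} {S L : List ℕ} :
    t ∈ filterMask o m S L ↔ t ∈ L ∨ t ∈ S ∧ m.testBit (t % o) = true := by
  induction S generalizing L with
  | nil => simp [filterMask]
  | cons s S ih =>
    rw [filterMask, bitAt_eq]
    cases h : m.testBit (s % o) <;> simp only [cond_true, cond_false, ih, List.mem_cons]
    · constructor
      · rintro (h' | ⟨h1, h2⟩)
        exacts [.inl h', .inr ⟨.inr h1, h2⟩]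
      · rintro (h' | ⟨rfl | h1, h2⟩)
        exacts [.inl h', by simp [h] at h2, .inr ⟨h1, h2⟩]
    · constructor
      · rintro ((rfl | h') | ⟨h1, h2⟩)
        exacts [.inr ⟨.inl rfl, h⟩, .inl h', .inr ⟨.inr h1, h2⟩]
      · rintro (h' | ⟨rfl | h1, h2⟩)
        exacts [.inl (.inr h'), .inl (.inl rfl), .inr ⟨h1, h2⟩]

/-- `mask p o` produces a set of residues modulo `o` containing `κ`. -/
def IsMaskFor (κ : ℤ) (mask : ℕ → ℕ → (ℕ → Bool) → Bool) : Prop :=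
  ∀ p o k, mask p o k = true → ∃ m, k m = true ∧
    ∃ r : ℕ, r < o ∧ (o : ℤ) ∣ κ - r ∧ m.testBit r = true

section

variable {mask : ℕ → ℕ → (ℕ → Bool) → Bool} {κ : ℤ}

theorem exists_of_sieveBy (hmask : IsMaskFor κ mask) {M : ℕ} {ps : List (ℕ × ℕ)} {S : List ℕ}
    {k : List ℕ → Bool} (h : sieveBy mask M ps S k = true) (hS : ∃ s ∈ S, (M : ℤ) ∣ κ - s) :
    ∃ S', k S' = true ∧ ∃ s ∈ S', (M : ℤ) ∣ κ - s := by
  induction ps generalizing S with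
  | nil => exact ⟨S, h, hS⟩
  | cons t ps ih =>
    simp only [sieveBy, Bool.and_eq_true, Nat.beq_eq] at h
    obtain ⟨hM, h⟩ := h
    obtain ⟨m, hm, r, hro, hr, hbit⟩ := hmask _ _ _ h
    obtain ⟨s, hs, hsκ⟩ := hS
    refine ih hm ⟨s, mem_filterMask.2 (.inr ⟨hs, ?_⟩), hsκ⟩
    have h1 : (t.2 : ℤ) ∣ s - r := by
      have := (Int.natCast_dvd_natCast.2 (Nat.dvd_of_mod_eq_zero hM)).trans hsκ
      obtain ⟨i, hi⟩ := hr
      obtain ⟨j, hj⟩ := this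
      exact ⟨i - j, by linear_combination hi - hj⟩
    have h2 : s % t.2 = r := by
      have h3 := Int.emod_eq_emod_iff_emod_sub_eq_zero.2 (Int.emod_eq_zero_of_dvd h1)
      have h4 : s % t.2 = r % t.2 := by exact_mod_cast h3
      rwa [Nat.mod_eq_of_lt hro] at h4
    rwa [h2]

theorem exists_of_sieve (hmask : IsMaskFor κ mask) {final : ℕ → List ℕ → Bool}
    {stages : List (ℕ × List (ℕ × ℕ))} {M : ℕ} {S : List ℕ}
    (h : sieve mask final stages M S = true) (hS : ∃ s ∈ S, (M : ℤ) ∣ κ - s) :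
    ∃ M' S', final M' S' = true ∧ ∃ s ∈ S', (M' : ℤ) ∣ κ - s := by
  induction stages generalizing M S with
  | nil => exact ⟨M, S, h, hS⟩
  | cons t stages ih =>
    simp only [sieve, force_eq, Bool.and_eq_true, Nat.ble_eq] at h
    obtain ⟨hq, h⟩ := h
    obtain ⟨S', h', hS'⟩ := exists_of_sieveBy hmask h (by
      obtain ⟨s, hs, j, hj⟩ := hS
      have hq0 : (0 : ℤ) < t.1 := by exact_mod_cast hq
      obtain ⟨i, hi⟩ := Int.eq_ofNat_of_zero_le (Int.emod_nonneg j hq0.ne')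
      have hiq : i < t.1 := by have := Int.emod_lt_of_pos j hq0; omega
      refine ⟨s + M * i, mem_expandAll.2 (.inr ⟨s, hs, i, hiq, rfl⟩), j / t.1, ?_⟩
      have := Int.emod_add_mul_ediv j t.1
      rw [hi] at this
      push_cast
      linear_combination hj - M * this)
    exact ih h' hS'

end

/-- The set of exponents `i` for which the second coordinate of `(v, w)` times the `i`-th power of
`(X, Y)` is a square modulo `p`, computed modulo the period `o`. -/
def pellMask (X Y v : ℕ) (w : ℤ) (p o : ℕ) (k : ℕ → Bool) : Bool :=
  Nat.ble 1 p && (Nat.ble 1 o && force (w % p).toNat fun s₀ =>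
    force ((v * Y + s₀ * X) % p) fun s₁ => force (2 * X % p) fun c =>
    force (squareMask p (p / 2) 0) fun sq => seqMask p c sq s₀ s₁ k o s₀ s₁ 1 0)

theorem exists_of_pellMask {a X Y v : ℕ} {w : ℤ} {p o : ℕ} {k : ℕ → Bool}
    (h : pellMask X Y v w p o k = true) {E : Pell.Solution₁ (a : ℤ)} (hX : E.x = X) (hY : E.y = Y)
    {κ u : ℤ} (hκ : v * (E ^ κ).y + w * (E ^ κ).x = u ^ 2) :
    ∃ m, k m = true ∧ ∃ r : ℕ, r < o ∧ (o : ℤ) ∣ κ - r ∧ m.testBit r = true := by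
  simp only [pellMask, force_eq, Bool.and_eq_true, Nat.ble_eq] at h
  obtain ⟨hp, ho, h⟩ := h
  set W : ℤ → ZMod p := fun i => ((v * (E ^ i).y + w * (E ^ i).x : ℤ) : ZMod p) with hWdef
  have hs₀ : (((w % p).toNat : ℕ) : ZMod p) = w := by
    have h1 : (((w % p).toNat : ℤ)) = w % p := Int.toNat_of_nonneg (Int.emod_nonneg _ (by omega))
    rw [← Int.cast_natCast, h1, ZMod.intCast_mod]
  have hlt : (w % p).toNat < p := by
    have := Int.emod_lt_of_pos w (by omega : (0 : ℤ) < p)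
    omega
  have hW : ∀ i, W (i + 2) = ((2 * X % p : ℕ) : ZMod p) * W (i + 1) - W i := by
    intro i
    have hprop := E.prop
    rw [ZMod.natCast_mod]
    simp only [hWdef]
    have hc : ((2 * X : ℕ) : ZMod p) = ((2 * X : ℤ) : ZMod p) := by push_cast; rfl
    rw [show i + 2 = i + 1 + 1 by ring, zpow_add_one, zpow_add_one, hc, ← Int.cast_mul,
      ← Int.cast_sub]
    congr 1
    simp only [Pell.Solution₁.x_mul, Pell.Solution₁.y_mul, ← hX]
    linear_combination (-v * (E ^ i).y - w * (E ^ i).x) * hprop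
  have h0 : W 0 = ((w % p).toNat : ℕ) := by simp [hWdef, hs₀]
  have h1 : W 1 = ((v * Y + (w % p).toNat * X) % p : ℕ) := by
    rw [ZMod.natCast_mod]
    push_cast
    rw [hs₀]
    simp [hWdef, hX, hY]
  obtain ⟨m, hm, h2, h3, h4⟩ := exists_of_seqMask hW h0 h1 (j := 0) h (by simpa using h0)
    (by simpa using h1) hlt (Nat.mod_lt _ (by omega)) (by simp)
  simp only [Nat.cast_zero, zero_add] at h2 h3 h4
  have hper := periodic_of_recurrence hW h2 h3
  have ho' : (0 : ℤ) < o := by exact_mod_cast ho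
  obtain ⟨r, hr⟩ := Int.eq_ofNat_of_zero_le (Int.emod_nonneg κ ho'.ne')
  have hro : r < o := by have := Int.emod_lt_of_pos κ ho'; omega
  refine ⟨m, hm, r, hro, hr ▸ Int.dvd_self_sub_emod, h4 r hro ?_⟩
  have : NeZero p := ⟨by omega⟩
  have hWr : W r = (u : ZMod p) ^ 2 := by
    have h5 := hper.sub_zsmul_eq (κ / o) (x := κ)
    rw [smul_eq_mul, mul_comm, ← Int.emod_def, hr] at h5
    change W (r : ℤ) = W κ at h5
    rw [h5]
    simp only [hWdef, hκ]
    push_cast; ring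
  refine ⟨(W r).val, ZMod.val_lt _, by simp,
    testBit_squareMask_of_sq hp (ZMod.val_lt _) (u := u) ?_⟩
  rw [← hWr]; simp

/-! ### The quartic equations `v ^ 2 = a u ^ 4 + b` -/

/-- An exponent, negative if `neg` holds and of absolute value `m`, leading from the base point of a
class to the point `(V, u ^ 2)`, which is isolated. -/
structure ClassPoint where
  neg : Bool
  m : ℕ
  V : ℕ
  u : ℕ
  cert : IsoCert

namespace ClassPoint

/-- The exponent of the point. -/
def exponent (e : ClassPoint) : ℤ :=
  bif e.neg then -e.m else e.m

/-- Validity of the data of a point. -/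
def check (a X Y v : ℕ) (w : ℤ) (good : ℕ → Bool) (e : ClassPoint) : Bool :=
  e.cert.check a X Y e.u e.V && good e.u &&
  match mulPowMod 0 a (X, Y) e.m (1, 0) with
  | (x, y) => bif e.neg
    then decide ((e.V : ℤ) = v * x - a * (w * y)) && decide ((e.u : ℤ) ^ 2 = w * x - v * y)
    else decide ((e.V : ℤ) = v * x + a * (w * y)) && decide ((e.u : ℤ) ^ 2 = w * x + v * y)

/-- The residue `s` modulo `M` reduces to the exponent of the point modulo the modulus of its
certificate. -/
def covers (M s : ℕ) (e : ClassPoint) : Bool :=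
  force e.cert.modulus fun n => Nat.beq (M % n) 0 &&
    bif e.neg then Nat.beq ((s + e.m) % n) 0 else Nat.beq (s % n) (e.m % n)

variable {a X Y v : ℕ} {w : ℤ} {good : ℕ → Bool} {e : ClassPoint} {E : Pell.Solution₁ (a : ℤ)}

theorem dvd_of_covers {M s : ℕ} {k : ℤ} (h : e.covers M s = true) (hk : (M : ℤ) ∣ k - s) :
    (e.cert.modulus : ℤ) ∣ k - e.exponent := by
  simp only [covers, force_eq, Bool.and_eq_true, Nat.beq_eq] at h
  obtain ⟨h1, h2⟩ := h
  have h3 := (Int.natCast_dvd_natCast.2 (Nat.dvd_of_mod_eq_zero h1)).trans hk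
  have h4 : (e.cert.modulus : ℤ) ∣ s - e.exponent := by
    cases hn : e.neg <;> simp only [hn, cond_true, cond_false, Nat.beq_eq] at h2
    · simpa [exponent, hn] using
        Nat.modEq_iff_dvd.1 (show e.m ≡ s [MOD e.cert.modulus] from h2.symm)
    · simpa [exponent, hn] using Int.natCast_dvd_natCast.2 (Nat.dvd_of_mod_eq_zero h2)
  simpa using dvd_add h3 h4

theorem good_of_check (h : e.check a X Y v w good = true) (ha : 0 < a) (hx : 0 < E.x)
    (hy : 0 < E.y) (hX : E.x = X) (hY : E.y = Y) {k : ℤ}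
    (hk : (e.cert.modulus : ℤ) ∣ k - e.exponent) {u : ℤ}
    (hu : v * (E ^ k).y + w * (E ^ k).x = u ^ 2) : good u.natAbs = true := by
  simp only [check, Bool.and_eq_true] at h
  obtain ⟨⟨h1, h2⟩, h3⟩ := h
  have hE := Reduces.sol_pow (q := 0) (E := E) (s := (X, Y)) (by rw [hX, hY]; simp [Reduces]) e.m
  obtain ⟨hE1, hE2⟩ := dvd_sub_of_reduces hE
  rw [Nat.cast_zero, zero_dvd_iff, sub_eq_zero] at hE1 hE2
  have hpt : (e.V : ℤ) = v * (E ^ e.exponent).x + a * (w * (E ^ e.exponent).y) ∧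
      (e.u : ℤ) ^ 2 = w * (E ^ e.exponent).x + v * (E ^ e.exponent).y := by
    cases hn : e.neg <;>
      simp only [hn, cond_true, cond_false, Bool.and_eq_true, decide_eq_true_eq, ← hE1, ← hE2] at h3
    · simpa [exponent, hn] using h3
    · simp only [exponent, hn, cond_true, zpow_neg, zpow_natCast, Pell.Solution₁.x_inv,
        Pell.Solution₁.y_inv]
      exact ⟨by linear_combination h3.1, by linear_combination h3.2⟩
  have key := IsoCert.isIsolated h1 ha hx hy hX hY _ hk u (by
    rw [← hu, show k = e.exponent + (k - e.exponent) by ring, zpow_add, Pell.Solution₁.x_mul,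
      Pell.Solution₁.y_mul, add_sub_cancel_left, hpt.1]
    push_cast
    rw [hpt.2]
    ring)
  rw [sub_eq_zero] at key
  rw [key] at hu
  have h5 : u ^ 2 = (e.u : ℤ) ^ 2 := by rw [hpt.2, ← hu]; ring
  have h6 : u.natAbs = e.u := by rw [Int.natAbs_eq_iff]; exact sq_eq_sq_iff_eq_or_eq_neg.1 h5
  rwa [h6]

end ClassPoint

/-- A class `(v, w)` of solutions of a Pell equation, the points in it whose second coordinate is a
square, and the sieve excluding all others. -/
structure ClassCert where
  v : ℕ
  w : ℤ
  points : List ClassPoint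
  stages : List (ℕ × List (ℕ × ℕ))

/-- Data for solving `v ^ 2 = a u ^ 4 + b`: a solution `(X, Y)` of the Pell equation of `a` and
representatives of all classes of solutions of `v ^ 2 = a w ^ 2 + b`, as found by searching up to
`B`. -/
structure QuarticCert where
  X : ℕ
  Y : ℕ
  B : ℕ
  classes : List ClassCert

/-- Validity of the data of a class. -/
def ClassCert.check (a X Y : ℕ) (good : ℕ → Bool) (C : ClassCert) : Bool :=
  C.points.all (ClassPoint.check a X Y C.v C.w good) &&
    sieve (pellMask X Y C.v C.w) (fun M S => S.all fun s => C.points.any (ClassPoint.covers M s))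
      C.stages 1 [0]

/-- Validity of a certificate for the equation `v ^ 2 = a u ^ 4 + b`. -/
def QuarticCert.check (a b : ℕ) (good : ℕ → Bool) (Q : QuarticCert) : Bool :=
  Nat.ble 1 a && Nat.ble 1 b && Nat.ble 1 Q.X && Nat.ble 1 Q.Y &&
  Nat.beq (Q.X ^ 2) (1 + a * Q.Y ^ 2) &&
  classCheck a b Q.X Q.Y Q.B (Q.classes.map fun C => (C.v, C.w)) &&
    Q.classes.all (ClassCert.check a Q.X Q.Y good)

theorem good_of_quarticCert {a b : ℕ} {good : ℕ → Bool} {Q : QuarticCert}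
    (h : Q.check a b good = true) {u v : ℤ} (huv : v ^ 2 = a * u ^ 4 + b) :
    good u.natAbs = true := by
  simp only [QuarticCert.check, Bool.and_eq_true, Nat.ble_eq, Nat.beq_eq, List.all_eq_true] at h
  obtain ⟨⟨⟨⟨⟨⟨ha, hb⟩, hX1⟩, hY1⟩, hprop⟩, hcl⟩, hpts⟩ := h
  let E : Pell.Solution₁ (a : ℤ) := .mk Q.X Q.Y (by zify at hprop; linear_combination hprop)
  have hX : E.x = Q.X := Pell.Solution₁.x_mk _ _ _
  have hY : E.y = Q.Y := Pell.Solution₁.y_mk _ _ _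
  have hx : 0 < E.x := by rw [hX]; exact_mod_cast hX1
  have hy : 0 < E.y := by rw [hY]; exact_mod_cast hY1
  have hv : 0 < |v| := by
    rw [abs_pos]
    rintro rfl
    have : (0 : ℤ) < a * u ^ 4 + b := by positivity
    omega
  obtain ⟨t, ht, κ, hκ⟩ := exists_mem_of_classCheck hcl ha hb hx hy hX hY hv (w := u ^ 2)
    (by rw [sq_abs, huv]; ring)
  obtain ⟨C, hC, rfl⟩ := List.mem_map.1 ht
  have hCC := hpts C hC
  simp only [ClassCert.check, Bool.and_eq_true, List.all_eq_true] at hCC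
  obtain ⟨M, S, hfin, s, hs, hsκ⟩ := exists_of_sieve (κ := κ)
    (fun p o k h => exists_of_pellMask h hX hY hκ.symm) hCC.2 ⟨0, by simp, by simp⟩
  obtain ⟨e, he, hes⟩ := List.any_eq_true.1 (List.all_eq_true.1 hfin s hs)
  exact ClassPoint.good_of_check (hCC.1 e he) ha hx hy hX hY (ClassPoint.dvd_of_covers hes hsκ)
    hκ.symm

/-! ### Local obstructions -/

/-- Passes `n` together with its set of square residues to `k`, for all `n` in a list. -/
def withSquares (k : List (ℕ × ℕ) → Bool) : List ℕ → List (ℕ × ℕ) → Bool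
  | [], L => k L
  | n :: ns, L => force (squareMask n (n / 2) 0) fun m => withSquares k ns ((n, m) :: L)

theorem of_withSquares {k : List (ℕ × ℕ) → Bool} {ns : List ℕ} {L : List (ℕ × ℕ)}
    (h : withSquares k ns L = true) :
    ∃ L', k L' = true ∧ ∀ t ∈ L', t ∈ L ∨ t.1 ∈ ns ∧ t.2 = squareMask t.1 (t.1 / 2) 0 := by
  induction ns generalizing L with
  | nil => exact ⟨L, h, fun t ht => .inl ht⟩
  | cons n ns ih =>
    simp only [withSquares, force_eq] at h
    obtain ⟨L', h1, h2⟩ := ih h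
    refine ⟨L', h1, fun t ht => ?_⟩
    rcases h2 t ht with h3 | h3
    · rcases List.mem_cons.1 h3 with rfl | h3
      · exact .inr ⟨by simp, rfl⟩
      · exact .inl h3
    · exact .inr ⟨List.mem_cons_of_mem _ h3.1, h3.2⟩

/-- No value of `a u ^ 4 + b` lies in the set `m` modulo `n`. -/
def obstructs (a b : ℕ) (t : ℕ × ℕ) : Bool :=
  Nat.ble 1 t.1 && allBelow (fun u => !bitAt t.2 ((a * u ^ 4 + b) % t.1)) t.1

theorem false_of_obstructs {a b : ℕ} {t : ℕ × ℕ} (h : obstructs a b t = true)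
    (ht : t.2 = squareMask t.1 (t.1 / 2) 0) {u v : ℤ} (huv : v ^ 2 = a * u ^ 4 + b) : False := by
  simp only [obstructs, Bool.and_eq_true, Nat.ble_eq] at h
  have hpos : (0 : ℤ) < t.1 := by exact_mod_cast h.1
  obtain ⟨r, hr⟩ := Int.eq_ofNat_of_zero_le (Int.emod_nonneg u hpos.ne')
  have hrt : r < t.1 := by have := Int.emod_lt_of_pos u hpos; omega
  have h1 := of_allBelow h.2 hrt
  have hru : (r : ZMod t.1) = u := by
    rw [← ZMod.intCast_mod u, hr]; simp
  rw [bitAt_eq, ht, testBit_squareMask_of_sq h.1 (Nat.mod_lt _ h.1) (u := v)] at h1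
  · simp at h1
  · rw [ZMod.natCast_mod]
    push_cast
    rw [hru]
    exact_mod_cast congrArg (Int.cast : ℤ → ZMod t.1) huv

/-! ### Assembly -/

/-- Solutions of `v ^ 2 = u ^ 4 + b` satisfy `good u`, as `u` is bounded. -/
def unitCase (b : ℕ) (good : ℕ → Bool) : Bool :=
  Nat.ble b 8000 && (Nat.ble 1 b &&
    allBelow (fun u => squareCheck 1 b (fun _ _ => good u) (u ^ 2)) 64)

theorem good_of_unitCase {b : ℕ} {good : ℕ → Bool} (h : unitCase b good = true) {u v : ℤ}
    (huv : v ^ 2 = u ^ 4 + b) : good u.natAbs = true := by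
  simp only [unitCase, Bool.and_eq_true, Nat.ble_eq] at h
  obtain ⟨hb, hb1, h⟩ := h
  have h1 : u ^ 2 + 1 ≤ |v| := by
    by_contra! h2
    have : |v| ^ 2 ≤ (u ^ 2) ^ 2 := pow_le_pow_left₀ (abs_nonneg v) (by omega) 2
    rw [sq_abs] at this
    have : (1 : ℤ) ≤ b := by exact_mod_cast hb1
    linarith [huv, show (u ^ 2) ^ 2 = u ^ 4 by ring]
  have h2 : (u ^ 2 + 1) ^ 2 ≤ v ^ 2 := by
    rw [← sq_abs v]; exact pow_le_pow_left₀ (by positivity) h1 2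
  have h3 : u.natAbs < 64 := by
    have : (b : ℤ) ≤ 8000 := by exact_mod_cast hb
    zify
    refine abs_lt_of_sq_lt_sq ?_ (by norm_num)
    nlinarith
  refine (of_squareCheck (of_allBelow h h3) (s := v.natAbs) ?_).1
  zify
  rw [sq_abs, sq_abs, huv]
  ring

/-- All solutions of `v ^ 2 = a u ^ 4 + b` satisfy `good u`, by one of the available methods. -/
def quarticCheck (a b : ℕ) (good : ℕ → Bool) (Q : Option QuarticCert) (L : List (ℕ × ℕ)) : Bool :=
  match Q with
  | some Q => Q.check a b good
  | none => L.any (obstructs a b) || Nat.beq a 1 && unitCase b good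

theorem good_of_quarticCheck {a b : ℕ} {good : ℕ → Bool} {Q : Option QuarticCert} {L : List (ℕ × ℕ)}
    (h : quarticCheck a b good Q L = true) (hL : ∀ t ∈ L, t.2 = squareMask t.1 (t.1 / 2) 0)
    {u v : ℤ} (huv : v ^ 2 = a * u ^ 4 + b) : good u.natAbs = true := by
  cases Q with
  | some Q => exact good_of_quarticCert h huv
  | none =>
    simp only [quarticCheck, Bool.or_eq_true, List.any_eq_true, Bool.and_eq_true, Nat.beq_eq] at h
    rcases h with ⟨t, ht, h⟩ | ⟨rfl, h⟩
    · exact (false_of_obstructs h (hL t ht) huv).elim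
    · exact good_of_unitCase h (by simpa using huv)

/-- The certificate with key `a` in a list. -/
def certOf (a : ℕ) : List (ℕ × QuarticCert) → Option QuarticCert
  | [] => none
  | t :: ts => bif Nat.beq t.1 a then some t.2 else certOf a ts

/-- `a u ^ 2` is zero or the mean of the consecutive integers in a solution for `d` from the
list. -/
def isListed (d a u : ℕ) : Bool :=
  Nat.beq u 0 || squareSolList.any fun t =>
    Nat.beq t.1 d && decide (t.2.1 + (d + 1 : ℕ) = (a * u ^ 2 : ℕ))

/-- For each squarefree divisor `a` of `N = 3 d (d + 1)`, the solutions of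
`v ^ 2 = a u ^ 4 + N / a` are listed. -/
def sumCheck (d : ℕ) (Qs : List (ℕ × QuarticCert)) : Bool :=
  force (3 * d * (d + 1)) fun N =>
    withSquares (fun L => allBelow (fun a => !Nat.beq (N % a) 0 || Nat.beq a 0 ||
        [4, 9, 25, 49].any (fun k => Nat.beq (a % k) 0) ||
        quarticCheck a (N / a) (isListed d a) (certOf a Qs) L) (N + 1))
      [31, 121, 361, 49, 125, 81, 64] []

theorem altCubeSum_eq (d : ℕ) (x : ℤ) :
    altCubeSum d x = (x + d + 1) * ((x + d + 1) ^ 2 + 3 * d * (d + 1)) := by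
  induction d with
  | zero => simp [altCubeSum]; ring
  | succ d ih =>
    simp only [altCubeSum] at ih ⊢
    rw [show 2 * (d + 1) + 1 = 2 * d + 1 + 1 + 1 by ring, Finset.sum_range_succ,
      Finset.sum_range_succ, ih, pow_succ (-1 : ℤ) (2 * d + 1), Odd.neg_one_pow ⟨d, rfl⟩]
    push_cast
    ring

theorem altCubeSum_eq_of_mem : ∀ t ∈ squareSolList, altCubeSum t.1 t.2.1 = t.2.2 ^ 2 := by
  simp only [altCubeSum_eq]
  decide

theorem exists_of_altCubeSum_eq {d : ℕ} {x z : ℤ} (h : altCubeSum d x = z ^ 2) (hx : x ≠ -(d + 1)) :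
    ∃ a u : ℕ, ∃ v : ℤ, 0 < u ∧ Squarefree a ∧ a ∣ 3 * d * (d + 1) ∧
      x + (d + 1 : ℕ) = (a * u ^ 2 : ℕ) ∧ v ^ 2 = a * (u : ℤ) ^ 4 + (3 * d * (d + 1) / a : ℕ) := by
  rw [altCubeSum_eq] at h
  have hy : 0 < x + d + 1 := by
    by_contra! hneg
    have h1 : x + d + 1 < 0 := lt_of_le_of_ne hneg (by omega)
    have h2 : 0 < (x + d + 1) ^ 2 := sq_pos_of_neg h1
    have h3 : (0 : ℤ) ≤ 3 * d * (d + 1) := by positivity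
    nlinarith [sq_nonneg z]
  obtain ⟨y, hy'⟩ := Int.eq_ofNat_of_zero_le hy.le
  rw [hy'] at h hy
  have hz : z.natAbs ^ 2 = y * (y ^ 2 + 3 * d * (d + 1)) := by
    zify; rw [sq_abs, ← h]
  obtain ⟨a, u, ha, hu, rfl, hsq⟩ := Nat.sq_mul_squarefree_of_pos (by exact_mod_cast hy)
  obtain ⟨t, ht⟩ := (Nat.pow_dvd_pow_iff two_ne_zero).1 (⟨_, hz.trans (mul_assoc _ _ _)⟩ :
    u ^ 2 ∣ z.natAbs ^ 2)
  have ht2 : t ^ 2 = a * ((u ^ 2 * a) ^ 2 + 3 * d * (d + 1)) := by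
    rw [ht, mul_pow, mul_assoc] at hz
    exact Nat.eq_of_mul_eq_mul_left (by positivity) hz
  obtain ⟨v, rfl⟩ := (hsq.dvd_pow_iff_dvd two_ne_zero).1 ⟨_, ht2⟩
  have hv : a * v ^ 2 = (u ^ 2 * a) ^ 2 + 3 * d * (d + 1) := by
    rw [mul_pow, sq a, mul_assoc] at ht2
    exact Nat.eq_of_mul_eq_mul_left ha ht2
  have hdvd : a ∣ 3 * d * (d + 1) :=
    (Nat.dvd_add_right (Dvd.intro_left (u ^ 2 * a * u ^ 2) (by ring))).1 ⟨_, hv.symm⟩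
  refine ⟨a, u, v, hu, hsq, hdvd, by push_cast at hy' ⊢; linarith, ?_⟩
  obtain ⟨b, hb⟩ := hdvd
  rw [hb] at hv ⊢
  rw [Nat.mul_div_cancel_left _ ha]
  have : v ^ 2 = a * u ^ 4 + b := Nat.eq_of_mul_eq_mul_left ha (by rw [hv]; ring)
  exact_mod_cast this

theorem eq_or_exists_of_sumCheck {d : ℕ} (hd : 1 ≤ d) {Qs : List (ℕ × QuarticCert)}
    (hc : sumCheck d Qs = true) {x z : ℤ} (h : altCubeSum d x = z ^ 2) :
    (x = -((d : ℤ) + 1) ∧ z = 0) ∨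
      ∃ t ∈ squareSolList, d = t.1 ∧ x = t.2.1 ∧ (z = t.2.2 ∨ z = -t.2.2) := by
  by_cases hx : x = -((d : ℤ) + 1)
  · refine .inl ⟨hx, ?_⟩
    rw [altCubeSum_eq, hx, show -((d : ℤ) + 1) + d + 1 = 0 by ring, zero_mul] at h
    exact pow_eq_zero_iff two_ne_zero |>.1 h.symm
  right
  obtain ⟨a, u, v, hu, hsq, hdvd, hxa, hv⟩ := exists_of_altCubeSum_eq h hx
  simp only [sumCheck, force_eq] at hc
  obtain ⟨L, hL, hsquares⟩ := of_withSquares hc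
  have hN : 0 < 3 * d * (d + 1) := by positivity
  have hc := of_allBelow hL (Nat.lt_succ_of_le (Nat.le_of_dvd hN hdvd))
  have hsq' : [4, 9, 25, 49].any (fun k => Nat.beq (a % k) 0) = false := by
    rw [List.any_eq_false]
    intro k hk h
    obtain ⟨p, rfl, hp⟩ : ∃ p, k = p * p ∧ ¬ IsUnit p := by
      simp only [List.mem_cons, List.not_mem_nil, or_false] at hk
      rcases hk with rfl | rfl | rfl | rfl
      exacts [⟨2, by simp⟩, ⟨3, by simp⟩, ⟨5, by simp⟩, ⟨7, by simp⟩]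
    exact hp (hsq p (Nat.dvd_of_mod_eq_zero (Nat.beq_eq.mp h)))
  have ha0 : a ≠ 0 := hsq.ne_zero
  simp only [Nat.mod_eq_zero_of_dvd hdvd, hsq', Bool.or_eq_true, Bool.not_eq_true', Nat.beq_eq, ha0,
    Nat.beq_refl, Bool.true_eq_false, Bool.false_eq_true, false_or] at hc
  have hgood := good_of_quarticCheck hc
    (fun t ht => ((hsquares t ht).resolve_left (by simp)).2) hv
  simp only [isListed, Int.natAbs_natCast, Bool.or_eq_true, Nat.beq_eq, hu.ne', false_or,
    List.any_eq_true, Bool.and_eq_true, decide_eq_true_eq, ← hxa] at hgood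
  obtain ⟨t, ht, rfl, hxt⟩ := hgood
  have hxt : t.2.1 = x := by omega
  refine ⟨t, ht, rfl, hxt.symm, sq_eq_sq_iff_eq_or_eq_neg.1 ?_⟩
  rw [← h, ← hxt, altCubeSum_eq_of_mem t ht]

/-- `sumCheck` holds for `d, d + 1, …` with the members of a list. -/
def sumCheckFrom (d : ℕ) : List (List (ℕ × QuarticCert)) → Bool
  | [] => true
  | Qs :: l => sumCheck d Qs && sumCheckFrom (d + 1) l

theorem exists_of_sumCheckFrom {d₀ d : ℕ} {l : List (List (ℕ × QuarticCert))}
    (h : sumCheckFrom d₀ l = true) (hd : d₀ ≤ d) (hd' : d < d₀ + l.length) :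
    ∃ Qs, sumCheck d Qs = true := by
  induction l generalizing d₀ with
  | nil => simp at hd'; omega
  | cons Qs l ih =>
    simp only [sumCheckFrom, Bool.and_eq_true] at h
    rcases hd.eq_or_lt with rfl | hlt
    · exact ⟨Qs, h.1⟩
    · exact ih h.2 hlt (by simp only [List.length_cons] at hd'; omega)

/-- The equations `v ^ 2 = a u ^ 4 + 3 d (d + 1) / a` with `1 < a` squarefree and without local
obstruction, listed by `a` for `d = 1, 2, …, 50` in turn. -/
def quarticCerts : List (List (ℕ × QuarticCert)) :=
  [[(6, ⟨5, 2, 0, [⟨1, 0, [⟨false, 0, 1, 0, .trivial⟩], [(2, []), (2, [(5, 4)]), (2, [(7, 8)]), (2,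
     []), (2, [(31, 32)]), (7, [(13, 7), (29, 28), (673, 56), (223, 224)])]⟩]⟩)],
   [(2, ⟨3, 2, 2, [⟨3, 0, [⟨false, 0, 3, 0, .trivial⟩, ⟨false, 2, 51, 6,
     (.unit 2 3 288 17 1 1 288 1 17 17 8 4 (1153, 68) (576, 34))⟩], [(2, []), (2, []), (2, [(17,
     8)]), (2, []), (2, []), (3, [(7, 3), (97, 48), (193, 96)]), (7, [(239, 7), (83, 84), (449,
     224)])]⟩]⟩), (3, ⟨2, 1, 1, [⟨3, 1, [⟨false, 0, 3, 1, (.unit 1 1 3 2 1 3 1 2 1 5 13 6 (3, 2) (1,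
     1))⟩], [(2, [(3, 2)]), (2, []), (2, []), (2, [(97, 16)]), (3, [(13, 12)])]⟩]⟩), (6, ⟨5, 2, 1,
     [⟨3, 1, [⟨false, 0, 3, 1, (.unit 1 1 6 5 2 3 2 1 1 5 12 4 (9, 4) (4, 2))⟩], [(2, [(3, 2)]), (2,
     []), (2, [(7, 8)]), (7, [(673, 56)])]⟩]⟩)],
   [],
   [(6, ⟨5, 2, 1, [⟨4, 1, [⟨false, 0, 4, 1, (.symbolAdd 1 1 6 5 2 4 false 1 11 1 [1])⟩], [(2, []),
     (2, [(5, 4)]), (2, [(7, 8)]), (7, [(83, 7), (673, 56)])]⟩, ⟨4, -1, [], [(2, []), (3, [(11,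
     3)]), (3, [(971, 9), (17, 18)])]⟩]⟩), (10, ⟨19, 6, 2, [⟨4, 1, [⟨false, 0, 4, 1,
     (.unit 1 1 10 19 6 2 5 3 2 3 3 3 (23071, 7296) (10840, 3428))⟩], [(2, []), (2, [(19, 4)]), (3,
     [(37, 6), (11, 12)])]⟩, ⟨4, -1, [], [(2, [(3, 1)])]⟩]⟩), (15, ⟨4, 1, 0, [⟨2, 0, [⟨false, 0, 2,
     0, .trivial⟩, ⟨false, 2, 62, 4, (.unit 2 2 960 31 1 1 960 1 31 17 9 8 (3841, 124) (1920,
     62))⟩], [(2, []), (2, []), (2, [(31, 8)]), (2, [(17, 16)]), (2, []), (3, [(3, 3), (23, 24),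
     (47, 48)]), (7, [(13, 7), (2239, 224)])]⟩]⟩)],
   [(10, ⟨19, 6, 2, [⟨3, 0, [⟨false, 0, 3, 0, .trivial⟩], [(2, []), (2, [(19, 4)]), (2, [(7, 8),
     (103, 8)]), (2, []), (2, []), (3, [(13, 3), (23, 24), (1823, 96)]), (7, [(43, 21), (449, 28),
     (167, 56), (223, 224)])]⟩, ⟨7, 2, [], [(2, [(3, 1)])]⟩, ⟨7, -2, [⟨false, 1, 13, 2,
     (.symbol 0 13 1 [1])⟩], [(2, []), (2, [(19, 4)]), (2, [(7, 8)]), (3, [(13, 3), (11,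
     12)])]⟩]⟩)],
   [(2, ⟨3, 2, 5, [⟨9, 3, [], [(3, [(7, 3)])]⟩, ⟨9, -3, [⟨false, 1, 15, 3, (.symbol 0 15 1 [1])⟩],
     [(2, []), (2, []), (2, [(17, 8)]), (2, [(577, 16)])]⟩]⟩), (7, ⟨8, 3, 3, [⟨5, 1, [⟨false, 0, 5,
     1, (.symbol 0 5 1 [1])⟩], [(2, [(3, 2)]), (2, []), (2, [(127, 8)]), (3, [(17, 3), (11, 12)])]⟩,
     ⟨5, -1, [], [(2, [(3, 2)]), (7, [(7, 7), (13, 14), (293, 14)])]⟩, ⟨9, 3, [], [(2, []), (2, []),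
     (7, [(293, 14), (197, 28)])]⟩]⟩), (14, ⟨15, 4, 2, [⟨3, 0, [⟨false, 0, 3, 0, .trivial⟩], [(2,
     []), (2, [(5, 4)]), (2, []), (2, [(191, 16)]), (5, [(11, 10), (79, 10), (1439, 80)])]⟩]⟩)],
   [(42, ⟨13, 2, 0, [⟨2, 0, [⟨false, 0, 2, 0, .trivial⟩, ⟨false, 1, 26, 2,
     (.unit 1 2 168 13 1 1 168 1 13 17 8 16 (673, 52) (336, 26))⟩], [(2, []), (2, []), (2, []), (2,
     [(17, 16), (31, 16)]), (2, [(1279, 32)]), (3, [(23, 24), (193, 96)]), (5, [(11, 10), (41, 40),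
     (239, 240)])]⟩]⟩)],
   [(6, ⟨5, 2, 3, [⟨6, 0, [⟨false, 0, 6, 0, .trivial⟩], [(2, []), (2, [(5, 4)]), (2, [(7, 8)]), (2,
     []), (2, [(31, 32)]), (7, [(881, 14), (673, 56), (223, 224)])]⟩]⟩)],
   [(30, ⟨11, 2, 1, [⟨3, 0, [⟨false, 0, 3, 0, .trivial⟩], [(2, []), (2, [(11, 4)]), (2, [(241, 8)]),
     (2, [(17, 16)]), (3, [(23, 3), (47, 24)])]⟩]⟩)],
   [(330, ⟨109, 6, 0, [⟨1, 0, [⟨false, 0, 1, 0, .trivial⟩], [(2, []), (2, [(109, 4)]), (2, []), (2,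
     [(113, 16)])]⟩]⟩)],
   [(3, ⟨2, 1, 4, [⟨12, 2, [⟨false, 1, 30, 4, (.symbol 1 15 1 [1])⟩], [(2, [(3, 2)]), (2, []), (2,
     [(7, 8)]), (2, [(97, 16)])]⟩, ⟨12, -2, [], [(2, [(3, 2)]), (2, []), (3, [(5, 3), (13,
     12)])]⟩]⟩), (11, ⟨10, 3, 3, [⟨6, 0, [⟨false, 0, 6, 0, .trivial⟩], [(2, []), (2, [(5, 4)]), (2,
     [(199, 8)]), (2, []), (2, [(31, 32)]), (3, [(7, 3), (23, 24), (71, 24)]), (7, [(13, 7), (223,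
     224)])]⟩]⟩)],
   [(13, ⟨649, 180, 29, [⟨6, 0, [⟨false, 0, 6, 0, .trivial⟩], [(2, []), (2, [(11, 4)]), (2, [(7,
     8)]), (2, [(47, 16)]), (2, [(1567, 32)]), (2, [(257, 64)])]⟩, ⟨7, 1, [⟨false, 0, 7, 1,
     (.half 11)⟩], [(2, []), (2, [(11, 4), (59, 4)])]⟩, ⟨7, -1, [], [(2, [(3, 1)])]⟩, ⟨19, 5, [],
     [(2, [(3, 1)])]⟩, ⟨19, -5, [], [(3, [(433, 3)])]⟩, ⟨33, 9, [⟨false, 0, 33, 3, (.half 11)⟩],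
     [(2, []), (2, [(59, 4)]), (2, [(17, 8)])]⟩, ⟨33, -9, [], [(5, [(61, 5), (211, 5)])]⟩, ⟨58, 16,
     [⟨false, 0, 58, 4, (.symbol 1 29 9 [1, 3, 9])⟩], [(2, []), (2, [(11, 4), (59, 4)]), (2, [(7,
     8)]), (3, [(433, 3)]), (3, []), (5, [(61, 5), (739, 20)]), (11, [(199, 33), (881, 55), (2969,
     990)])]⟩, ⟨58, -16, [], [(2, [(3, 1)])]⟩]⟩)],
   [(546, ⟨701, 30, 0, [⟨1, 0, [⟨false, 0, 1, 0, .trivial⟩], [(2, []), (2, []), (2, []), (2, [(17,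
     16)]), (2, [(449, 32)]), (3, [(61, 3), (97, 96)])]⟩]⟩)],
   [(70, ⟨251, 30, 4, [⟨3, 0, [⟨false, 0, 3, 0, .trivial⟩], [(2, []), (2, []), (2, []), (2, [(17,
     16), (1409, 16)])]⟩, ⟨17, 2, [], [(2, [(5, 1)])]⟩, ⟨17, -2, [], [(2, [(5, 1)])]⟩]⟩)],
   [(5, ⟨9, 4, 10, [⟨12, 0, [⟨false, 0, 12, 0, .trivial⟩], [(2, []), (2, []), (2, [(7, 8), (23,
     8)]), (2, []), (5, [(1601, 80)])]⟩, ⟨18, 6, [], [(13, [(79, 13), (521, 13)])]⟩, ⟨18, -6, [],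
     [(2, []), (3, [(19, 3), (17, 6)])]⟩]⟩)],
   [(51, ⟨50, 7, 2, [⟨4, 0, [⟨false, 0, 4, 0, .trivial⟩], [(2, []), (2, [(5, 4)]), (2, []), (2, []),
     (2, [(449, 32)]), (7, [(181, 7), (113, 56)])]⟩]⟩)],
   [(102, ⟨101, 10, 2, [⟨3, 0, [⟨false, 0, 3, 0, .trivial⟩], [(2, []), (2, []), (2, [(23, 8)]), (2,
     []), (2, []), (3, [(7, 3), (67, 6), (719, 48)]), (7, [(1093, 28), (43, 42), (83, 42), (449,
     224)])]⟩]⟩)],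
   [(6, ⟨5, 2, 7, [⟨15, 3, [], [(2, []), (2, [(5, 4)]), (3, [(97, 12)])]⟩, ⟨15, -3, [], [(2, []),
     (2, [(5, 4)]), (3, [(97, 12)])]⟩]⟩), (19, ⟨170, 39, 15, [⟨15, 3, [], [(3, [(11, 3), (31,
     3)])]⟩, ⟨15, -3, [], [(3, [(11, 3), (31, 3)])]⟩, ⟨23, 5, [], [(2, [(13, 1)])]⟩, ⟨23, -5, [],
     [(2, [(13, 1)])]⟩]⟩), (114, ⟨1025, 96, 6, [⟨3, 0, [⟨false, 0, 3, 0, .trivial⟩], [(2, []), (2,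
     [(5, 4)]), (2, []), (2, [(47, 16)]), (3, [(293, 3)]), (5, [(29, 15), (79, 80)])]⟩]⟩)],
   [(6, ⟨5, 2, 7, [⟨14, 1, [⟨false, 0, 14, 1, (.symbolAdd 1 1 6 5 2 14 false 1 101 99 [1, 3, 9, 11,
     33])⟩], [(2, []), (2, [(5, 4)]), (2, [(7, 8)]), (3, [(97, 12)]), (3, [(971, 9), (17, 18)]), (5,
     [(109, 5), (241, 120)]), (11, [(23, 11), (131, 22), (859, 66)])]⟩, ⟨14, -1, [], [(2, []), (2,
     [(5, 4)]), (3, [(11, 3), (97, 12)])]⟩, ⟨22, 7, [], [(3, [(11, 3)])]⟩, ⟨22, -7, [⟨false, 1, 26,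
     3, (.symbol 1 13 9 [1, 3, 9])⟩, ⟨false, 3, 2354, 31, (.symbol 1 1177 15 [3, 15])⟩], [(2, []),
     (2, [(5, 4)]), (2, [(7, 8)]), (3, []), (3, [(17, 18)]), (5, [(109, 5), (89, 10), (1901, 20),
     (59, 30), (241, 120)]), (11, [(659, 22), (593, 198)])]⟩]⟩), (190, ⟨52021, 3774, 28, [⟨14, 1,
     [⟨false, 0, 14, 1, (.symbol 1 7 1 [1])⟩], [(2, []), (2, []), (2, []), (2, []), (3, [(79, 3),
     (7, 6), (433, 48)]), (3, [(359, 72)])]⟩, ⟨14, -1, [], [(2, [(3, 1)])]⟩]⟩), (285, ⟨2431, 144, 4,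
     [⟨2, 0, [⟨false, 0, 2, 0, .trivial⟩], [(2, []), (2, [(13, 4)]), (2, []), (2, [(2657, 16)])]⟩,
     ⟨17, 1, [⟨false, 0, 17, 1, (.half 17)⟩], [(2, []), (2, [(11, 4)]), (2, [(41, 8)])]⟩, ⟨17, -1,
     [], [(2, [(3, 1)])]⟩]⟩)],
   [(15, ⟨4, 1, 2, [⟨12, 2, [], [(2, [(3, 1)])]⟩, ⟨12, -2, [⟨false, 1, 18, 2,
     (.symbolAdd 2 2 60 31 4 9 true 0 261 7 [1, 7])⟩], [(2, []), (2, []), (2, [(31, 8)]), (2, []),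
     (3, [(7, 6), (61, 12), (23, 24), (47, 48)]), (7, [(13, 7), (43, 7)])]⟩]⟩), (21, ⟨55, 12, 8,
     [⟨9, 1, [⟨false, 0, 9, 1, (.half 5)⟩], [(2, []), (2, [(5, 4), (11, 4)])]⟩, ⟨9, -1, [], [(2,
     [(3, 1)])]⟩, ⟨12, 2, [], [(2, [(3, 1)])]⟩, ⟨12, -2, [], [(2, []), (2, [(5, 4)]), (2, [(23, 8),
     (263, 8)])]⟩, ⟨33, 7, [], [(2, []), (5, [(29, 5), (19, 10), (631, 10)])]⟩, ⟨33, -7, [], [(2,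
     [(3, 1)])]⟩]⟩), (35, ⟨6, 1, 1, [⟨6, 0, [⟨false, 0, 6, 0, .trivial⟩], [(2, []), (2, []), (2,
     [(71, 8)]), (2, [(17, 16), (593, 16)]), (7, [(1847, 7), (7, 14), (29, 28), (449, 56)])]⟩]⟩)],
   [(154, ⟨21295, 1716, 24, [⟨3, 0, [⟨false, 0, 3, 0, .trivial⟩], [(2, []), (2, [(5, 4)]), (2, [(79,
     8)]), (2, [(17, 16)]), (5, [(919, 5), (211, 10), (41, 40)])]⟩, ⟨25, 2, [], [(2, [(3, 1)])]⟩,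
     ⟨25, -2, [], [(2, [(13, 1)])]⟩]⟩)],
   [(1518, ⟨1013, 26, 0, [⟨1, 0, [⟨false, 0, 1, 0, .trivial⟩], [(2, []), (2, [(1013, 4)]), (2, []),
     (2, []), (2, [(31, 32), (223, 32), (383, 32)])]⟩]⟩)],
   [(46, ⟨24335, 3588, 97, [⟨6, 0, [⟨false, 0, 6, 0, .trivial⟩], [(2, []), (2, [(5, 4)]), (2,
     [(2543, 8)]), (2, []), (2, []), (7, [(83, 28), (223, 28), (2129, 56), (449, 224)])]⟩, ⟨190, 28,
     [], [(2, [(23, 1)])]⟩, ⟨190, -28, [], [(2, [(13, 2)])]⟩]⟩)],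
   [(2, ⟨3, 2, 21, [⟨30, 0, [⟨false, 0, 30, 0, .trivial⟩], [(2, []), (2, []), (2, []), (2, [(577,
     16)])]⟩]⟩)],
   [(78, ⟨53, 6, 2, [⟨5, 0, [⟨false, 0, 5, 0, .trivial⟩], [(2, []), (2, [(53, 4)]), (2, [(137, 8)]),
     (2, []), (3, [(107, 3), (7, 6)]), (5, [(1031, 5), (359, 10), (79, 80), (479, 240)])]⟩]⟩)],
   [(26, ⟨51, 10, 8, [⟨9, 0, [⟨false, 0, 9, 0, .trivial⟩], [(2, []), (2, [(17, 4)]), (2, [(7, 8),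
     (743, 8)]), (2, []), (3, [(1249, 48)])]⟩]⟩)],
   [(2, ⟨3, 2, 23, [⟨36, 9, [⟨false, 0, 36, 3, (.unit 1 9 2 3 2 2 1 7 2 7 21 21 (23, 16) (8, 6))⟩,
     ⟨false, 4, 28116, 141, (.symbol 2 7029 15 [5, 15])⟩], [(2, []), (2, []), (2, [(17, 8)]), (2,
     []), (3, [(97, 48)]), (3, [(199, 9), (73, 36)]), (5, [(41, 5), (29, 10), (31, 15), (601, 60),
     (2699, 180)]), (7, [(239, 7), (139, 140), (673, 336)])]⟩, ⟨36, -9, [], [(3, [(7, 3)])]⟩]⟩), (7,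
     ⟨8, 3, 12, [⟨18, 0, [⟨false, 0, 18, 0, .trivial⟩], [(2, []), (2, []), (2, [(127, 8)]), (2, []),
     (2, [(193, 32)]), (7, [(617, 7), (197, 28), (673, 56)])]⟩, ⟨24, 6, [], [(2, []), (7, [(7, 7),
     (617, 7), (293, 14)])]⟩, ⟨24, -6, [], [(3, [(17, 3)]), (7, [(617, 7), (41, 21)])]⟩, ⟨32, 10,
     [], [(2, [(3, 2)]), (2, []), (5, [(239, 10), (179, 20), (359, 20)])]⟩, ⟨32, -10, [⟨false, 1,
     46, 4, (.symbol 1 23 1 [1])⟩], [(2, [(3, 2)]), (2, []), (2, [(127, 8)]), (3, [(17, 3), (11,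
     12)])]⟩]⟩), (14, ⟨15, 4, 9, [⟨36, 9, [⟨false, 0, 36, 3, (.unit 1 9 14 15 4 2 7 1 2 3 5 4 (29,
     8) (14, 4))⟩], [(2, []), (2, []), (2, [(449, 8)]), (3, [(31, 3), (13, 12), (431, 24)])]⟩]⟩)],
   [(42, ⟨13, 2, 2, [⟨10, 1, [⟨false, 0, 10, 1, (.symbol 1 5 1 [1])⟩], [(2, []), (2, [(13, 4)]), (2,
     [(337, 8)]), (2, [(31, 16), (431, 16)])]⟩, ⟨10, -1, [], [(2, []), (3, [(3, 3), (5, 6)])]⟩]⟩),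
     (58, ⟨19603, 2574, 84, [⟨10, 1, [⟨false, 0, 10, 1, (.symbol 1 5 1 [1])⟩], [(2, []), (2, []),
     (2, []), (2, [(911, 16)]), (2, [(31, 32), (1951, 32)]), (5, [(491, 5), (479, 160), (1759,
     160)])]⟩, ⟨10, -1, [], [(2, [(3, 1)])]⟩, ⟨358, 47, [], [(2, [(3, 1)])]⟩, ⟨358, -47, [], [(2,
     [(11, 1)])]⟩]⟩), (609, ⟨605695, 24544, 44, [⟨2, 0, [⟨false, 0, 2, 0, .trivial⟩], [(2, []), (2,
     [(5, 4)]), (2, [(71, 8)]), (2, [(223, 16)]), (3, [(281, 3)]), (5, [(11, 10), (31, 15), (239,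
     240)])]⟩]⟩)],
   [(6, ⟨5, 2, 12, [⟨21, 1, [⟨false, 0, 21, 1, (.symbolAdd 1 1 6 5 2 21 false 0 447 315 [1, 3, 5, 7,
     9, 15, 21, 35, 45, 63, 105, 315])⟩], [(2, [(3, 2)]), (2, []), (2, [(7, 8)]), (3, [(11, 3), (97,
     12)]), (3, [(971, 9), (73, 36)]), (5, [(109, 5)]), (7, [(13, 7), (83, 7), (673, 56)])]⟩, ⟨21,
     -1, [], [(2, [(3, 2)]), (2, [(5, 4)])]⟩, ⟨27, 7, [], [(2, [(3, 2)]), (2, [(5, 4)])]⟩, ⟨27, -7,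
     [], [(2, [(3, 2)]), (3, [(11, 3)]), (3, [(971, 9), (19, 18)])]⟩]⟩), (290, ⟨579, 34, 2, [⟨3, 0,
     [⟨false, 0, 3, 0, .trivial⟩], [(2, []), (2, [(193, 4)]), (2, [(7, 8)]), (2, []), (2, [(31,
     32)]), (3, [(13, 6)]), (7, [(113, 28), (41, 42), (223, 224)])]⟩]⟩), (435, ⟨146, 7, 1, [⟨21, 1,
     [⟨false, 0, 21, 1, (.unit 1 1 435 146 7 3 145 2 7 7 6 2 (291, 14) (145, 7))⟩], [(2, [(3, 2)]),
     (2, []), (2, [(89, 8)])]⟩]⟩)],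
   [(10, ⟨19, 6, 15, [⟨17, 1, [⟨false, 0, 17, 1, (.symbol 0 17 5 [1, 5])⟩, ⟨false, 1, 383, 11,
     (.symbol 0 383 21 [1, 21])⟩], [(2, []), (2, [(19, 4)]), (2, [(7, 8)]), (3, [(13, 3)]), (5,
     [(1481, 5), (241, 15), (41, 20), (859, 20)]), (7, [(1093, 21), (167, 56)])]⟩, ⟨17, -1, [], [(2,
     [(3, 1)])]⟩, ⟨23, 5, [], [(2, [(3, 1)])]⟩, ⟨23, -5, [], [(2, []), (2, [(19, 4)]), (2, [(7, 8),
     (103, 8)])]⟩, ⟨33, 9, [⟨false, 0, 33, 3, (.symbolAdd 1 3 90 19 2 11 false 0 211 495 [3, 11, 45,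
     55, 99])⟩], [(2, []), (2, [(19, 4)]), (2, [(7, 8)]), (3, [(13, 3), (11, 12)]), (3, []), (5,
     [(1481, 5), (271, 15), (859, 20), (1259, 180)]), (11, [(89, 44), (881, 88), (199, 99)])]⟩, ⟨33,
     -9, [], [(3, [(13, 3)]), (5, [(31, 15)])]⟩]⟩), (31, ⟨1520, 273, 46, [⟨11, 1, [⟨false, 0, 11, 1,
     (.symbol 0 11 3 [1, 3])⟩], [(2, [(3, 2)]), (2, [(19, 4)]), (2, []), (3, [(1013, 6), (47,
     24)])]⟩, ⟨11, -1, [], [(2, [(7, 1)])]⟩, ⟨51, 9, [⟨false, 0, 51, 3, (.symbol 0 51 5 [1, 5])⟩],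
     [(2, []), (2, [(5, 4), (19, 4)]), (2, []), (3, [(1013, 6), (47, 24)]), (5, [(11, 10), (29,
     10)])]⟩, ⟨51, -9, [], [(2, [(7, 1)])]⟩, ⟨73, 13, [], [(2, [(7, 1)])]⟩, ⟨73, -13, [⟨false, 1,
     941, 13, (.symbol 0 941 2145 [15, 33, 39])⟩], [(2, [(3, 2)]), (2, [(19, 4)]), (2, []), (3,
     [(47, 24)]), (5, [(11, 10), (479, 20)]), (11, [(23, 11), (463, 11), (1321, 55), (131, 132)]),
     (13, [(79, 39), (937, 52), (1429, 130)])]⟩]⟩), (310, ⟨848719, 48204, 110, [⟨3, 0, [⟨false, 0,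
     3, 0, .trivial⟩], [(2, []), (2, [(311, 4)]), (2, []), (2, [(17, 16), (191, 16)]), (2, [(673,
     32)]), (3, [(7, 6), (11, 12), (23, 24)])]⟩, ⟨493, 28, [], [(2, [(13, 1)])]⟩, ⟨493, -28, [],
     [(2, [(3, 1)])]⟩]⟩)],
   [(6, ⟨5, 2, 12, []⟩), (186, ⟨7501, 550, 17, [⟨4, 0, [⟨false, 0, 4, 0, .trivial⟩], [(2, []), (2,
     []), (2, [(193, 8)]), (2, [(2719, 16)]), (3, [(3, 3), (1667, 3), (47, 48)])]⟩]⟩)],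
   [(22, ⟨197, 42, 25, [⟨12, 0, [⟨false, 0, 12, 0, .trivial⟩], [(2, []), (2, [(197, 4)]), (2, []),
     (2, []), (3, [(79, 3), (131, 6), (577, 48)])]⟩, ⟨76, 16, [⟨false, 0, 76, 4, (.symbol 2 19 3 [1,
     3])⟩], [(2, [(3, 2)]), (2, []), (2, []), (2, []), (3, [(79, 3), (577, 48)])]⟩, ⟨76, -16, [],
     [(2, [(7, 1)])]⟩]⟩)],
   [(102, ⟨101, 10, 4, [⟨21, 2, [], [(2, [(5, 1)])]⟩, ⟨21, -2, [], [(2, [(5, 1)])]⟩]⟩), (374, ⟨3365,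
     174, 6, [⟨3, 0, [⟨false, 0, 3, 0, .trivial⟩], [(2, []), (2, [(5, 4)]), (2, [(7, 8)]), (2, []),
     (2, []), (3, [(53, 3), (47, 48), (193, 96)])]⟩]⟩)],
   [(51, ⟨50, 7, 5, [⟨11, 1, [⟨false, 0, 11, 1, (.symbolAdd 1 1 51 50 7 11 true 1 137 77 [1, 7, 11,
     77])⟩], [(2, []), (2, [(5, 4)]), (2, []), (3, [(101, 3), (23, 24)]), (7, [(181, 7), (797, 7),
     (113, 56)]), (11, [(617, 22), (131, 33)])]⟩, ⟨11, -1, [], [(2, [(7, 1)])]⟩, ⟨23, 3, [], [(2,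
     [(7, 1)])]⟩, ⟨23, -3, [], [(3, [(101, 3)])]⟩]⟩), (70, ⟨251, 30, 9, [⟨11, 1, [⟨false, 0, 11, 1,
     (.symbol 0 11 3 [1, 3])⟩], [(2, [(3, 2)]), (2, [(251, 4)]), (2, []), (3, [(503, 3), (47, 24)]),
     (3, [(37, 36), (1801, 36)])]⟩, ⟨11, -1, [], [(2, [(3, 2)]), (3, [(503, 3), (167, 6)])]⟩, ⟨59,
     7, [], [(2, [(5, 1)])]⟩, ⟨59, -7, [], [(2, [(5, 1)])]⟩]⟩), (3570, ⟨239, 4, 0, [⟨1, 0, [⟨false,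
     0, 1, 0, .trivial⟩, ⟨false, 1, 239, 2, (.unit 1 1 57120 239 1 1 57120 1 239 13 17 7 (228481,
     956) (114240, 478))⟩], [(2, []), (2, []), (2, [(23, 8)]), (2, [(1297, 16), (2143, 16)]), (2,
     []), (7, [(7, 7), (71, 7), (2351, 28), (673, 224)])]⟩]⟩)],
   [(105, ⟨41, 4, 2, [⟨6, 0, [⟨false, 0, 6, 0, .trivial⟩], [(2, []), (2, [(41, 4)]), (2, []), (2,
     [(433, 16)]), (13, [(53, 52), (313, 104)])]⟩]⟩)],
   [(3, ⟨2, 1, 14, [⟨42, 12, [], [(2, []), (2, []), (2, []), (3, [(5, 3), (13, 12), (193, 24)])]⟩,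
     ⟨42, -12, [], [(3, [(5, 3)]), (5, [(19, 5), (29, 15)])]⟩]⟩), (37, ⟨73, 12, 10, [⟨16, 2, [],
     [(2, [(3, 1)])]⟩, ⟨16, -2, [], [(5, [(11, 5), (1951, 5)])]⟩, ⟨21, 3, [], [(5, [(11, 5), (1951,
     5)])]⟩, ⟨21, -3, [], [(2, []), (3, [(7, 3), (5, 6)])]⟩]⟩), (111, ⟨295, 28, 6, [⟨6, 0, [⟨false,
     0, 6, 0, .trivial⟩], [(2, []), (2, [(5, 4)]), (2, []), (2, [(17, 16)]), (2, [(353, 32)])]⟩]⟩)],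
   [(4218, ⟨231421901, 3563290, 165, [⟨1, 0, [⟨false, 0, 1, 0, .trivial⟩], [(2, []), (2, [(17, 4)]),
     (2, []), (2, []), (3, [(859, 3), (7, 6)]), (5, [(181, 10), (41, 40), (241, 240)])]⟩]⟩)],
   [(39, ⟨25, 4, 5, [⟨33, 5, [], [(2, [(3, 1)])]⟩, ⟨33, -5, [], [(2, []), (2, [(5, 4)]), (3, [(17,
     3), (7, 6)])]⟩]⟩), (114, ⟨1025, 96, 13, [⟨75, 7, [], [(3, [(7, 3), (293, 3)])]⟩, ⟨75, -7,
     [⟨false, 1, 267, 5, (.symbol 0 267 9 [1, 3, 9])⟩], [(2, [(3, 2)]), (2, []), (2, []), (2, [(47,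
     16)]), (3, [(293, 3), (23, 24)]), (3, [(503, 72), (577, 144)])]⟩]⟩), (494, ⟨73035, 3286, 25,
     [⟨3, 0, [⟨false, 0, 3, 0, .trivial⟩], [(2, []), (2, [(5, 4)]), (2, [(17, 8)]), (2, []), (2,
     [(97, 32)])]⟩]⟩)],
   [(130, ⟨6499, 570, 29, [⟨6, 0, [⟨false, 0, 6, 0, .trivial⟩], [(2, []), (2, []), (2, [(2657, 8)]),
     (2, []), (2, [(31, 32)]), (2, []), (5, [(11, 5), (239, 80), (641, 320)])]⟩, ⟨46, 4, [⟨false, 0,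
     46, 2, (.symbol 1 23 1 [1])⟩], [(2, []), (2, [(67, 4), (97, 4)]), (2, []), (3, [(7, 3), (41,
     6), (23, 24)])]⟩, ⟨46, -4, [], [(2, [(3, 1)])]⟩]⟩)],
   [(1230, ⟨491, 14, 0, [⟨2, 0, [⟨false, 0, 2, 0, .trivial⟩], [(2, []), (2, [(491, 4)]), (2, [(71,
     8)]), (2, []), (2, [(31, 32), (1759, 32)]), (2, []), (3, [(983, 3), (3, 6), (193, 192)])]⟩]⟩)],
   [(574, ⟨575, 24, 2, [⟨3, 0, [⟨false, 0, 3, 0, .trivial⟩], [(2, []), (2, [(5, 4)]), (2, [(17,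
     8)]), (2, []), (2, [(257, 32)])]⟩]⟩)],
   [(14, ⟨15, 4, 13, [⟨39, 9, [⟨false, 0, 39, 3, (.symbol 0 39 1 [1])⟩], [(2, []), (2, []), (2,
     [(449, 8)]), (2, [(191, 16), (2111, 16)])]⟩, ⟨39, -9, [], [(7, [(7, 7), (41, 7), (97,
     7)])]⟩]⟩), (43, ⟨3482, 531, 71, [⟨13, 1, [⟨false, 0, 13, 1, (.symbol 0 13 1 [1])⟩], [(2, [(3,
     2)]), (2, []), (2, [(17, 8), (23, 8)])]⟩, ⟨13, -1, [], [(2, [(59, 1)])]⟩, ⟨73, 11, [], [(2,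
     [(59, 1)])]⟩, ⟨73, -11, [], [(3, [(7, 3)])]⟩, ⟨99, 15, [], [(2, []), (3, [(11, 6), (211,
     6)])]⟩, ⟨99, -15, [], [(2, [(59, 1)])]⟩]⟩), (602, ⟨687, 28, 2, [⟨3, 0, [⟨false, 0, 3, 0,
     .trivial⟩], [(2, []), (2, [(229, 4)]), (2, []), (2, []), (2, [(31, 32), (191, 32)]), (3,
     [(1373, 6), (47, 48)]), (7, [(167, 56)])]⟩]⟩)],
   [(1419, ⟨12770, 339, 4, [⟨2, 0, [⟨false, 0, 2, 0, .trivial⟩], [(2, []), (2, [(5, 4)]), (2, [(17,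
     8)]), (2, []), (3, [(2113, 24)]), (13, [(467, 78), (1559, 104), (1249, 208)])]⟩]⟩)],
   [(165, ⟨1079, 84, 10, [⟨6, 0, [⟨false, 0, 6, 0, .trivial⟩], [(2, []), (2, []), (2, [(73, 8)]),
     (2, []), (7, [(43, 7), (2003, 14), (337, 112)])]⟩, ⟨39, 3, [], [(2, [(7, 1)])]⟩, ⟨39, -3, [],
     [(3, [(17, 3), (127, 3)])]⟩]⟩)],
   [(6, ⟨5, 2, 18, [⟨33, 3, [⟨false, 1, 201, 9, (.symbol 0 201 9 [3, 9])⟩], [(2, []), (2, [(5, 4)]),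
     (2, [(7, 8)]), (2, []), (2, [(31, 32)]), (3, [(193, 96)]), (3, [(971, 9), (19, 18)]), (5, [(89,
     10), (179, 30), (79, 80)])]⟩, ⟨33, -3, [], [(3, [(11, 3)])]⟩, ⟨39, 9, [⟨false, 0, 39, 3,
     (.symbol 0 39 9 [1, 3, 9])⟩], [(2, []), (2, [(5, 4)]), (2, [(7, 8)]), (3, [(11, 3), (97, 12)]),
     (3, [(971, 9)]), (7, [(13, 7), (83, 7), (673, 56)])]⟩, ⟨39, -9, [], [(11, [(23, 11)])]⟩]⟩),
     (115, ⟨1126, 105, 16, [⟨13, 1, [⟨false, 0, 13, 1, (.symbol 0 13 9 [1, 3, 9])⟩], [(2, [(7, 2)]),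
     (2, [(563, 4)]), (2, []), (3, [(2251, 6), (71, 24)]), (3, [(19, 18)]), (5, [(179, 5), (59, 30),
     (89, 90)])]⟩, ⟨13, -1, [], [(2, [(3, 1)])]⟩, ⟨33, 3, [], [(2, [(5, 1)])]⟩, ⟨33, -3, [], [(2,
     [(5, 1)])]⟩]⟩), (690, ⟨1471, 56, 3, [⟨3, 0, [⟨false, 0, 3, 0, .trivial⟩], [(2, []), (2, []),
     (2, [(281, 8)]), (2, []), (2, []), (2, []), (3, [(109, 3), (383, 192), (2687, 192)])]⟩]⟩)],
   [(6, ⟨5, 2, 18, [⟨41, 10, [], [(2, []), (5, [(109, 5), (89, 10)])]⟩, ⟨41, -10, [], [(7, [(13, 7),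
     (83, 7)])]⟩, ⟨55, 18, [], [(3, [(11, 3)])]⟩, ⟨55, -18, [], [(11, [(23, 11)])]⟩]⟩), (6486,
     ⟨2255, 28, 0, [⟨1, 0, [⟨false, 0, 1, 0, .trivial⟩], [(2, []), (2, [(5, 4)]), (2, []), (2, [(17,
     16)]), (5, [(149, 5), (59, 10), (619, 20), (199, 40)]), (11, [(109, 11), (263, 88)])]⟩]⟩)],
   [(3, ⟨2, 1, 19, [⟨48, 4, [⟨false, 0, 48, 2, (.unit 1 4 3 2 1 3 1 47 4 47 1081 1081 (111, 64) (28,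
     16))⟩], [(2, [(3, 2)]), (2, []), (2, [(7, 8)]), (3, [(13, 12)]), (23, [(3037, 92), (137, 138),
     (919, 184), (829, 276), (1657, 276), (12697, 276)]), (47, [(1129, 47), (4229, 141), (1693,
     188), (13537, 1128)])]⟩, ⟨48, -4, [], [(2, [(3, 2)]), (5, [(19, 5), (11, 10)])]⟩]⟩), (47, ⟨48,
     7, 8, [⟨12, 0, [⟨false, 0, 12, 0, .trivial⟩], [(2, []), (2, []), (2, [(17, 8), (271, 8)]), (2,
     []), (2, []), (3, [(97, 3), (37, 12), (191, 96), (383, 96)])]⟩]⟩), (141, ⟨95, 8, 4, [⟨48, 4,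
     [⟨false, 0, 48, 2, (.unit 1 4 141 95 8 3 47 1 4 7 8 6 (189, 16) (94, 8))⟩], [(2, [(3, 2)]), (2,
     [(19, 4)]), (3, [(191, 3), (7, 6)])]⟩]⟩)],
   [],
   [(6, ⟨5, 2, 20, [⟨35, 0, [⟨false, 0, 35, 0, .trivial⟩], [(2, []), (2, []), (2, []), (2, []), (2,
     [(31, 32)]), (3, [(11, 3), (3, 6), (193, 96)]), (5, [(89, 10), (1901, 20), (241, 120)])]⟩, ⟨49,
     14, [], [(7, [(13, 7), (83, 7)])]⟩, ⟨49, -14, [], [(3, [(11, 3)])]⟩]⟩), (70, ⟨251, 30, 13,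
     [⟨35, 4, [⟨false, 0, 35, 2, (.symbolAdd 2 1 1120 126001 3765 35 false 0 2345 39 [1, 3, 13,
     39])⟩], [(2, [(3, 2)]), (2, []), (2, []), (2, [(17, 16)]), (3, [(167, 6), (911, 48)]), (13,
     [(103, 52), (1091, 52), (389, 78)])]⟩, ⟨35, -4, [], [(2, [(3, 2)]), (3, [(503, 3), (167,
     6)])]⟩]⟩)],
   [(34, ⟨35, 6, 10, [⟨15, 0, [⟨false, 0, 15, 0, .trivial⟩], [(2, []), (2, [(7, 4)]), (2, [(31, 8),
     (79, 8)]), (2, []), (5, [(11, 10), (439, 10), (61, 20), (479, 80)]), (11, [(89, 44), (2111,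
     176)])]⟩, ⟨19, 2, [], [(2, [(3, 2)]), (2, []), (2, [(31, 8), (79, 8)])]⟩, ⟨19, -2, [], [(2,
     [(3, 2)]), (2, [(5, 4)])]⟩, ⟨49, 8, [], [(2, [(3, 2)]), (2, []), (5, [(11, 10), (61, 20)])]⟩,
     ⟨49, -8, [], [(3, [(71, 3)])]⟩]⟩)]]

theorem sumCheckFrom_quarticCerts : sumCheckFrom 1 quarticCerts = true := by
  decide +kernel

/-- For `1 ≤ d ≤ 50`, the only integer solutions of
`∑_{i=1}^{2d+1} (−1)^{i−1}(x+i)³ = z²` are `(x, z) = (−d−1, 0)` together with the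
triples `(d, x, ±z)` appearing in `squareSolList`; conversely each listed `(d, x, z)`
(with either sign of `z`) is a solution. -/
theorem alternating_cubes_p_eq_two :
    (∀ d : ℕ, 1 ≤ d → d ≤ 50 → ∀ x z : ℤ,
      altCubeSum d x = z ^ 2 →
        (x = -((d : ℤ) + 1) ∧ z = 0) ∨
        (∃ t ∈ squareSolList, d = t.1 ∧ x = t.2.1 ∧ (z = t.2.2 ∨ z = -t.2.2))) ∧
    (∀ t ∈ squareSolList, altCubeSum t.1 t.2.1 = t.2.2 ^ 2) := by
  refine ⟨fun d hd hd' x z h => ?_, altCubeSum_eq_of_mem⟩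
  obtain ⟨Qs, hc⟩ := exists_of_sumCheckFrom sumCheckFrom_quarticCerts hd
    (by rw [show quarticCerts.length = 50 from rfl]; omega)
  exact eq_or_exists_of_sumCheck hd hc h
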